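/- Let g be a complete Riemannian metric without conjugate points on ℝ², let p ∈ ℝ², and define F_p(r) := ∫_{σ⁻¹(cl B(p,r))} U² dμ, where U comes from Hopf's construction and cl denotes closure. Then F_p : (0,∞) → [0,∞) is non-decreasing and locally absolutely continuous, and the differential inequality F_p(r) ≤ 2π·A_p''(r) + √(2π)·(F_p'(r)·A_p'(r))^{1/2} − 4π² holds for almost every r > 0. -/

import Mathlib

open MeasureTheory Filter Set Real
open scoped ENNReal NNReal

noncomputable section

/-- Points / tangent vectors of the plane. -/
abbrev V2 : Type := Fin 2 → ℝ

/-- Componentwise velocity of a curve in the plane. -/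
def vel (γ : ℝ → V2) (t : ℝ) : V2 := fun k => deriv (fun s => γ s k) t

/-- Componentwise acceleration of a curve in the plane. -/
def acc (γ : ℝ → V2) (t : ℝ) : V2 := fun k => deriv (fun s => vel γ s k) t

/-- The deck transformation `τⁿ(x,y) = (x+n,y)`. -/
def shift (n : ℤ) (p : V2) : V2 := p + (n : ℝ) • (Pi.single 0 1 : V2)

/-- A (smooth) Riemannian metric on the plane ℝ²: a smooth family of
positive-definite symmetric matrices. -/
structure RMetric where
  g : V2 → Matrix (Fin 2) (Fin 2) ℝ
  smooth : ∀ i j, ContDiff ℝ (⊤ : ℕ∞) fun p => g p i j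
  symm : ∀ p, (g p).IsSymm
  posDef : ∀ p, (g p).PosDef

/-- `B` has tangent direction `τ` at `p`. -/
def TangentDirAt (B : Set V2) (p τ : V2) : Prop :=
  τ ≠ 0 ∧ ∀ ε > 0, ∃ δ > 0, ∀ q ∈ B, q ≠ p → ‖q - p‖ < δ →
    ∃ s : ℝ, ‖q - p - s • τ‖ ≤ ε * ‖q - p‖

/-- `B` is, near `x`, after a bi-Lipschitz change of coordinates, the graph of a
Lipschitz function. -/
def IsLipGraphAt (B : Set V2) (x : V2) : Prop :=
  ∃ U : Set V2, IsOpen U ∧ x ∈ U ∧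
    ∃ (φ : V2 → ℝ × ℝ) (ψ : ℝ × ℝ → V2) (L : NNReal) (f : ℝ → ℝ),
      LipschitzOnWith L φ U ∧ LipschitzOnWith L ψ (φ '' U) ∧
      (∀ y ∈ U, ψ (φ y) = y) ∧ LipschitzWith L f ∧
      ∀ y ∈ U, (y ∈ B ↔ (φ y).2 = f (φ y).1)

/-- A (compact) 1-dimensional strong Lipschitz submanifold of the plane. -/
def IsStrongLipschitzCurve (B : Set V2) : Prop := ∀ x ∈ B, IsLipGraphAt B x

/-- `Q` is the closure of its interior and its boundary `Q \ int Q` is a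
1-dimensional strong Lipschitz submanifold. -/
def HasStrongLipschitzBoundary (Q : Set V2) : Prop :=
  Q = closure (interior Q) ∧ IsStrongLipschitzCurve (Q \ interior Q)

/-- Absolute continuity of `F` on `[a,b]`. -/
def AbsContOn (F : ℝ → ℝ) (a b : ℝ) : Prop :=
  ∀ ε > 0, ∃ δ > 0, ∀ n : ℕ, ∀ I : Fin n → ℝ × ℝ,
    (∀ i, a ≤ (I i).1 ∧ (I i).1 ≤ (I i).2 ∧ (I i).2 ≤ b) →
    (∀ i j, i ≠ j → Disjoint (Set.Ioo (I i).1 (I i).2) (Set.Ioo (I j).1 (I j).2)) →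
    (∑ i, ((I i).2 - (I i).1)) < δ → (∑ i, |F (I i).2 - F (I i).1|) < ε

/-- Local absolute continuity on a set: absolute continuity on every compact
subinterval. -/
def LocAbsContOn (F : ℝ → ℝ) (s : Set ℝ) : Prop :=
  ∀ a ∈ s, ∀ b ∈ s, a ≤ b → AbsContOn F a b

namespace RMetric

variable (M : RMetric)

/-- The inner product `g_p(v,w)`. -/
def met (p v w : V2) : ℝ := ∑ i, ∑ j, M.g p i j * v i * w j

/-- The unit tangent bundle `T¹ = {(p,v) : g_p(v,v) = 1}`. -/
def UnitTangent : Set (V2 × V2) := {x | M.met x.1 x.2 x.2 = 1}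

/-- Riemannian length of a `C¹` curve. -/
def curveLen (γ : ℝ → V2) (a b : ℝ) : ℝ :=
  ∫ t in a..b, Real.sqrt (M.met (γ t) (vel γ t) (vel γ t))

/-- The Riemannian distance: infimum of lengths of `C¹` curves joining the points. -/
def dist (p q : V2) : ℝ :=
  sInf {L | ∃ γ : ℝ → V2, ContDiff ℝ 1 γ ∧ γ 0 = p ∧ γ 1 = q ∧ L = M.curveLen γ 0 1}

/-- Completeness of the induced metric space. -/
def Complete : Prop :=
  ∀ u : ℕ → V2, (∀ ε > 0, ∃ N, ∀ m ≥ N, ∀ n ≥ N, M.dist (u m) (u n) < ε) →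
    ∃ p, Tendsto (fun n => M.dist (u n) p) atTop (nhds 0)

/-- Open metric ball. -/
def ball (p : V2) (r : ℝ) : Set V2 := {q | M.dist p q < r}

/-- Metric sphere. -/
def sphere (p : V2) (r : ℝ) : Set V2 := {q | M.dist p q = r}

/-- Coordinate derivative `∂_d g_{ij}`. -/
def dg (d i j : Fin 2) (p : V2) : ℝ :=
  deriv (fun s : ℝ => M.g (p + s • (Pi.single d 1 : V2)) i j) 0

/-- Christoffel symbols `Γ^k_{ij}`. -/
def Γ (k i j : Fin 2) (p : V2) : ℝ :=
  (1 / 2) * ∑ l, (M.g p)⁻¹ k l * (M.dg i j l p + M.dg j i l p - M.dg l i j p)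

/-- Coordinate derivative `∂_d Γ^k_{ij}`. -/
def dΓ (d k i j : Fin 2) (p : V2) : ℝ :=
  deriv (fun s : ℝ => M.Γ k i j (p + s • (Pi.single d 1 : V2))) 0

/-- Gaussian curvature `K = R_{1212} / det g`. -/
def K (p : V2) : ℝ :=
  (∑ l, M.g p 0 l *
      (M.dΓ 0 l 1 1 p - M.dΓ 1 l 0 1 p +
        ∑ m, (M.Γ l 0 m p * M.Γ m 1 1 p - M.Γ l 1 m p * M.Γ m 0 1 p))) /
    (M.g p).det

/-- Flatness: vanishing Gaussian curvature. -/
def Flat : Prop := ∀ p, M.K p = 0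

/-- A geodesic of `g`: a `C²` solution of the geodesic equation. -/
def IsGeodesic (γ : ℝ → V2) : Prop :=
  ContDiff ℝ 2 γ ∧
    ∀ t, ∀ k, acc γ t k + ∑ i, ∑ j, M.Γ k i j (γ t) * vel γ t i * vel γ t j = 0

/-- Unit-speed curve. -/
def UnitSpeed (γ : ℝ → V2) : Prop := ∀ t, M.met (γ t) (vel γ t) (vel γ t) = 1

/-- No conjugate points: every nontrivial solution of the Jacobi equation along a
unit-speed geodesic vanishing at `a` vanishes nowhere else. -/
def NoConjugatePoints : Prop :=
  ∀ γ : ℝ → V2, M.IsGeodesic γ → M.UnitSpeed γ →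
    ∀ J : ℝ → ℝ, ContDiff ℝ 2 J →
      (∀ t, deriv (deriv J) t + M.K (γ t) * J t = 0) →
      (∃ t₀, J t₀ ≠ 0) → ∀ a, J a = 0 → ∀ t, t ≠ a → J t ≠ 0

/-- Riemannian area measure: density `√(det g)` with respect to Lebesgue measure. -/
def area : Measure V2 := volume.withDensity fun p => ENNReal.ofReal (Real.sqrt (M.g p).det)

/-- `Φ` is the geodesic flow of `g` on the unit tangent bundle. -/
def IsGeodesicFlow (Φ : V2 × V2 → ℝ → V2 × V2) : Prop :=
  ∀ x ∈ M.UnitTangent, Φ x 0 = x ∧ M.IsGeodesic (fun t => (Φ x t).1) ∧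
    ∀ t : ℝ, (Φ x t).2 = vel (fun s => (Φ x s).1) t

/-- First vector of the Gram-Schmidt `g`-orthonormal frame. -/
def E1 (p : V2) : V2 :=
  (Real.sqrt (M.met p (Pi.single 0 1) (Pi.single 0 1)))⁻¹ • (Pi.single 0 1 : V2)

def w2 (p : V2) : V2 :=
  (Pi.single 1 1 : V2) - (M.met p (Pi.single 1 1) (M.E1 p)) • M.E1 p

/-- Second vector of the Gram-Schmidt `g`-orthonormal frame. -/
def E2 (p : V2) : V2 := (Real.sqrt (M.met p (M.w2 p) (M.w2 p)))⁻¹ • M.w2 p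

/-- The `g`-unit tangent vector at `p` of angle `θ` (arclength parametrization of
the `g_p`-unit circle). -/
def unitVec (p : V2) (θ : ℝ) : V2 := Real.cos θ • M.E1 p + Real.sin θ • M.E2 p

/-- The Liouville measure on the unit tangent bundle: locally the product of the
area measure with the arclength (angle) measure on the fibers; `σ_* μ = 2π A`. -/
def liouville : Measure (V2 × V2) :=
  Measure.map (fun x : V2 × ℝ => (x.1, M.unitVec x.1 x.2))
    (M.area.prod (volume.restrict (Set.Ico 0 (2 * π))))

/-- Diameter with respect to the Riemannian distance. -/
def ediam (S : Set V2) : ℝ≥0∞ := ⨆ p ∈ S, ⨆ q ∈ S, ENNReal.ofReal (M.dist p q)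

/-- 1-dimensional Hausdorff measure (as an outer-measure set function) with
respect to the Riemannian distance. -/
def H1 (S : Set V2) : ℝ≥0∞ :=
  ⨆ (δ : ℝ) (_ : 0 < δ),
    ⨅ (U : ℕ → Set V2) (_ : S ⊆ ⋃ n, U n) (_ : ∀ n, M.ediam (U n) ≤ ENNReal.ofReal δ),
      ∑' n, M.ediam (U n)

/-- The "tube" in the unit tangent bundle over `S` with angles in `Θ`. -/
def tube (S : Set V2) (Θ : Set ℝ) : Set (V2 × V2) :=
  (fun x : V2 × ℝ => (x.1, M.unitVec x.1 x.2)) '' (S ×ˢ Θ)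

/-- `ν` is the measure on `σ⁻¹(B)` which is locally the product of the
1-dimensional Hausdorff measure on `B` with the angle measure on the fibers. -/
def IsNuOn (B : Set V2) (ν : Measure (V2 × V2)) : Prop :=
  ν {x : V2 × V2 | x.1 ∉ B} = 0 ∧
    ∀ S : Set V2, ∀ Θ : Set ℝ, S ⊆ B → MeasurableSet Θ → Θ ⊆ Set.Ico 0 (2 * π) →
      ν (M.tube S Θ) = M.H1 S * volume Θ

/-- Locally bounded function on the unit tangent bundle. -/
def LocBddUT (f : V2 × V2 → ℝ) : Prop :=
  ∀ R : ℝ, ∃ Cb : ℝ, ∀ x ∈ M.UnitTangent, ‖x.1‖ ≤ R → |f x| ≤ Cb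

/-- Locally bounded function on `T¹ × ℝ`. -/
def LocBddHopf (u : (V2 × V2) × ℝ → ℝ) : Prop :=
  ∀ R : ℝ, ∃ Cb : ℝ, ∀ x ∈ M.UnitTangent, ‖x.1‖ ≤ R → ∀ t : ℝ, |t| ≤ R → |u (x, t)| ≤ Cb

/-- The function `u` produced by E. Hopf's construction: Borel measurable, locally
bounded, solving the Riccati equation along every unit-speed geodesic, and
invariant under the geodesic flow. -/
def IsHopfSolution (Φ : V2 × V2 → ℝ → V2 × V2) (u : (V2 × V2) × ℝ → ℝ) : Prop :=
  Measurable u ∧ M.LocBddHopf u ∧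
    (∀ x ∈ M.UnitTangent, ∀ t : ℝ,
      HasDerivAt (fun s => u (x, s)) (-(u (x, t)) ^ 2 - M.K ((Φ x t).1)) t) ∧
    ∀ x ∈ M.UnitTangent, ∀ s t : ℝ, u (x, s + t) = u (Φ x s, t)

/-- `n` is the inner (w.r.t. `Q`) unit normal of the curve `B` at `p`. -/
def IsInnerUnitNormalAt (Q B : Set V2) (p n : V2) : Prop :=
  M.met p n n = 1 ∧ (∃ τ, TangentDirAt B p τ ∧ M.met p n τ = 0) ∧
    ∀ᶠ t in nhdsWithin (0 : ℝ) (Set.Ioi 0), p + t • n ∈ interior Q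

end RMetric

/-- A Riemannian metric on the cylinder `C = S¹ × ℝ`, modeled by a metric on ℝ²
invariant under the translation `τ(x,y) = (x+1,y)`. -/
structure CylMetric where
  M : RMetric
  invariant : ∀ p, M.g (shift 1 p) = M.g p

/-- τ-invariant subsets of ℝ², i.e. subsets of the cylinder. -/
def InvSet (S : Set V2) : Prop := ∀ p, p ∈ S ↔ shift 1 p ∈ S

/-- The fundamental strip `[0,1) × ℝ`. -/
def strip : Set V2 := {p : V2 | p 0 ∈ Set.Ico (0 : ℝ) 1}

namespace CylMetric

variable (C : CylMetric)

/-- The distance on the cylinder: `d(p,q) = min_n d̃(p̃, τⁿ q̃)`. -/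
def cdist (p q : V2) : ℝ := ⨅ n : ℤ, C.M.dist p (shift n q)

/-- Metric ball in the cylinder. -/
def cball (p : V2) (r : ℝ) : Set V2 := {q | C.cdist p q < r}

/-- Metric sphere in the cylinder. -/
def csphere (p : V2) (r : ℝ) : Set V2 := {q | C.cdist p q = r}

/-- Completeness of the cylinder. -/
def Complete : Prop :=
  ∀ u : ℕ → V2, (∀ ε > 0, ∃ N, ∀ m ≥ N, ∀ n ≥ N, C.cdist (u m) (u n) < ε) →
    ∃ p, Tendsto (fun n => C.cdist (u n) p) atTop (nhds 0)

/-- Area measure on the cylinder, computed in the fundamental strip. -/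
def carea (S : Set V2) : ℝ≥0∞ := C.M.area (S ∩ strip)

/-- The length `l(p)` of a shortest non-contractible loop based at `p`:
`l(p) = min_{n ≠ 0} d̃(p̃, τⁿ p̃)`. -/
def loopLen (p : V2) : ℝ := ⨅ n : {n : ℤ // n ≠ 0}, C.M.dist p (shift n.1 p)

/-- Diameter with respect to the cylinder distance. -/
def ediamC (S : Set V2) : ℝ≥0∞ := ⨆ p ∈ S, ⨆ q ∈ S, ENNReal.ofReal (C.cdist p q)

/-- 1-dimensional Hausdorff measure of a (τ-invariant) subset of the cylinder. -/
def cH1 (S : Set V2) : ℝ≥0∞ :=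
  ⨆ (δ : ℝ) (_ : 0 < δ),
    ⨅ (U : ℕ → Set V2) (_ : S ∩ strip ⊆ ⋃ n, U n)
      (_ : ∀ n, C.ediamC (U n) ≤ ENNReal.ofReal δ),
      ∑' n, C.ediamC (U n)

/-- Distance from a point to a set in the cylinder. -/
def cinfDist (p : V2) (S : Set V2) : ℝ := ⨅ q : S, C.cdist p (q : V2)

/-- A neighborhood of the end `ℰ₊` (`pos = true`) resp. `ℰ₋` (`pos = false`). -/
def EndNbhd (U : Set V2) (pos : Bool) : Prop :=
  InvSet U ∧ ∃ c : ℝ, 0 < c ∧ ∀ p : V2, (if pos then c < p 1 else p 1 < -c) → p ∈ U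

/-- The end has subquadratic area growth. -/
def Subquadratic (pos : Bool) : Prop :=
  ∃ U : Set V2, EndNbhd U pos ∧ ∃ p : V2,
    Filter.liminf (fun r : ℝ => C.carea (U ∩ C.cball p r) / ENNReal.ofReal (r ^ 2)) atTop = 0

/-- A sequence converging to the end `ℰ₊` resp. `ℰ₋`. -/
def TendstoEnd (p : ℕ → V2) (pos : Bool) : Prop :=
  Tendsto (fun i => p i 1) atTop (if pos then atTop else atBot)

/-- The end opens less than linearly. -/
def OpensLessThanLinearly (pos : Bool) : Prop :=
  ∃ p : ℕ → V2, TendstoEnd p pos ∧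
    Tendsto (fun i => C.loopLen (p i) / C.cdist (p i) (p 0)) atTop (nhds 0)

/-- A ray in the cylinder. -/
def IsRay (γ : ℝ → V2) : Prop := ∀ s ≥ (0:ℝ), ∀ t ≥ (0:ℝ), C.cdist (γ s) (γ t) = |s - t|

/-- A ray converging to the end `ℰ₊` resp. `ℰ₋`. -/
def RayToEnd (γ : ℝ → V2) (pos : Bool) : Prop :=
  C.IsRay γ ∧ Tendsto (fun t => γ t 1) atTop (if pos then atTop else atBot)

/-- A minimal geodesic line in the cylinder. -/
def IsMinimalLine (γ : ℝ → V2) : Prop :=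
  C.M.IsGeodesic γ ∧ ∀ s t : ℝ, C.cdist (γ s) (γ t) = |s - t|

/-- The line joins the two ends of the cylinder. -/
def JoinsEnds (γ : ℝ → V2) : Prop :=
  Tendsto (fun t : ℝ => γ t 1) atTop atTop ∧ Tendsto (fun t : ℝ => γ t 1) atBot atBot

/-- `b` is the Busemann function of the ray `γ`: `b(p) = lim_t (d(p,γ(t)) - t)`. -/
def IsBusemann (γ : ℝ → V2) (b : V2 → ℝ) : Prop :=
  ∀ p : V2, Tendsto (fun t : ℝ => C.cdist p (γ t) - t) atTop (nhds (b p))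

end CylMetric

end

section OrdinaryDifferentialEquations

variable {E : Type*} [NormedAddCommGroup E] [NormedSpace ℝ E] [ProperSpace E]

theorem exists_lipschitzOnWith_closedBall_of_contDiff {F : Type*} [NormedAddCommGroup F]
    [NormedSpace ℝ F] {f : E → F} (hf : ContDiff ℝ 1 f) (R : ℝ) :
    ∃ K : ℝ≥0, LipschitzOnWith K f (Metric.closedBall 0 R) :=
  LocallyLipschitzOn.exists_lipschitzOnWith_of_compact (isCompact_closedBall _ _)
    hf.locallyLipschitz.locallyLipschitzOn

omit [NormedSpace ℝ E] [ProperSpace E] in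
theorem exists_bound_of_continuous {α : ℝ → E} (hα : Continuous α) (T : ℝ) :
    ∃ R : ℝ, ∀ t ∈ Icc 0 T, ‖α t‖ ≤ R :=
  isCompact_Icc.exists_bound_of_continuousOn hα.continuousOn

/-- Locally Lipschitz dependence of the solutions of an autonomous ODE on the initial value. -/
theorem exists_lipschitz_dependence_forward {f : E → E} (hf : ContDiff ℝ 1 f) {α : ℝ → E}
    (hα : ∀ t, HasDerivAt α (f (α t)) t) (T : ℝ) :
    ∃ δ > 0, ∃ C > 0, ∀ β : ℝ → E, (∀ t, HasDerivAt β (f (β t)) t) → ‖β 0 - α 0‖ < δ →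
      ∀ t ∈ Icc 0 T, ‖β t - α t‖ ≤ C * ‖β 0 - α 0‖ ∧ ‖β t - α t‖ ≤ 1 := by
  have hαc : Continuous α := continuous_iff_continuousAt.2 fun t => (hα t).continuousAt
  obtain ⟨R, hR⟩ := exists_bound_of_continuous hαc T
  obtain ⟨K, hK⟩ := exists_lipschitzOnWith_closedBall_of_contDiff hf (R + 1)
  have key : ∀ β : ℝ → E, (∀ t, HasDerivAt β (f (β t)) t) → ∀ t₀ ∈ Icc 0 T,
      (∀ t ∈ Ico 0 t₀, ‖β t - α t‖ ≤ 1) →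
      ‖β t₀ - α t₀‖ ≤ exp (K * T) * ‖β 0 - α 0‖ := by
    intro β hβ t₀ ht₀ hb
    have hβc : Continuous β := continuous_iff_continuousAt.2 fun t => (hβ t).continuousAt
    have := dist_le_of_trajectories_ODE_of_mem (v := fun _ => f)
      (s := fun _ => Metric.closedBall 0 (R + 1)) (K := K) (f := β) (g := α) (a := 0) (b := t₀)
      (δ := ‖β 0 - α 0‖) (fun _ _ => hK) hβc.continuousOn (fun t _ => (hβ t).hasDerivWithinAt)
      (fun t ht => by
        rw [mem_closedBall_zero_iff]
        have h1 := hb t ht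
        have h2 := hR t ⟨ht.1, ht.2.le.trans ht₀.2⟩
        have : β t = (β t - α t) + α t := by abel
        rw [this]
        exact (norm_add_le _ _).trans (by linarith))
      hαc.continuousOn (fun t _ => (hα t).hasDerivWithinAt)
      (fun t ht => by
        rw [mem_closedBall_zero_iff]
        have h2 := hR t ⟨ht.1, ht.2.le.trans ht₀.2⟩
        linarith)
      (by rw [dist_eq_norm]) t₀ ⟨ht₀.1, le_rfl⟩
    rw [dist_eq_norm, sub_zero, mul_comm] at this
    refine this.trans (mul_le_mul_of_nonneg_right ?_ (norm_nonneg _))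
    exact exp_le_exp.2 (mul_le_mul_of_nonneg_left ht₀.2 K.2)
  refine ⟨exp (-(K * T)), exp_pos _, exp (K * T), exp_pos _, fun β hβ h0 => ?_⟩
  have hβc : Continuous β := continuous_iff_continuousAt.2 fun t => (hβ t).continuousAt
  have hsmall : exp (K * T) * ‖β 0 - α 0‖ < 1 := by
    calc exp (K * T) * ‖β 0 - α 0‖ < exp (K * T) * exp (-(K * T)) :=
          mul_lt_mul_of_pos_left h0 (exp_pos _)
      _ = 1 := by rw [← exp_add]; simp
  have hlt : ∀ t ∈ Icc 0 T, ‖β t - α t‖ < 1 := by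
    by_contra! hcon
    have hcomp : IsCompact (Icc 0 T ∩ {t | 1 ≤ ‖β t - α t‖}) :=
      isCompact_Icc.inter_right (isClosed_le continuous_const (hβc.sub hαc).norm)
    obtain ⟨t₀, ⟨ht₀, h1⟩, hleast⟩ := hcomp.exists_isLeast
      (by obtain ⟨t, ht, h⟩ := hcon; exact ⟨t, ht, h⟩)
    have := key β hβ t₀ ht₀ fun t ht => by
      by_contra! hc
      exact absurd (hleast ⟨⟨ht.1, ht.2.le.trans ht₀.2⟩, hc.le⟩) (not_le.2 ht.2)
    have h1' : 1 ≤ ‖β t₀ - α t₀‖ := h1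
    linarith
  intro t ht
  exact ⟨key β hβ t ht fun s hs => (hlt s ⟨hs.1, hs.2.le.trans ht.2⟩).le, (hlt t ht).le⟩

omit [ProperSpace E] in
theorem hasDerivAt_reverse {f : E → E} {α : ℝ → E} (hα : ∀ t, HasDerivAt α (f (α t)) t) (t : ℝ) :
    HasDerivAt (fun t => α (-t)) (-f (α (-t))) t := by
  have := (hα (-t)).scomp t (hasDerivAt_neg t)
  rw [neg_one_smul] at this
  exact this

theorem exists_lipschitz_dependence {f : E → E} (hf : ContDiff ℝ 1 f) {α : ℝ → E}
    (hα : ∀ t, HasDerivAt α (f (α t)) t) (T : ℝ) :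
    ∃ δ > 0, ∃ C > 0, ∀ β : ℝ → E, (∀ t, HasDerivAt β (f (β t)) t) → ‖β 0 - α 0‖ < δ →
      ∀ t, |t| ≤ T → ‖β t - α t‖ ≤ C * ‖β 0 - α 0‖ := by
  obtain ⟨δ₁, hδ₁, C₁, hC₁, h₁⟩ := exists_lipschitz_dependence_forward hf hα T
  obtain ⟨δ₂, hδ₂, C₂, hC₂, h₂⟩ := exists_lipschitz_dependence_forward (f := fun x => -f x) hf.neg
    (hasDerivAt_reverse hα) T
  refine ⟨min δ₁ δ₂, lt_min hδ₁ hδ₂, max C₁ C₂, lt_max_of_lt_left hC₁, fun β hβ h0 t ht => ?_⟩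
  rcases le_total 0 t with h | h
  · refine ((h₁ β hβ (h0.trans_le (min_le_left _ _)) t ⟨h, (abs_le.1 ht).2⟩).1).trans ?_
    gcongr
    exact le_max_left _ _
  · have := (h₂ _ (hasDerivAt_reverse hβ) (by simpa using h0.trans_le (min_le_right _ _)) (-t)
      ⟨by linarith, by linarith [(abs_le.1 ht).1]⟩).1
    simp only [neg_neg, neg_zero] at this
    refine this.trans ?_
    gcongr
    exact le_max_right _ _

theorem autonomous_ODE_unique {f : E → E} (hf : ContDiff ℝ 1 f) {α β : ℝ → E}
    (hα : ∀ t, HasDerivAt α (f (α t)) t) (hβ : ∀ t, HasDerivAt β (f (β t)) t)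
    (h0 : β 0 = α 0) : β = α := by
  funext t
  obtain ⟨δ, hδ, C, hC, h⟩ := exists_lipschitz_dependence hf hα |t|
  have := h β hβ (by simpa [h0] using hδ) t le_rfl
  rw [h0, sub_self, norm_zero, mul_zero] at this
  exact sub_eq_zero.1 (norm_le_zero_iff.1 this)

/-- A global flow of a `C¹` vector field is jointly continuous. -/
theorem continuous_uncurry_flow {f : E → E} (hf : ContDiff ℝ 1 f) {Ψ : E → ℝ → E}
    (h0 : ∀ x, Ψ x 0 = x) (hΨ : ∀ x t, HasDerivAt (Ψ x) (f (Ψ x t)) t) :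
    Continuous fun y : E × ℝ => Ψ y.1 y.2 := by
  rw [continuous_iff_continuousAt]
  rintro ⟨x, t⟩
  obtain ⟨δ, hδ, C, hC, h⟩ := exists_lipschitz_dependence hf (hΨ x) (|t| + 1)
  have hc : ContinuousAt (Ψ x) t := (hΨ x t).continuousAt
  have h1 : Tendsto (fun y : E × ℝ => C * ‖y.1 - x‖ + ‖Ψ x y.2 - Ψ x t‖) (nhds (x, t)) (nhds 0) := by
    have a1 : Tendsto (fun y : E × ℝ => C * ‖y.1 - x‖) (nhds (x, t)) (nhds 0) :=
      Continuous.tendsto' (by fun_prop) _ _ (by simp)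
    have a2 : Tendsto (fun y : E × ℝ => ‖Ψ x y.2 - Ψ x t‖) (nhds (x, t)) (nhds 0) := by
      have : Tendsto (fun y : E × ℝ => Ψ x y.2) (nhds (x, t)) (nhds (Ψ x t)) :=
        Tendsto.comp hc (continuous_snd.tendsto (x, t))
      exact tendsto_iff_norm_sub_tendsto_zero.1 this
    simpa using a1.add a2
  refine tendsto_iff_norm_sub_tendsto_zero.2 (squeeze_zero' (Eventually.of_forall fun _ =>
    norm_nonneg _) ?_ h1)
  have e1 : ∀ᶠ y : E × ℝ in nhds (x, t), ‖y.1 - x‖ < δ :=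
    (Continuous.tendsto' (f := fun y : E × ℝ => ‖y.1 - x‖) (by fun_prop) (x, t) 0
      (by simp)).eventually_lt_const hδ
  have e2 : ∀ᶠ y : E × ℝ in nhds (x, t), |y.2| < |t| + 1 :=
    (Continuous.tendsto' (f := fun y : E × ℝ => |y.2|) (by fun_prop) (x, t) |t|
      (by simp)).eventually_lt_const (by linarith)
  filter_upwards [e1, e2] with y hy1 hy2
  have := h (Ψ y.1) (hΨ y.1) (by simpa [h0] using hy1) y.2 hy2.le
  rw [h0, h0] at this
  calc ‖Ψ y.1 y.2 - Ψ x t‖ = ‖(Ψ y.1 y.2 - Ψ x y.2) + (Ψ x y.2 - Ψ x t)‖ := by congr 1; abel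
    _ ≤ _ := norm_add_le _ _
    _ ≤ _ := by gcongr

/-- The time-`t` map of a flow is differentiable; its derivative solves the variational
equation. -/
theorem hasFDerivAt_flow {f : E → E} (hf : ContDiff ℝ 2 f) {Ψ : E → ℝ → E}
    (h0 : ∀ x, Ψ x 0 = x) (hΨ : ∀ x t, HasDerivAt (Ψ x) (f (Ψ x t)) t) (x : E)
    (Z : ℝ → E →L[ℝ] E) (hZ0 : ∀ h, Z 0 h = h)
    (hZ : ∀ h t, HasDerivAt (fun t => Z t h) (fderiv ℝ f (Ψ x t) (Z t h)) t) (T : ℝ)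
    (hT : 0 ≤ T) : HasFDerivAt (fun y => Ψ y T) (Z T) x := by
  have hf1 : ContDiff ℝ 1 f := hf.of_le (by norm_num)
  have hdf : ContDiff ℝ 1 (fderiv ℝ f) := hf.fderiv_right (by norm_num)
  have hαc : Continuous (Ψ x) := continuous_iff_continuousAt.2 fun t => (hΨ x t).continuousAt
  obtain ⟨R, hR⟩ := exists_bound_of_continuous hαc T
  obtain ⟨L, hL⟩ := exists_lipschitzOnWith_closedBall_of_contDiff hdf (R + 1)
  obtain ⟨M, hM⟩ := (isCompact_closedBall (0 : E) (R + 1)).exists_bound_of_continuousOn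
    hdf.continuous.continuousOn
  obtain ⟨δ, hδ, C, hC, hdep⟩ := exists_lipschitz_dependence_forward hf1 (hΨ x) T
  set M' : ℝ := max M 1
  have hM'0 : M' ≠ 0 := (lt_of_lt_of_le one_pos (le_max_right _ _)).ne'
  set D : ℝ := L * C ^ 2 / M' * (exp (M' * T) - 1)
  have main : ∀ y, ‖y - x‖ < δ → ‖Ψ y T - Ψ x T - Z T (y - x)‖ ≤ D * ‖y - x‖ ^ 2 := by
    intro y hy
    have hd := hdep (Ψ y) (hΨ y) (by simpa [h0] using hy)
    rw [h0, h0] at hd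
    have hder : ∀ t, HasDerivAt (fun t => Ψ y t - Ψ x t - Z t (y - x))
        (f (Ψ y t) - f (Ψ x t) - fderiv ℝ f (Ψ x t) (Z t (y - x))) t := fun t =>
      ((hΨ y t).sub (hΨ x t)).sub (hZ _ t)
    have := norm_le_gronwallBound_of_norm_deriv_right_le (δ := 0) (K := M')
      (ε := L * C ^ 2 * ‖y - x‖ ^ 2) (a := 0) (b := T)
      (f := fun t => Ψ y t - Ψ x t - Z t (y - x))
      (fun t _ => (hder t).continuousAt.continuousWithinAt)
      (fun t _ => (hder t).hasDerivWithinAt) (by simp [h0, hZ0]) (fun t ht => by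
        have ht' : t ∈ Icc 0 T := ⟨ht.1, ht.2.le⟩
        obtain ⟨hd1, hd2⟩ := hd t ht'
        have hx1 : Ψ x t ∈ Metric.closedBall (0 : E) (R + 1) := by
          rw [mem_closedBall_zero_iff]; linarith [hR t ht']
        have hy1 : Ψ y t ∈ Metric.closedBall (0 : E) (R + 1) := by
          rw [mem_closedBall_zero_iff]
          have : Ψ y t = (Ψ y t - Ψ x t) + Ψ x t := by abel
          rw [this]
          exact (norm_add_le _ _).trans (by linarith [hR t ht'])
        have hseg : segment ℝ (Ψ x t) (Ψ y t) ⊆ Metric.closedBall (0 : E) (R + 1) :=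
          (convex_closedBall _ _).segment_subset hx1 hy1
        have hq : ‖f (Ψ y t) - f (Ψ x t) - fderiv ℝ f (Ψ x t) (Ψ y t - Ψ x t)‖
            ≤ (L * ‖Ψ y t - Ψ x t‖) * ‖Ψ y t - Ψ x t‖ :=
          Convex.norm_image_sub_le_of_norm_fderiv_le' (s := segment ℝ (Ψ x t) (Ψ y t))
            (fun z _ => (hf1.differentiable one_ne_zero) z)
            (fun z hz => by
              refine (hL.norm_sub_le (hseg hz) hx1).trans ?_
              gcongr
              exact norm_sub_le_of_mem_segment hz)
            (convex_segment _ _) (left_mem_segment ℝ _ _) (right_mem_segment ℝ _ _)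
        have hsplit : f (Ψ y t) - f (Ψ x t) - fderiv ℝ f (Ψ x t) (Z t (y - x)) =
            fderiv ℝ f (Ψ x t) (Ψ y t - Ψ x t - Z t (y - x)) +
            (f (Ψ y t) - f (Ψ x t) - fderiv ℝ f (Ψ x t) (Ψ y t - Ψ x t)) := by
          rw [map_sub (fderiv ℝ f (Ψ x t)) (Ψ y t - Ψ x t)]; abel
        rw [hsplit]
        refine (norm_add_le _ _).trans (add_le_add ?_ (hq.trans ?_))
        · refine (ContinuousLinearMap.le_opNorm _ _).trans ?_
          gcongr
          exact (hM _ hx1).trans (le_max_left _ _)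
        · calc L * ‖Ψ y t - Ψ x t‖ * ‖Ψ y t - Ψ x t‖
              ≤ L * (C * ‖y - x‖) * (C * ‖y - x‖) := by gcongr
            _ = L * C ^ 2 * ‖y - x‖ ^ 2 := by ring) T ⟨hT, le_rfl⟩
    refine this.trans (le_of_eq ?_)
    rw [gronwallBound_of_K_ne_0 hM'0]
    simp only [D]
    ring_nf
  refine HasFDerivAt.of_isLittleO ?_
  have hbig : (fun y => Ψ y T - Ψ x T - Z T (y - x)) =O[nhds x] fun y => ‖y - x‖ ^ 2 := by
    refine Asymptotics.IsBigO.of_bound D ?_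
    filter_upwards [Metric.ball_mem_nhds x hδ] with y hy
    rw [Metric.mem_ball, dist_eq_norm] at hy
    simpa using main y hy
  refine hbig.trans_isLittleO ?_
  have := Asymptotics.isLittleO_norm_pow_id (E' := E) (n := 2) (by norm_num)
  exact this.comp_tendsto (k := fun y => y - x) (tendsto_sub_nhds_zero_iff.2 tendsto_id)

end OrdinaryDifferentialEquations

noncomputable section

section PartialDerivatives

/-- Coordinate partial derivative of a function on the plane. -/
def pd (d : Fin 2) (f : V2 → ℝ) (p : V2) : ℝ := fderiv ℝ f p (Pi.single d 1)

/-- Smooth real functions on the plane. -/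
def Smooth2 (f : V2 → ℝ) : Prop := ContDiff ℝ (⊤ : ℕ∞) f

variable {f g : V2 → ℝ}

theorem Smooth2.differentiableAt (hf : Smooth2 f) (p : V2) : DifferentiableAt ℝ f p :=
  (ContDiff.differentiable hf (by simp)) p

theorem Smooth2.add (hf : Smooth2 f) (hg : Smooth2 g) : Smooth2 fun p => f p + g p :=
  ContDiff.add hf hg

theorem Smooth2.sub (hf : Smooth2 f) (hg : Smooth2 g) : Smooth2 fun p => f p - g p :=
  ContDiff.sub hf hg

theorem Smooth2.mul (hf : Smooth2 f) (hg : Smooth2 g) : Smooth2 fun p => f p * g p :=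
  ContDiff.mul hf hg

theorem Smooth2.neg (hf : Smooth2 f) : Smooth2 fun p => - f p := ContDiff.neg hf

theorem Smooth2.inv (hf : Smooth2 f) (h : ∀ p, f p ≠ 0) : Smooth2 fun p => (f p)⁻¹ :=
  ContDiff.inv hf h

theorem Smooth2.sqrt (hf : Smooth2 f) (h : ∀ p, f p ≠ 0) : Smooth2 fun p => √(f p) :=
  ContDiff.sqrt hf h

theorem Smooth2.pd (hf : Smooth2 f) (d : Fin 2) : Smooth2 (pd d f) :=
  (ContDiff.fderiv_right (m := (⊤ : ℕ∞)) hf (by simp)).clm_apply contDiff_const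

theorem fderiv_eq_sum_pd (f : V2 → ℝ) (p v : V2) :
    fderiv ℝ f p v = v 0 * pd 0 f p + v 1 * pd 1 f p := by
  have hv : v = v 0 • (Pi.single 0 1 : V2) + v 1 • (Pi.single 1 1 : V2) := by
    ext i; fin_cases i <;> simp
  conv_lhs => rw [hv]
  simp [pd]

theorem deriv_line_eq_pd (hf : Smooth2 f) (d : Fin 2) (p : V2) :
    deriv (fun s : ℝ => f (p + s • (Pi.single d 1 : V2))) 0 = pd d f p := by
  have h : HasDerivAt (fun s : ℝ => p + s • (Pi.single d 1 : V2)) (Pi.single d 1) 0 := by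
    simpa using ((hasDerivAt_id (0 : ℝ)).smul_const (Pi.single d 1 : V2)).const_add p
  have h2 : HasFDerivAt f (fderiv ℝ f p) (p + (0 : ℝ) • (Pi.single d 1 : V2)) := by
    simpa using (hf.differentiableAt p).hasFDerivAt
  exact (h2.comp_hasDerivAt 0 h).deriv

theorem pd_add (hf : Smooth2 f) (hg : Smooth2 g) (d : Fin 2) (p : V2) :
    pd d (fun p => f p + g p) p = pd d f p + pd d g p := by
  simp only [pd]
  rw [fderiv_fun_add (hf.differentiableAt p) (hg.differentiableAt p)]
  rfl

theorem pd_mul (hf : Smooth2 f) (hg : Smooth2 g) (d : Fin 2) (p : V2) :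
    pd d (fun p => f p * g p) p = pd d f p * g p + f p * pd d g p := by
  simp only [pd]
  rw [fderiv_fun_mul (hf.differentiableAt p) (hg.differentiableAt p)]
  simp
  ring

theorem pd_neg (d : Fin 2) (p : V2) : pd d (fun p => - f p) p = - pd d f p := by
  simp only [pd]
  rw [fderiv_fun_neg]
  rfl

theorem pd_const (c : ℝ) (d : Fin 2) (p : V2) : pd d (fun _ => c) p = 0 := by
  simp [pd]

theorem pd_comm (hf : Smooth2 f) (i j : Fin 2) (p : V2) :
    pd i (pd j f) p = pd j (pd i f) p := by
  have hd : DifferentiableAt ℝ (fderiv ℝ f) p :=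
    (ContDiff.differentiable (ContDiff.fderiv_right (m := (⊤ : ℕ∞)) hf (by simp)) (by simp)) p
  have key : ∀ a b : V2, fderiv ℝ (fun q => fderiv ℝ f q a) p b = fderiv ℝ (fderiv ℝ f) p b a := by
    intro a b
    rw [fderiv_clm_apply hd (differentiableAt_const _)]
    simp
  have hs : IsSymmSndFDerivAt ℝ f p :=
    ContDiffAt.isSymmSndFDerivAt (n := (⊤ : ℕ∞)) (ContDiff.contDiffAt hf)
      (by simp only [minSmoothness_of_isRCLikeNormedField]; exact WithTop.coe_le_coe.2 le_top)
  change fderiv ℝ (fun q => fderiv ℝ f q _) p _ = fderiv ℝ (fun q => fderiv ℝ f q _) p _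
  rw [key, key]
  exact hs _ _

end PartialDerivatives

namespace RMetric

variable (M : RMetric)

theorem smooth_g (i j : Fin 2) : Smooth2 fun p => M.g p i j := M.smooth i j

theorem g_symm (p : V2) : M.g p 1 0 = M.g p 0 1 := (M.symm p).apply 0 1

theorem det_pos (p : V2) : 0 < (M.g p).det := (M.posDef p).det_pos

theorem g_zero_pos (p : V2) : 0 < M.g p 0 0 := (M.posDef p).diag_pos

theorem det_eq (p : V2) : (M.g p).det = M.g p 0 0 * M.g p 1 1 - M.g p 0 1 * M.g p 0 1 := by
  rw [Matrix.det_fin_two, g_symm]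

theorem smooth_det : Smooth2 fun p => (M.g p).det := by
  simp only [det_eq]
  exact ((M.smooth_g 0 0).mul (M.smooth_g 1 1)).sub ((M.smooth_g 0 1).mul (M.smooth_g 0 1))

theorem dg_eq (d i j : Fin 2) (p : V2) : M.dg d i j p = pd d (fun p => M.g p i j) p :=
  deriv_line_eq_pd (M.smooth_g i j) d p

theorem dg_symm (d : Fin 2) (p : V2) : M.dg d 1 0 p = M.dg d 0 1 p := by
  simp only [dg_eq, g_symm]

theorem smooth_dg (d i j : Fin 2) : Smooth2 (M.dg d i j) := by
  have : M.dg d i j = pd d (fun p => M.g p i j) := funext fun p => M.dg_eq d i j p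
  rw [this]
  exact (M.smooth_g i j).pd d

theorem smooth_inv (i j : Fin 2) : Smooth2 fun p => (M.g p)⁻¹ i j := by
  have h : ∀ p, (M.g p)⁻¹ i j = (M.g p).det⁻¹ * (M.g p).adjugate i j := by
    intro p
    rw [Matrix.inv_def, Ring.inverse_eq_inv']
    rfl
  simp only [h]
  refine (M.smooth_det.inv fun p => (M.det_pos p).ne').mul ?_
  simp only [Matrix.adjugate_fin_two]
  fin_cases i <;> fin_cases j
  · exact M.smooth_g 1 1
  · exact (M.smooth_g 0 1).neg
  · exact (M.smooth_g 1 0).neg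
  · exact M.smooth_g 0 0

theorem smooth_Γ (k i j : Fin 2) : Smooth2 (M.Γ k i j) := by
  have : M.Γ k i j = fun p => (1 / 2) *
      ((M.g p)⁻¹ k 0 * (M.dg i j 0 p + M.dg j i 0 p - M.dg 0 i j p) +
       (M.g p)⁻¹ k 1 * (M.dg i j 1 p + M.dg j i 1 p - M.dg 1 i j p)) := by
    funext p
    simp [Γ, Fin.sum_univ_two]
  rw [this]
  refine Smooth2.mul contDiff_const (Smooth2.add ?_ ?_) <;>
  exact (M.smooth_inv _ _).mul (((M.smooth_dg _ _ _).add (M.smooth_dg _ _ _)).sub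
    (M.smooth_dg _ _ _))

theorem dΓ_eq (d k i j : Fin 2) (p : V2) : M.dΓ d k i j p = pd d (M.Γ k i j) p :=
  deriv_line_eq_pd (M.smooth_Γ k i j) d p

theorem Γ_symm (k i j : Fin 2) (p : V2) : M.Γ k i j p = M.Γ k j i p := by
  have h : ∀ d, M.dg d i j p = M.dg d j i p := by
    intro d
    fin_cases i <;> fin_cases j <;> simp [dg_symm]
  simp only [Γ, h]
  congr 1
  refine Finset.sum_congr rfl fun l _ => ?_
  ring

theorem smooth_K : Smooth2 M.K := by
  have : M.K = fun p => (M.g p 0 0 * (pd 0 (M.Γ 0 1 1) p - pd 1 (M.Γ 0 0 1) p +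
      ((M.Γ 0 0 0 p * M.Γ 0 1 1 p - M.Γ 0 1 0 p * M.Γ 0 0 1 p) +
        (M.Γ 0 0 1 p * M.Γ 1 1 1 p - M.Γ 0 1 1 p * M.Γ 1 0 1 p))) +
      M.g p 0 1 * (pd 0 (M.Γ 1 1 1) p - pd 1 (M.Γ 1 0 1) p +
      ((M.Γ 1 0 0 p * M.Γ 0 1 1 p - M.Γ 1 1 0 p * M.Γ 0 0 1 p) +
        (M.Γ 1 0 1 p * M.Γ 1 1 1 p - M.Γ 1 1 1 p * M.Γ 1 0 1 p)))) * ((M.g p).det)⁻¹ := by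
    funext p
    simp only [K, Fin.sum_univ_two, dΓ_eq, div_eq_mul_inv]
  rw [this]
  have G := M.smooth_Γ
  refine Smooth2.mul (Smooth2.add ((M.smooth_g _ _).mul ?_) ((M.smooth_g _ _).mul ?_))
    (M.smooth_det.inv fun p => (M.det_pos p).ne') <;>
  exact ((((G _ _ _).pd _).sub ((G _ _ _).pd _)).add
    ((((G _ _ _).mul (G _ _ _)).sub ((G _ _ _).mul (G _ _ _))).add
      (((G _ _ _).mul (G _ _ _)).sub ((G _ _ _).mul (G _ _ _)))))

theorem lower_Γ (m i j : Fin 2) (p : V2) :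
    M.g p m 0 * M.Γ 0 i j p + M.g p m 1 * M.Γ 1 i j p =
      (1 / 2) * (M.dg i j m p + M.dg j i m p - M.dg m i j p) := by
  have hu : IsUnit (M.g p).det := (M.det_pos p).ne'.isUnit
  have h := fun a b => congrFun (congrFun (Matrix.mul_nonsing_inv (M.g p) hu) a) b
  simp only [Matrix.mul_apply, Fin.sum_univ_two] at h
  simp only [Γ, Fin.sum_univ_two]
  fin_cases m
  · have h0 := h 0 0
    have h1 := h 0 1
    simp only [Matrix.one_apply, Fin.isValue, if_true, zero_ne_one, if_false] at h0 h1
    simp only [Fin.zero_eta, Fin.isValue]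
    linear_combination (1 / 2) * (M.dg i j 0 p + M.dg j i 0 p - M.dg 0 i j p) * h0 +
      (1 / 2) * (M.dg i j 1 p + M.dg j i 1 p - M.dg 1 i j p) * h1
  · have h0 := h 1 0
    have h1 := h 1 1
    simp only [Matrix.one_apply, Fin.isValue, if_true, one_ne_zero, if_false] at h0 h1
    simp only [Fin.mk_one, Fin.isValue]
    linear_combination (1 / 2) * (M.dg i j 0 p + M.dg j i 0 p - M.dg 0 i j p) * h0 +
      (1 / 2) * (M.dg i j 1 p + M.dg j i 1 p - M.dg 1 i j p) * h1

/-- The Levi-Civita connection is metric. -/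
theorem metric_compat (d m n : Fin 2) (p : V2) :
    pd d (fun p => M.g p m n) p =
      (M.g p n 0 * M.Γ 0 d m p + M.g p n 1 * M.Γ 1 d m p) +
      (M.g p m 0 * M.Γ 0 d n p + M.g p m 1 * M.Γ 1 d n p) := by
  rw [lower_Γ, lower_Γ, ← dg_eq]
  have h : M.dg d n m p = M.dg d m n p := by
    fin_cases m <;> fin_cases n <;> simp [dg_symm]
  rw [h]
  ring

theorem met_eq (p v w : V2) : M.met p v w =
    M.g p 0 0 * v 0 * w 0 + M.g p 0 1 * v 0 * w 1 +
      (M.g p 0 1 * v 1 * w 0 + M.g p 1 1 * v 1 * w 1) := by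
  simp [met, Fin.sum_univ_two, g_symm]

theorem E1_zero (p : V2) : M.E1 p 0 = (√(M.g p 0 0))⁻¹ := by
  simp [E1, met_eq]

theorem E1_one (p : V2) : M.E1 p 1 = 0 := by
  simp [E1]

theorem w2_zero (p : V2) : M.w2 p 0 = - (M.g p 0 1 * (M.g p 0 0)⁻¹) := by
  have h := M.g_zero_pos p
  have hs : √(M.g p 0 0) * √(M.g p 0 0) = M.g p 0 0 := mul_self_sqrt h.le
  have : M.w2 p 0 = - (M.g p 0 1 * (√(M.g p 0 0) * √(M.g p 0 0))⁻¹) := by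
    simp [w2, met_eq, E1_zero, E1_one]
    ring
  rw [this, hs]

theorem w2_one (p : V2) : M.w2 p 1 = 1 := by
  simp [w2, E1_one]

theorem met_w2 (p : V2) : M.met p (M.w2 p) (M.w2 p) = (M.g p).det * (M.g p 0 0)⁻¹ := by
  have h := (M.g_zero_pos p).ne'
  rw [met_eq, w2_zero, w2_one, det_eq]
  field_simp
  ring

theorem met_w2_pos (p : V2) : 0 < (M.g p).det * (M.g p 0 0)⁻¹ :=
  mul_pos (M.det_pos p) (inv_pos.2 (M.g_zero_pos p))

theorem E2_zero (p : V2) : M.E2 p 0 =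
    (√((M.g p).det * (M.g p 0 0)⁻¹))⁻¹ * (- (M.g p 0 1 * (M.g p 0 0)⁻¹)) := by
  simp only [E2, Pi.smul_apply, smul_eq_mul, met_w2, w2_zero]

theorem E2_one (p : V2) : M.E2 p 1 = (√((M.g p).det * (M.g p 0 0)⁻¹))⁻¹ := by
  simp only [E2, Pi.smul_apply, smul_eq_mul, met_w2, w2_one, mul_one]

/-- The Gram–Schmidt frame. -/
def frame (a : Fin 2) (p : V2) : V2 := if a = 0 then M.E1 p else M.E2 p

theorem frame_zero (p : V2) : M.frame 0 p = M.E1 p := by simp [frame]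

theorem frame_one (p : V2) : M.frame 1 p = M.E2 p := by simp [frame]

theorem smooth_frame (a k : Fin 2) : Smooth2 fun p => M.frame a p k := by
  have hg : ∀ p, M.g p 0 0 ≠ 0 := fun p => (M.g_zero_pos p).ne'
  have hi := (M.smooth_g 0 0).inv hg
  have hs : Smooth2 fun p => (√((M.g p).det * (M.g p 0 0)⁻¹))⁻¹ :=
    ((M.smooth_det.mul hi).sqrt fun p => (M.met_w2_pos p).ne').inv
      fun p => (sqrt_pos.2 (M.met_w2_pos p)).ne'
  fin_cases a <;> fin_cases k
  · simp only [Fin.zero_eta, frame_zero, E1_zero]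
    exact ((M.smooth_g 0 0).sqrt hg).inv fun p => (sqrt_pos.2 (M.g_zero_pos p)).ne'
  · simp only [Fin.zero_eta, Fin.mk_one, frame_zero, E1_one]
    exact contDiff_const
  · simp only [Fin.zero_eta, Fin.mk_one, frame_one, E2_zero]
    exact hs.mul ((M.smooth_g 0 1).mul hi).neg
  · simp only [Fin.mk_one, frame_one, E2_one]
    exact hs

theorem met_E1_E1 (p : V2) : M.met p (M.E1 p) (M.E1 p) = 1 := by
  have h := M.g_zero_pos p
  have hs : √(M.g p 0 0) * √(M.g p 0 0) = M.g p 0 0 := mul_self_sqrt h.le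
  have : M.met p (M.E1 p) (M.E1 p) = M.g p 0 0 * (√(M.g p 0 0) * √(M.g p 0 0))⁻¹ := by
    rw [met_eq, E1_zero, E1_one, mul_inv]; ring
  rw [this, hs, mul_inv_cancel₀ h.ne']

theorem met_E1_E2 (p : V2) : M.met p (M.E1 p) (M.E2 p) = 0 := by
  have h := (M.g_zero_pos p).ne'
  rw [met_eq, E1_zero, E1_one, E2_zero, E2_one]
  field_simp
  ring

theorem met_E2_E2 (p : V2) : M.met p (M.E2 p) (M.E2 p) = 1 := by
  have h := M.met_w2_pos p
  have h0 := (M.g_zero_pos p).ne'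
  have hs := mul_self_sqrt h.le
  set D := (M.g p).det * (M.g p 0 0)⁻¹ with hD
  have : M.met p (M.E2 p) (M.E2 p) = D * (√D * √D)⁻¹ := by
    have hmet := M.met_w2 p
    rw [met_eq, w2_zero, w2_one, ← hD] at hmet
    rw [met_eq, E2_zero, E2_one, ← hD, mul_inv]
    linear_combination (√D)⁻¹ * (√D)⁻¹ * hmet
  rw [this, hs, mul_inv_cancel₀ h.ne']

theorem frame_det (p : V2) : M.E1 p 0 * M.E2 p 1 - M.E1 p 1 * M.E2 p 0 = (√(M.g p).det)⁻¹ := by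
  have h := M.g_zero_pos p
  rw [E1_zero, E1_one, E2_one, zero_mul, sub_zero, ← mul_inv, ← sqrt_mul h.le]
  congr 2
  field_simp

/-- The pairing of the `k`-th coordinate vector with the `a`-th frame vector. -/
def coframe (a k : Fin 2) (p : V2) : ℝ := M.g p k 0 * M.frame a p 0 + M.g p k 1 * M.frame a p 1

theorem frame_coframe (a b : Fin 2) (p : V2) :
    M.coframe a 0 p * M.frame b p 0 + M.coframe a 1 p * M.frame b p 1 = if a = b then 1 else 0 := by
  have h : M.coframe a 0 p * M.frame b p 0 + M.coframe a 1 p * M.frame b p 1 =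
      M.met p (M.frame a p) (M.frame b p) := by
    rw [met_eq, coframe, coframe, g_symm]; ring
  rw [h]
  have h10 : M.met p (M.E2 p) (M.E1 p) = 0 := by
    rw [← M.met_E1_E2 p, met_eq, met_eq]; ring
  fin_cases a <;> fin_cases b <;>
    simp [frame_zero, frame_one, met_E1_E1, met_E2_E2, met_E1_E2, h10]

theorem coframe_frame (k l : Fin 2) (p : V2) :
    M.frame 0 p k * M.coframe 0 l p + M.frame 1 p k * M.coframe 1 l p = if k = l then 1 else 0 := by
  have h : Matrix.of (fun a k => M.coframe a k p) * Matrix.of (fun k b => M.frame b p k) = 1 := by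
    ext a b
    simp only [Matrix.mul_apply, Fin.sum_univ_two, Matrix.of_apply, frame_coframe,
      Matrix.one_apply]
  have h1 := mul_eq_one_comm.1 h
  have h2 := congrFun (congrFun h1 k) l
  simpa only [Matrix.mul_apply, Fin.sum_univ_two, Matrix.of_apply, Matrix.one_apply] using h2

theorem smooth_coframe (a k : Fin 2) : Smooth2 (M.coframe a k) :=
  ((M.smooth_g _ _).mul (M.smooth_frame _ _)).add ((M.smooth_g _ _).mul (M.smooth_frame _ _))

/-- Components of the covariant derivative of the frame. -/
def nablaFrame (i a k : Fin 2) (p : V2) : ℝ :=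
  pd i (fun p => M.frame a p k) p +
    (M.Γ k i 0 p * M.frame a p 0 + M.Γ k i 1 p * M.frame a p 1)

theorem smooth_nablaFrame (i a k : Fin 2) : Smooth2 (M.nablaFrame i a k) :=
  ((M.smooth_frame a k).pd i).add
    (((M.smooth_Γ _ _ _).mul (M.smooth_frame _ _)).add ((M.smooth_Γ _ _ _).mul (M.smooth_frame _ _)))

/-- The connection form of the Gram–Schmidt frame. -/
def omega (i : Fin 2) (p : V2) : ℝ :=
  M.coframe 1 0 p * M.nablaFrame i 0 0 p + M.coframe 1 1 p * M.nablaFrame i 0 1 p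

theorem smooth_omega (i : Fin 2) : Smooth2 (M.omega i) :=
  ((M.smooth_coframe _ _).mul (M.smooth_nablaFrame _ _ _)).add
    ((M.smooth_coframe _ _).mul (M.smooth_nablaFrame _ _ _))

theorem nabla_skew (i a b : Fin 2) (p : V2) :
    (M.coframe b 0 p * M.nablaFrame i a 0 p + M.coframe b 1 p * M.nablaFrame i a 1 p) +
    (M.coframe a 0 p * M.nablaFrame i b 0 p + M.coframe a 1 p * M.nablaFrame i b 1 p) = 0 := by
  have h : (fun p => M.coframe a 0 p * M.frame b p 0 + M.coframe a 1 p * M.frame b p 1) =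
      fun _ => if a = b then 1 else 0 := funext fun p => M.frame_coframe a b p
  have h2 := congrArg (fun f => pd i f p) h
  have hc : ∀ a k, pd i (M.coframe a k) p = pd i (fun p => M.g p k 0) p * M.frame a p 0 +
      M.g p k 0 * pd i (fun p => M.frame a p 0) p + (pd i (fun p => M.g p k 1) p * M.frame a p 1 +
      M.g p k 1 * pd i (fun p => M.frame a p 1) p) := by
    intro a k
    have : M.coframe a k = fun p => M.g p k 0 * M.frame a p 0 + M.g p k 1 * M.frame a p 1 := rfl
    rw [this, pd_add ((M.smooth_g _ _).mul (M.smooth_frame _ _))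
      ((M.smooth_g _ _).mul (M.smooth_frame _ _)), pd_mul (M.smooth_g _ _) (M.smooth_frame _ _),
      pd_mul (M.smooth_g _ _) (M.smooth_frame _ _)]
  rw [pd_const, pd_add ((M.smooth_coframe _ _).mul (M.smooth_frame _ _))
    ((M.smooth_coframe _ _).mul (M.smooth_frame _ _)),
    pd_mul (M.smooth_coframe _ _) (M.smooth_frame _ _),
    pd_mul (M.smooth_coframe _ _) (M.smooth_frame _ _), hc, hc] at h2
  simp only [metric_compat] at h2
  simp only [nablaFrame, coframe, g_symm] at h2 ⊢
  linear_combination h2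

theorem nabla_frame_zero (i k : Fin 2) (p : V2) :
    M.nablaFrame i 0 k p = M.omega i p * M.frame 1 p k := by
  have h0 := M.nabla_skew i 0 0 p
  have c0 := M.coframe_frame k 0 p
  have c1 := M.coframe_frame k 1 p
  rw [omega]
  fin_cases k
  · simp at c0 c1 ⊢
    linear_combination (-M.nablaFrame i 0 0 p) * c0 - M.nablaFrame i 0 1 p * c1 +
      M.frame 0 p 0 / 2 * h0
  · simp at c0 c1 ⊢
    linear_combination (-M.nablaFrame i 0 0 p) * c0 - M.nablaFrame i 0 1 p * c1 +
      M.frame 0 p 1 / 2 * h0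

theorem nabla_frame_one (i k : Fin 2) (p : V2) :
    M.nablaFrame i 1 k p = - M.omega i p * M.frame 0 p k := by
  have h0 := M.nabla_skew i 1 1 p
  have h1 := M.nabla_skew i 0 1 p
  have c0 := M.coframe_frame k 0 p
  have c1 := M.coframe_frame k 1 p
  rw [omega]
  fin_cases k
  · simp at c0 c1 ⊢
    linear_combination (-M.nablaFrame i 1 0 p) * c0 - M.nablaFrame i 1 1 p * c1 +
      M.frame 1 p 0 / 2 * h0 + M.frame 0 p 0 * h1
  · simp at c0 c1 ⊢
    linear_combination (-M.nablaFrame i 1 0 p) * c0 - M.nablaFrame i 1 1 p * c1 +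
      M.frame 1 p 1 / 2 * h0 + M.frame 0 p 1 * h1

theorem pd_frame_zero (i k : Fin 2) (p : V2) : pd i (fun p => M.frame 0 p k) p =
    M.omega i p * M.frame 1 p k -
      (M.Γ k i 0 p * M.frame 0 p 0 + M.Γ k i 1 p * M.frame 0 p 1) := by
  rw [← M.nabla_frame_zero, nablaFrame]; ring

theorem pd_frame_one (i k : Fin 2) (p : V2) : pd i (fun p => M.frame 1 p k) p =
    - M.omega i p * M.frame 0 p k -
      (M.Γ k i 0 p * M.frame 1 p 0 + M.Γ k i 1 p * M.frame 1 p 1) := by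
  rw [← M.nabla_frame_one, nablaFrame]; ring

/-- The curvature operator `R(∂₀,∂₁)`. -/
def curvOp (k m : Fin 2) (p : V2) : ℝ :=
  pd 0 (M.Γ k 1 m) p - pd 1 (M.Γ k 0 m) p +
    ((M.Γ k 0 0 p * M.Γ 0 1 m p - M.Γ k 1 0 p * M.Γ 0 0 m p) +
     (M.Γ k 0 1 p * M.Γ 1 1 m p - M.Γ k 1 1 p * M.Γ 1 0 m p))

theorem pd_pd_frame_zero (i j k : Fin 2) (p : V2) : pd j (pd i (fun p => M.frame 0 p k)) p =
    pd j (M.omega i) p * M.frame 1 p k + M.omega i p * pd j (fun p => M.frame 1 p k) p -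
      (pd j (M.Γ k i 0) p * M.frame 0 p 0 + M.Γ k i 0 p * pd j (fun p => M.frame 0 p 0) p +
       (pd j (M.Γ k i 1) p * M.frame 0 p 1 + M.Γ k i 1 p * pd j (fun p => M.frame 0 p 1) p)) := by
  have h : pd i (fun p => M.frame 0 p k) = fun p => M.omega i p * M.frame 1 p k +
      - (M.Γ k i 0 p * M.frame 0 p 0 + M.Γ k i 1 p * M.frame 0 p 1) :=
    funext fun p => by rw [M.pd_frame_zero]; ring
  have G := M.smooth_Γ
  have Fr := M.smooth_frame
  rw [h, pd_add ((M.smooth_omega i).mul (Fr 1 k))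
    (((G _ _ _).mul (Fr _ _)).add ((G _ _ _).mul (Fr _ _))).neg, pd_neg,
    pd_add ((G _ _ _).mul (Fr _ _)) ((G _ _ _).mul (Fr _ _)), pd_mul (G _ _ _) (Fr _ _),
    pd_mul (G _ _ _) (Fr _ _), pd_mul (M.smooth_omega i) (Fr _ _)]
  ring

theorem pd_pd_frame_one (i j k : Fin 2) (p : V2) : pd j (pd i (fun p => M.frame 1 p k)) p =
    - (pd j (M.omega i) p * M.frame 0 p k + M.omega i p * pd j (fun p => M.frame 0 p k) p) -
      (pd j (M.Γ k i 0) p * M.frame 1 p 0 + M.Γ k i 0 p * pd j (fun p => M.frame 1 p 0) p +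
       (pd j (M.Γ k i 1) p * M.frame 1 p 1 + M.Γ k i 1 p * pd j (fun p => M.frame 1 p 1) p)) := by
  have h : pd i (fun p => M.frame 1 p k) = fun p => - (M.omega i p * M.frame 0 p k) +
      - (M.Γ k i 0 p * M.frame 1 p 0 + M.Γ k i 1 p * M.frame 1 p 1) :=
    funext fun p => by rw [M.pd_frame_one]; ring
  have G := M.smooth_Γ
  have Fr := M.smooth_frame
  rw [h, pd_add ((M.smooth_omega i).mul (Fr 0 k)).neg
    (((G _ _ _).mul (Fr _ _)).add ((G _ _ _).mul (Fr _ _))).neg, pd_neg, pd_neg,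
    pd_add ((G _ _ _).mul (Fr _ _)) ((G _ _ _).mul (Fr _ _)), pd_mul (G _ _ _) (Fr _ _),
    pd_mul (G _ _ _) (Fr _ _), pd_mul (M.smooth_omega i) (Fr _ _)]
  ring

theorem curvOp_frame_zero (k : Fin 2) (p : V2) :
    M.curvOp k 0 p * M.frame 0 p 0 + M.curvOp k 1 p * M.frame 0 p 1 =
      (pd 0 (M.omega 1) p - pd 1 (M.omega 0) p) * M.frame 1 p k := by
  have h := pd_comm (M.smooth_frame 0 k) 0 1 p
  rw [pd_pd_frame_zero, pd_pd_frame_zero] at h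
  simp only [pd_frame_zero, pd_frame_one] at h
  simp only [curvOp]
  linear_combination - h

theorem curvOp_frame_one (k : Fin 2) (p : V2) :
    M.curvOp k 0 p * M.frame 1 p 0 + M.curvOp k 1 p * M.frame 1 p 1 =
      - (pd 0 (M.omega 1) p - pd 1 (M.omega 0) p) * M.frame 0 p k := by
  have h := pd_comm (M.smooth_frame 1 k) 0 1 p
  rw [pd_pd_frame_one, pd_pd_frame_one] at h
  simp only [pd_frame_zero, pd_frame_one] at h
  simp only [curvOp]
  linear_combination - h

/-- Cartan's second structure equation. -/
theorem K_eq (p : V2) : M.K p = - (pd 0 (M.omega 1) p - pd 1 (M.omega 0) p) *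
    (M.frame 0 p 0 * M.frame 1 p 1 - M.frame 0 p 1 * M.frame 1 p 0) := by
  have hK : M.K p * (M.g p).det = M.g p 0 0 * M.curvOp 0 1 p + M.g p 0 1 * M.curvOp 1 1 p := by
    rw [K, div_mul_cancel₀ _ (M.det_pos p).ne']
    simp only [Fin.sum_univ_two, dΓ_eq, curvOp]
  have hR : ∀ k, M.curvOp k 1 p = (pd 0 (M.omega 1) p - pd 1 (M.omega 0) p) *
      (M.frame 1 p k * M.coframe 0 1 p - M.frame 0 p k * M.coframe 1 1 p) := by
    intro k
    have c0 := M.coframe_frame 0 1 p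
    have c1 := M.coframe_frame 1 1 p
    simp at c0 c1
    linear_combination (- M.curvOp k 0 p) * c0 - M.curvOp k 1 p * c1 +
      M.coframe 0 1 p * M.curvOp_frame_zero k p + M.coframe 1 1 p * M.curvOp_frame_one k p
  refine mul_right_cancel₀ (M.det_pos p).ne' ?_
  rw [hK, hR, hR, det_eq]
  simp only [coframe, g_symm]
  ring

end RMetric

/-- The universal cover of the unit tangent bundle: footpoint and angle. -/
abbrev UTCover : Type := V2 × ℝ

namespace RMetric

variable (M : RMetric)

/-- The connection form evaluated on the frame. -/
def conn (a : Fin 2) (p : V2) : ℝ := M.omega 0 p * M.frame a p 0 + M.omega 1 p * M.frame a p 1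

theorem smooth_conn (a : Fin 2) : Smooth2 (M.conn a) :=
  ((M.smooth_omega 0).mul (M.smooth_frame a 0)).add ((M.smooth_omega 1).mul (M.smooth_frame a 1))

theorem pd_conn (i a : Fin 2) (p : V2) : pd i (M.conn a) p =
    pd i (M.omega 0) p * M.frame a p 0 + M.omega 0 p * pd i (fun p => M.frame a p 0) p +
      (pd i (M.omega 1) p * M.frame a p 1 + M.omega 1 p * pd i (fun p => M.frame a p 1) p) := by
  have : M.conn a = fun p => M.omega 0 p * M.frame a p 0 + M.omega 1 p * M.frame a p 1 := rfl
  rw [this, pd_add ((M.smooth_omega 0).mul (M.smooth_frame a 0))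
    ((M.smooth_omega 1).mul (M.smooth_frame a 1)), pd_mul (M.smooth_omega 0) (M.smooth_frame a 0),
    pd_mul (M.smooth_omega 1) (M.smooth_frame a 1)]

theorem unitVec_apply (p : V2) (θ : ℝ) (k : Fin 2) :
    M.unitVec p θ k = cos θ * M.frame 0 p k + sin θ * M.frame 1 p k := by
  simp [unitVec, frame_zero, frame_one]

theorem met_unitVec (p : V2) (θ : ℝ) : M.met p (M.unitVec p θ) (M.unitVec p θ) = 1 := by
  have h1 := M.met_E1_E1 p
  have h2 := M.met_E1_E2 p
  have h3 := M.met_E2_E2 p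
  rw [met_eq] at h1 h2 h3 ⊢
  simp only [unitVec_apply, frame_zero, frame_one]
  linear_combination cos θ ^ 2 * h1 + 2 * cos θ * sin θ * h2 + sin θ ^ 2 * h3 + cos_sq_add_sin_sq θ

theorem unitVec_add_two_pi (p : V2) (θ : ℝ) : M.unitVec p (θ + 2 * π) = M.unitVec p θ := by
  simp [unitVec]

/-- The geodesic spray on `UTCover`. -/
def spray (z : UTCover) : UTCover :=
  (M.unitVec z.1 z.2, -(cos z.2 * M.conn 0 z.1 + sin z.2 * M.conn 1 z.1))

/-- The horizontal vector field orthogonal to the geodesic spray. -/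
def horiz (z : UTCover) : UTCover := M.spray (z.1, z.2 + π / 2)

theorem contDiff_spray : ContDiff ℝ (⊤ : ℕ∞) M.spray := by
  have hF : ∀ a k, ContDiff ℝ (⊤ : ℕ∞) fun z : UTCover => M.frame a z.1 k :=
    fun a k => (M.smooth_frame a k).comp contDiff_fst
  have hw : ∀ a, ContDiff ℝ (⊤ : ℕ∞) fun z : UTCover => M.conn a z.1 :=
    fun a => (M.smooth_conn a).comp contDiff_fst
  have hc : ContDiff ℝ (⊤ : ℕ∞) fun z : UTCover => cos z.2 := contDiff_cos.comp contDiff_snd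
  have hs : ContDiff ℝ (⊤ : ℕ∞) fun z : UTCover => sin z.2 := contDiff_sin.comp contDiff_snd
  refine ContDiff.prodMk (contDiff_pi.2 fun k => ?_)
    (((hc.mul (hw 0)).add (hs.mul (hw 1))).neg)
  simp only [unitVec_apply]
  exact (hc.mul (hF 0 k)).add (hs.mul (hF 1 k))

theorem contDiff_horiz : ContDiff ℝ (⊤ : ℕ∞) M.horiz :=
  M.contDiff_spray.comp (contDiff_fst.prodMk (contDiff_snd.add contDiff_const))

theorem spray_add_two_pi (z : UTCover) : M.spray (z + (0, 2 * π)) = M.spray z := by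
  simp [spray, unitVec_add_two_pi]

theorem hasFDerivAt_lift {f : V2 → ℝ} (hf : Smooth2 f) (z : UTCover) :
    HasFDerivAt (fun z : UTCover => f z.1)
      ((fderiv ℝ f z.1).comp (ContinuousLinearMap.fst ℝ V2 ℝ)) z :=
  (hf.differentiableAt z.1).hasFDerivAt.comp z hasFDerivAt_fst

theorem hasFDerivAt_rot {f g : V2 → ℝ} (hf : Smooth2 f) (hg : Smooth2 g) (z : UTCover) :
    ∃ L : UTCover →L[ℝ] ℝ,
      HasFDerivAt (fun z : UTCover => cos z.2 * f z.1 + sin z.2 * g z.1) L z ∧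
      ∀ v, L v = cos z.2 * (v.1 0 * pd 0 f z.1 + v.1 1 * pd 1 f z.1) +
        sin z.2 * (v.1 0 * pd 0 g z.1 + v.1 1 * pd 1 g z.1) +
        v.2 * (- sin z.2 * f z.1 + cos z.2 * g z.1) := by
  have hc : HasFDerivAt (fun z : UTCover => cos z.2) _ z := hasFDerivAt_snd.cos
  have hs : HasFDerivAt (fun z : UTCover => sin z.2) _ z := hasFDerivAt_snd.sin
  refine ⟨_, (hc.mul (hasFDerivAt_lift hf z)).add (hs.mul (hasFDerivAt_lift hg z)), fun v => ?_⟩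
  simp [fderiv_eq_sum_pd]
  ring

theorem differentiable_spray : Differentiable ℝ M.spray :=
  M.contDiff_spray.differentiable (by simp)

theorem fderiv_spray_fst (z v : UTCover) (k : Fin 2) : (fderiv ℝ M.spray z v).1 k =
    cos z.2 * (v.1 0 * pd 0 (fun p => M.frame 0 p k) z.1 +
        v.1 1 * pd 1 (fun p => M.frame 0 p k) z.1) +
      sin z.2 * (v.1 0 * pd 0 (fun p => M.frame 1 p k) z.1 +
        v.1 1 * pd 1 (fun p => M.frame 1 p k) z.1) +
      v.2 * (- sin z.2 * M.frame 0 z.1 k + cos z.2 * M.frame 1 z.1 k) := by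
  obtain ⟨L, hL, hLv⟩ := hasFDerivAt_rot (M.smooth_frame 0 k) (M.smooth_frame 1 k) z
  have h1 : HasFDerivAt (fun z => (M.spray z).1 k) _ z :=
    ((ContinuousLinearMap.proj (R := ℝ) (φ := fun _ : Fin 2 => ℝ) k).comp
      (ContinuousLinearMap.fst ℝ V2 ℝ)).hasFDerivAt.comp z (M.differentiable_spray z).hasFDerivAt
  have h2 : (fun z => (M.spray z).1 k) =
      fun z : UTCover => cos z.2 * M.frame 0 z.1 k + sin z.2 * M.frame 1 z.1 k :=
    funext fun z => M.unitVec_apply _ _ _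
  rw [h2] at h1
  rw [← hLv, ← h1.unique hL]
  rfl

theorem fderiv_spray_snd (z v : UTCover) : (fderiv ℝ M.spray z v).2 =
    -(cos z.2 * (v.1 0 * pd 0 (M.conn 0) z.1 + v.1 1 * pd 1 (M.conn 0) z.1) +
      sin z.2 * (v.1 0 * pd 0 (M.conn 1) z.1 + v.1 1 * pd 1 (M.conn 1) z.1) +
      v.2 * (- sin z.2 * M.conn 0 z.1 + cos z.2 * M.conn 1 z.1)) := by
  obtain ⟨L, hL, hLv⟩ := hasFDerivAt_rot (M.smooth_conn 0) (M.smooth_conn 1) z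
  have h1 : HasFDerivAt (fun z => (M.spray z).2) _ z := (M.differentiable_spray z).hasFDerivAt.snd
  rw [← hLv]
  have h2 := h1.unique hL.neg
  exact congrArg (fun L : UTCover →L[ℝ] ℝ => L v) h2

theorem fderiv_spray_vertical (z : UTCover) : fderiv ℝ M.spray z (0, 1) = M.horiz z := by
  refine Prod.ext (funext fun k => ?_) ?_
  · rw [fderiv_spray_fst]
    simp [horiz, spray, unitVec_apply, cos_add_pi_div_two, sin_add_pi_div_two]
  · rw [fderiv_spray_snd]
    simp [horiz, spray, cos_add_pi_div_two, sin_add_pi_div_two]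

theorem fderiv_horiz (z v : UTCover) :
    fderiv ℝ M.horiz z v = fderiv ℝ M.spray (z.1, z.2 + π / 2) v := by
  have hs : HasFDerivAt (fun z : UTCover => (z.1, z.2 + π / 2)) (ContinuousLinearMap.id ℝ UTCover)
      z := (hasFDerivAt_id z).add_const ((0 : V2), π / 2) |>.congr_of_eventuallyEq
        (Eventually.of_forall fun z => by ext <;> simp)
  have := ((M.differentiable_spray (z.1, z.2 + π / 2)).hasFDerivAt.comp z hs).fderiv
  change fderiv ℝ M.horiz z = _ at this
  rw [this]
  rfl

/-- Structure equation: `[Y, H] = K V`. -/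
theorem fderiv_horiz_spray (z : UTCover) :
    fderiv ℝ M.horiz z (M.spray z) - fderiv ℝ M.spray z (M.horiz z) = (0, M.K z.1) := by
  rw [fderiv_horiz]
  obtain ⟨x, θ⟩ := z
  have hcs := cos_sq_add_sin_sq θ
  refine Prod.ext (funext fun k => ?_) ?_
  · simp only [Prod.fst_sub, Pi.sub_apply, fderiv_spray_fst, Pi.zero_apply]
    simp only [horiz, spray, unitVec_apply, cos_add_pi_div_two, sin_add_pi_div_two,
      pd_frame_zero, pd_frame_one, M.Γ_symm k 1 0, conn]
    ring
  · simp only [Prod.snd_sub, fderiv_spray_snd]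
    simp only [horiz, spray, unitVec_apply, cos_add_pi_div_two, sin_add_pi_div_two, pd_conn,
      pd_frame_zero, pd_frame_one, M.Γ_symm _ 1 0, conn, K_eq]
    linear_combination (- (pd 0 (M.omega 1) x - pd 1 (M.omega 0) x) *
      (M.frame 0 x 0 * M.frame 1 x 1 - M.frame 0 x 1 * M.frame 1 x 0)) * hcs

end RMetric

/-- Hopf's solution of the Riccati equation along the geodesic flow, lifted to the universal cover
of the unit tangent bundle. -/
structure HopfFlow (M : RMetric) where
  flow : UTCover → ℝ → UTCover
  U : UTCover → ℝ
  flow_zero : ∀ z, flow z 0 = z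
  hasDerivAt_flow : ∀ z t, HasDerivAt (flow z) (M.spray (flow z t)) t
  measurable_U : Measurable U
  locBdd : ∀ R : ℝ, ∃ C : ℝ, ∀ z : UTCover, ‖z.1‖ ≤ R → |U z| ≤ C
  U_add_two_pi : ∀ z, U (z + (0, 2 * π)) = U z
  riccati : ∀ z t,
    HasDerivAt (fun s => U (flow z s)) (-(U (flow z t)) ^ 2 - M.K (flow z t).1) t

theorem Smooth2.hasDerivAt_comp {γ : ℝ → V2} {f : V2 → ℝ} (hf : Smooth2 f) {t : ℝ} {v : V2}
    (h : HasDerivAt γ v t) :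
    HasDerivAt (fun s => f (γ s)) (v 0 * _root_.pd 0 f (γ t) + v 1 * _root_.pd 1 f (γ t)) t := by
  rw [← fderiv_eq_sum_pd]
  exact (hf.differentiableAt (γ t)).hasFDerivAt.comp_hasDerivAt t h

namespace RMetric

variable (M : RMetric)

theorem continuous_spray : Continuous M.spray := M.contDiff_spray.continuous

theorem continuous_unitVec : Continuous fun z : UTCover => M.unitVec z.1 z.2 :=
  M.continuous_spray.fst

theorem frame_unique (p : V2) {a b c d : ℝ}
    (h : ∀ k, a * M.frame 0 p k + b * M.frame 1 p k = c * M.frame 0 p k + d * M.frame 1 p k) :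
    a = c ∧ b = d := by
  have h00 := M.frame_coframe 0 0 p
  have h01 := M.frame_coframe 0 1 p
  have h10 := M.frame_coframe 1 0 p
  have h11 := M.frame_coframe 1 1 p
  simp only [Fin.isValue, if_true, zero_ne_one, one_ne_zero, if_false] at h00 h01 h10 h11
  constructor
  · linear_combination M.coframe 0 0 p * h 0 + M.coframe 0 1 p * h 1 - (a - c) * h00 - (b - d) * h01
  · linear_combination M.coframe 1 0 p * h 0 + M.coframe 1 1 p * h 1 - (a - c) * h10 - (b - d) * h11

variable {M}

section Geodesic

variable {γ : ℝ → V2}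

theorem IsGeodesic.hasDerivAt (hγ : M.IsGeodesic γ) (t : ℝ) : HasDerivAt γ (vel γ t) t := by
  refine hasDerivAt_pi.2 fun k => ?_
  have h : DifferentiableAt ℝ (fun s => γ s k) t :=
    ((contDiff_pi.1 hγ.1 k).differentiable (by norm_num)) t
  exact h.hasDerivAt

theorem IsGeodesic.hasDerivAt_vel (hγ : M.IsGeodesic γ) (t : ℝ) (k : Fin 2) :
    HasDerivAt (fun s => vel γ s k)
      (-∑ i, ∑ j, M.Γ k i j (γ t) * vel γ t i * vel γ t j) t := by
  have h : ContDiff ℝ 1 (fun s => vel γ s k) := by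
    have h2 : ContDiff ℝ (1 + 1) (fun s => γ s k) := by
      have := contDiff_pi.1 hγ.1 k
      norm_num
      exact this
    exact ((contDiff_succ_iff_deriv.1 h2).2.2)
  have h1 := ((h.differentiable one_ne_zero) t).hasDerivAt
  have h3 : deriv (fun s => vel γ s k) t =
      -∑ i, ∑ j, M.Γ k i j (γ t) * vel γ t i * vel γ t j := by
    have := hγ.2 t k
    simp only [acc] at this
    linarith
  rwa [h3] at h1

theorem IsGeodesic.continuous (hγ : M.IsGeodesic γ) : Continuous γ := hγ.1.continuous

theorem IsGeodesic.continuous_vel (hγ : M.IsGeodesic γ) (k : Fin 2) :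
    Continuous fun s => vel γ s k :=
  continuous_iff_continuousAt.2 fun t => (hγ.hasDerivAt_vel t k).continuousAt

/-- Along a geodesic the angle with the frame evolves by the connection form. -/
theorem IsGeodesic.vel_eq_unitVec (hγ : M.IsGeodesic γ) {α : ℝ → ℝ}
    (hα : ∀ t, HasDerivAt α
      (-(M.omega 0 (γ t) * vel γ t 0 + M.omega 1 (γ t) * vel γ t 1)) t)
    (h0 : vel γ 0 = M.unitVec (γ 0) (α 0)) (t : ℝ) : vel γ t = M.unitVec (γ t) (α t) := by
  set W : ℝ → ℝ := fun t => M.omega 0 (γ t) * vel γ t 0 + M.omega 1 (γ t) * vel γ t 1 with hW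
  set a : Fin 2 → ℝ → ℝ := fun i t =>
    M.coframe i 0 (γ t) * vel γ t 0 + M.coframe i 1 (γ t) * vel γ t 1 with ha
  have hvel : ∀ t k, vel γ t k = a 0 t * M.frame 0 (γ t) k + a 1 t * M.frame 1 (γ t) k := by
    intro t k
    have c0 := M.coframe_frame k 0 (γ t)
    have c1 := M.coframe_frame k 1 (γ t)
    simp only [ha]
    fin_cases k
    · simp at c0 c1 ⊢
      linear_combination -vel γ t 0 * c0 - vel γ t 1 * c1
    · simp at c0 c1 ⊢
      linear_combination -vel γ t 0 * c0 - vel γ t 1 * c1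
  have hFr : ∀ b k t, HasDerivAt (fun s => M.frame b (γ s) k) _ t :=
    fun b k t => (M.smooth_frame b k).hasDerivAt_comp (hγ.hasDerivAt t)
  have hda : ∀ i t, ∃ d, HasDerivAt (a i) d t := fun i t =>
    ⟨_, (((M.smooth_coframe i 0).hasDerivAt_comp (hγ.hasDerivAt t)).mul (hγ.hasDerivAt_vel t 0)).add
      (((M.smooth_coframe i 1).hasDerivAt_comp (hγ.hasDerivAt t)).mul (hγ.hasDerivAt_vel t 1))⟩
  clear_value a
  have hab : ∀ t, HasDerivAt (a 0) (W t * a 1 t) t ∧ HasDerivAt (a 1) (-(W t * a 0 t)) t := by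
    intro t
    obtain ⟨d0, hd0⟩ := hda 0 t
    obtain ⟨d1, hd1⟩ := hda 1 t
    have key : d0 = W t * a 1 t ∧ d1 = -(W t * a 0 t) := by
      refine M.frame_unique (γ t) fun k => ?_
      have e1 := hγ.hasDerivAt_vel t k
      have e2 := (hd0.mul (hFr 0 k t)).add (hd1.mul (hFr 1 k t))
      have e3 := e1.unique (e2.congr_of_eventuallyEq
        (Eventually.of_forall fun s => hvel s k))
      simp only [Fin.sum_univ_two, pd_frame_zero, pd_frame_one] at e3
      have w0 := hvel t 0
      have w1 := hvel t 1
      simp only [hW]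
      rw [w0, w1] at e3 ⊢
      linear_combination -e3
    rw [← key.1, ← key.2]
    exact ⟨hd0, hd1⟩
  have hE : ∀ t, (a 0 t - cos (α t)) ^ 2 + (a 1 t - sin (α t)) ^ 2 = 0 := by
    have hd : ∀ t, HasDerivAt (fun t => (a 0 t - cos (α t)) ^ 2 + (a 1 t - sin (α t)) ^ 2) 0 t := by
      intro t
      have := (((hab t).1.sub (hα t).cos).pow 2).add (((hab t).2.sub (hα t).sin).pow 2)
      refine this.congr_deriv ?_
      simp only [hW, Pi.sub_apply]
      push_cast
      ring
    have hinit : a 0 0 = cos (α 0) ∧ a 1 0 = sin (α 0) := by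
      refine M.frame_unique (γ 0) fun k => ?_
      rw [← hvel, h0, unitVec_apply]
    intro t
    have := is_const_of_deriv_eq_zero (fun t => (hd t).differentiableAt)
      (fun t => (hd t).deriv) t 0
    simp only [hinit.1, hinit.2] at this
    rw [this]; ring
  funext k
  have h1 : a 0 t = cos (α t) := by
    nlinarith [hE t, sq_nonneg (a 0 t - cos (α t)), sq_nonneg (a 1 t - sin (α t))]
  have h2 : a 1 t = sin (α t) := by
    nlinarith [hE t, sq_nonneg (a 0 t - cos (α t)), sq_nonneg (a 1 t - sin (α t))]
  rw [hvel, unitVec_apply, h1, h2]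

end Geodesic

theorem exists_hopfFlow {Φ : V2 × V2 → ℝ → V2 × V2} (hΦ : M.IsGeodesicFlow Φ)
    {u : (V2 × V2) × ℝ → ℝ} (hu : M.IsHopfSolution Φ u) :
    ∃ F : HopfFlow M, ∀ z, F.U z = u ((z.1, M.unitVec z.1 z.2), 0) := by
  have hmem : ∀ z : UTCover, (z.1, M.unitVec z.1 z.2) ∈ M.UnitTangent :=
    fun z => M.met_unitVec z.1 z.2
  set γ : UTCover → ℝ → V2 := fun z t => (Φ (z.1, M.unitVec z.1 z.2) t).1 with hγdef
  have hγ : ∀ z, M.IsGeodesic (γ z) := fun z => (hΦ _ (hmem z)).2.1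
  set W : UTCover → ℝ → ℝ := fun z t =>
    M.omega 0 (γ z t) * vel (γ z) t 0 + M.omega 1 (γ z t) * vel (γ z) t 1 with hW
  have hWc : ∀ z, Continuous (W z) := fun z =>
    ((M.smooth_omega 0).continuous.comp (hγ z).continuous |>.mul ((hγ z).continuous_vel 0)).add
    ((M.smooth_omega 1).continuous.comp (hγ z).continuous |>.mul ((hγ z).continuous_vel 1))
  set α : UTCover → ℝ → ℝ := fun z t => z.2 - ∫ s in (0:ℝ)..t, W z s with hα
  have hαd : ∀ z t, HasDerivAt (α z) (-W z t) t := fun z t =>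
    ((hWc z).integral_hasStrictDerivAt 0 t).hasDerivAt.const_sub z.2
  have hα0 : ∀ z, α z 0 = z.2 := fun z => by simp [hα]
  have hγ0 : ∀ z, γ z 0 = z.1 := fun z => by simp [hγdef, (hΦ _ (hmem z)).1]
  have hvel : ∀ z t, vel (γ z) t = M.unitVec (γ z t) (α z t) := fun z t =>
    (hγ z).vel_eq_unitVec (hαd z) (by
      have h1 := (hΦ _ (hmem z)).2.2 0
      rw [(hΦ _ (hmem z)).1] at h1
      rw [hα0, hγ0]
      exact h1.symm) t
  have hproj : ∀ z t, Φ (z.1, M.unitVec z.1 z.2) t = (γ z t, M.unitVec (γ z t) (α z t)) := by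
    intro z t
    refine Prod.ext rfl ?_
    rw [← hvel]
    exact (hΦ _ (hmem z)).2.2 t
  have hUflow : ∀ z t, u ((γ z t, M.unitVec (γ z t) (α z t)), 0) =
      u ((z.1, M.unitVec z.1 z.2), t) := by
    intro z t
    rw [← hproj, ← hu.2.2.2 _ (hmem z) t 0, add_zero]
  refine ⟨{ flow := fun z t => (γ z t, α z t)
            U := fun z => u ((z.1, M.unitVec z.1 z.2), 0)
            flow_zero := fun z => Prod.ext (hγ0 z) (hα0 z)
            hasDerivAt_flow := fun z t => ?_
            measurable_U := ?_
            locBdd := fun R => ?_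
            U_add_two_pi := fun z => by simp [unitVec_add_two_pi]
            riccati := fun z t => ?_ }, fun z => rfl⟩
  · refine HasDerivAt.prodMk ?_ ?_
    · simp only [← hvel]
      exact (hγ z).hasDerivAt t
    · refine (hαd z t).congr_deriv ?_
      simp only [hW, hvel, unitVec_apply, conn]
      ring
  · refine hu.1.comp ?_
    exact ((continuous_fst.prodMk M.continuous_unitVec).prodMk continuous_const).measurable
  · obtain ⟨C, hC⟩ := hu.2.1 (max R 0)
    exact ⟨C, fun z hz => hC _ (hmem z) (hz.trans (le_max_left _ _)) 0 (by simp)⟩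
  · simp only [hUflow]
    exact hu.2.2.1 _ (hmem z) t

end RMetric

theorem det_utCover (f : UTCover →ₗ[ℝ] UTCover) : LinearMap.det f =
    let a := f (Pi.single 0 1, 0)
    let b := f (Pi.single 1 1, 0)
    let c := f (0, 1)
    a.1 0 * b.1 1 * c.2 - a.1 0 * c.1 1 * b.2 - b.1 0 * a.1 1 * c.2 + b.1 0 * c.1 1 * a.2 +
      c.1 0 * a.1 1 * b.2 - c.1 0 * b.1 1 * a.2 := by
  let e : UTCover ≃ₗ[ℝ] (Fin 3 → ℝ) :=
    { toFun := fun v => ![v.1 0, v.1 1, v.2]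
      invFun := fun w => (![w 0, w 1], w 2)
      map_add' := fun v w => by ext i; fin_cases i <;> simp
      map_smul' := fun c v => by ext i; fin_cases i <;> simp
      left_inv := fun v => by ext i <;> [fin_cases i; skip] <;> simp
      right_inv := fun w => by ext i; fin_cases i <;> simp }
  have h := LinearMap.det_toMatrix (Module.Basis.ofEquivFun e) f
  rw [← h, Matrix.det_fin_three]
  have e0 : e.symm (Pi.single 0 1) = (Pi.single 0 1, 0) := by
    ext i <;> [fin_cases i; skip] <;> simp [e]
  have e1 : e.symm (Pi.single 1 1) = (Pi.single 1 1, 0) := by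
    ext i <;> [fin_cases i; skip] <;> simp [e]
  have e2 : e.symm (Pi.single 2 1) = (0, 1) := by
    ext i <;> [fin_cases i; skip] <;> simp [e]
  simp only [LinearMap.toMatrix_apply, Module.Basis.coe_ofEquivFun, Module.Basis.ofEquivFun_repr_apply, e0, e1, e2]
  simp [e]

namespace RMetric

variable (M : RMetric)

/-- The frame `(Y, H, V)` of the tangent space of `UTCover`. -/
def frameMap (z : UTCover) : UTCover →L[ℝ] UTCover :=
  ((ContinuousLinearMap.proj (R := ℝ) (φ := fun _ : Fin 2 => ℝ) 0).comp
      (ContinuousLinearMap.fst ℝ V2 ℝ)).smulRight (M.spray z) +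
    ((ContinuousLinearMap.proj (R := ℝ) (φ := fun _ : Fin 2 => ℝ) 1).comp
      (ContinuousLinearMap.fst ℝ V2 ℝ)).smulRight (M.horiz z) +
    (ContinuousLinearMap.snd ℝ V2 ℝ).smulRight ((0 : V2), (1 : ℝ))

theorem frameMap_apply (z v : UTCover) :
    M.frameMap z v = v.1 0 • M.spray z + v.1 1 • M.horiz z + v.2 • ((0 : V2), (1 : ℝ)) := by
  simp [frameMap]

theorem det_unitVec (p : V2) (θ : ℝ) : M.unitVec p θ 0 * M.unitVec p (θ + π / 2) 1 -
    M.unitVec p θ 1 * M.unitVec p (θ + π / 2) 0 = (√(M.g p).det)⁻¹ := by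
  rw [← frame_det, ← frame_zero, ← frame_one]
  simp only [unitVec_apply, cos_add_pi_div_two, sin_add_pi_div_two]
  linear_combination (M.frame 0 p 0 * M.frame 1 p 1 - M.frame 0 p 1 * M.frame 1 p 0) *
    cos_sq_add_sin_sq θ

theorem det_frameMap (z : UTCover) :
    LinearMap.det (M.frameMap z : UTCover →ₗ[ℝ] UTCover) = (√(M.g z.1).det)⁻¹ := by
  rw [det_utCover, ← M.det_unitVec z.1 z.2]
  simp [frameMap_apply, spray, horiz]
  ring

end RMetric

namespace HopfFlow

variable {M : RMetric} (F : HopfFlow M)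

theorem contDiff_spray (n : ℕ) : ContDiff ℝ n M.spray := by
  refine M.contDiff_spray.of_le ?_
  exact WithTop.coe_le_coe.2 le_top

theorem flow_add (z : UTCover) (s t : ℝ) : F.flow z (s + t) = F.flow (F.flow z s) t := by
  have h := autonomous_ODE_unique (α := F.flow (F.flow z s)) (β := fun t => F.flow z (s + t))
    (contDiff_spray 1) (F.hasDerivAt_flow _)
    (fun t => (F.hasDerivAt_flow z (s + t)).comp_const_add s t) (by simp [F.flow_zero])
  exact congrFun h t

theorem flow_add_two_pi (z : UTCover) (t : ℝ) :
    F.flow (z + (0, 2 * π)) t = F.flow z t + (0, 2 * π) := by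
  have h := autonomous_ODE_unique (α := F.flow (z + (0, 2 * π)))
    (β := fun t => F.flow z t + (0, 2 * π)) (contDiff_spray 1) (F.hasDerivAt_flow _)
    (fun t => by
      rw [M.spray_add_two_pi]
      exact (F.hasDerivAt_flow z t).add_const _) (by simp [F.flow_zero])
  exact (congrFun h t).symm

theorem continuous_flow : Continuous fun y : UTCover × ℝ => F.flow y.1 y.2 :=
  continuous_uncurry_flow (contDiff_spray 1) F.flow_zero F.hasDerivAt_flow

theorem continuous_flow_left (z : UTCover) : Continuous (F.flow z) :=
  continuous_iff_continuousAt.2 fun t => (F.hasDerivAt_flow z t).continuousAt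

theorem continuous_flow_right (t : ℝ) : Continuous fun z => F.flow z t :=
  F.continuous_flow.comp (continuous_id.prodMk continuous_const)

theorem continuous_U_flow (z : UTCover) : Continuous fun s => F.U (F.flow z s) :=
  continuous_iff_continuousAt.2 fun t => (F.riccati z t).continuousAt

/-- The positive Jacobi field with logarithmic derivative `U`. -/
def posJacobi (z : UTCover) (t : ℝ) : ℝ := exp (∫ s in (0 : ℝ)..t, F.U (F.flow z s))

/-- The Jacobi field with `J 0 = 0` and `J' 0 = 1`. -/
def jacobi (z : UTCover) (t : ℝ) : ℝ :=
  F.posJacobi z t * ∫ s in (0 : ℝ)..t, (F.posJacobi z s ^ 2)⁻¹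

/-- The derivative of `jacobi`. -/
def jacobiDeriv (z : UTCover) (t : ℝ) : ℝ :=
  F.U (F.flow z t) * F.jacobi z t + (F.posJacobi z t)⁻¹

/-- The Jacobi field with `J 0 = 1` and `J' 0 = 0`. -/
def cojacobi (z : UTCover) (t : ℝ) : ℝ := F.posJacobi z t - F.U z * F.jacobi z t

/-- The derivative of `cojacobi`. -/
def cojacobiDeriv (z : UTCover) (t : ℝ) : ℝ :=
  F.U (F.flow z t) * F.posJacobi z t - F.U z * F.jacobiDeriv z t

variable (z : UTCover) (t : ℝ)

theorem posJacobi_pos : 0 < F.posJacobi z t := exp_pos _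

theorem hasDerivAt_posJacobi :
    HasDerivAt (F.posJacobi z) (F.U (F.flow z t) * F.posJacobi z t) t := by
  have := ((F.continuous_U_flow z).integral_hasStrictDerivAt 0 t).hasDerivAt.exp
  rwa [mul_comm] at this

theorem continuous_posJacobi : Continuous (F.posJacobi z) :=
  continuous_iff_continuousAt.2 fun t => (F.hasDerivAt_posJacobi z t).continuousAt

theorem hasDerivAt_jacobi : HasDerivAt (F.jacobi z) (F.jacobiDeriv z t) t := by
  have hc : Continuous fun s => (F.posJacobi z s ^ 2)⁻¹ :=
    ((F.continuous_posJacobi z).pow 2).inv₀ fun s => (pow_pos (F.posJacobi_pos z s) 2).ne'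
  refine ((F.hasDerivAt_posJacobi z t).mul
    (hc.integral_hasStrictDerivAt 0 t).hasDerivAt).congr_deriv ?_
  have := (F.posJacobi_pos z t).ne'
  simp only [jacobiDeriv, jacobi]
  field_simp

theorem hasDerivAt_jacobiDeriv :
    HasDerivAt (F.jacobiDeriv z) (-(M.K (F.flow z t).1 * F.jacobi z t)) t := by
  have hp := (F.posJacobi_pos z t).ne'
  refine (((F.riccati z t).mul (F.hasDerivAt_jacobi z t)).add
    ((F.hasDerivAt_posJacobi z t).inv hp)).congr_deriv ?_
  simp only [jacobiDeriv]
  field_simp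
  ring

theorem hasDerivAt_cojacobi : HasDerivAt (F.cojacobi z) (F.cojacobiDeriv z t) t :=
  (F.hasDerivAt_posJacobi z t).sub ((F.hasDerivAt_jacobi z t).const_mul _)

theorem hasDerivAt_cojacobiDeriv :
    HasDerivAt (F.cojacobiDeriv z) (-(M.K (F.flow z t).1 * F.cojacobi z t)) t := by
  refine (((F.riccati z t).mul (F.hasDerivAt_posJacobi z t)).sub
    ((F.hasDerivAt_jacobiDeriv z t).const_mul _)).congr_deriv ?_
  simp only [cojacobi]
  ring

theorem posJacobi_zero : F.posJacobi z 0 = 1 := by simp [posJacobi]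

theorem jacobi_zero : F.jacobi z 0 = 0 := by simp [jacobi]

theorem jacobiDeriv_zero : F.jacobiDeriv z 0 = 1 := by
  simp [jacobiDeriv, jacobi_zero, posJacobi_zero]

theorem cojacobi_zero : F.cojacobi z 0 = 1 := by simp [cojacobi, jacobi_zero, posJacobi_zero]

theorem cojacobiDeriv_zero : F.cojacobiDeriv z 0 = 0 := by
  simp [cojacobiDeriv, jacobiDeriv_zero, posJacobi_zero, F.flow_zero]

theorem jacobi_pos {t : ℝ} (ht : 0 < t) : 0 < F.jacobi z t := by
  have hc : Continuous fun s => (F.posJacobi z s ^ 2)⁻¹ :=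
    ((F.continuous_posJacobi z).pow 2).inv₀ fun s => (pow_pos (F.posJacobi_pos z s) 2).ne'
  refine mul_pos (F.posJacobi_pos z t) ?_
  exact intervalIntegral.intervalIntegral_pos_of_pos (hc.intervalIntegrable _ _)
    (fun s => inv_pos.2 (pow_pos (F.posJacobi_pos z s) 2)) ht

theorem wronskian :
    F.cojacobi z t * F.jacobiDeriv z t - F.jacobi z t * F.cojacobiDeriv z t = 1 := by
  have hp := (F.posJacobi_pos z t).ne'
  simp only [cojacobi, cojacobiDeriv, jacobiDeriv]
  field_simp
  ring

/-- The matrix of the derivative of the flow in the frames `(Y, H, V)`. -/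
def jacobiMap : UTCover →L[ℝ] UTCover :=
  (ContinuousLinearMap.proj (R := ℝ) (φ := fun _ : Fin 2 => ℝ) 0 |>.comp
      (ContinuousLinearMap.fst ℝ V2 ℝ)).smulRight (Pi.single 0 1, 0) +
    (ContinuousLinearMap.proj (R := ℝ) (φ := fun _ : Fin 2 => ℝ) 1 |>.comp
      (ContinuousLinearMap.fst ℝ V2 ℝ)).smulRight
        (Pi.single 1 (F.cojacobi z t), F.cojacobiDeriv z t) +
    (ContinuousLinearMap.snd ℝ V2 ℝ).smulRight (Pi.single 1 (F.jacobi z t), F.jacobiDeriv z t)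

theorem jacobiMap_apply (v : UTCover) : F.jacobiMap z t v =
    (![v.1 0, v.1 1 * F.cojacobi z t + v.2 * F.jacobi z t],
      v.1 1 * F.cojacobiDeriv z t + v.2 * F.jacobiDeriv z t) := by
  ext i <;> [fin_cases i; skip] <;> simp [jacobiMap]

theorem det_jacobiMap : LinearMap.det (F.jacobiMap z t : UTCover →ₗ[ℝ] UTCover) = 1 := by
  rw [det_utCover]
  simp [jacobiMap_apply]
  linear_combination F.wronskian z t

/-- The frame `(Y, H, V)` as an equivalence. -/
def frameEquiv (M : RMetric) (z : UTCover) : UTCover ≃L[ℝ] UTCover :=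
  (LinearEquiv.ofIsUnitDet (v := Module.finBasis ℝ UTCover) (v' := Module.finBasis ℝ UTCover)
    (f := (M.frameMap z : UTCover →ₗ[ℝ] UTCover)) (by
      rw [LinearMap.det_toMatrix, M.det_frameMap]
      exact (inv_pos.2 (sqrt_pos.2 (M.det_pos z.1))).ne'.isUnit)).toContinuousLinearEquiv

theorem frameEquiv_apply (M : RMetric) (z v : UTCover) : frameEquiv M z v = M.frameMap z v := rfl

/-- The derivative of the flow. -/
def flowDeriv : UTCover →L[ℝ] UTCover :=
  (M.frameMap (F.flow z t)).comp ((F.jacobiMap z t).comp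
    ((frameEquiv M z).symm : UTCover →L[ℝ] UTCover))

theorem flowDeriv_frameMap (v : UTCover) : F.flowDeriv z t (M.frameMap z v) =
    M.frameMap (F.flow z t) (F.jacobiMap z t v) := by
  rw [← frameEquiv_apply]
  simp [flowDeriv]

theorem flowDeriv_vertical : F.flowDeriv z t (0, 1) =
    F.jacobi z t • M.horiz (F.flow z t) + F.jacobiDeriv z t • ((0 : V2), (1 : ℝ)) := by
  have h : ((0 : V2), (1 : ℝ)) = M.frameMap z (0, 1) := by simp [RMetric.frameMap_apply]
  conv_lhs => rw [h]
  rw [flowDeriv_frameMap, jacobiMap_apply, RMetric.frameMap_apply]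
  simp

theorem det_flowDeriv : LinearMap.det (F.flowDeriv z t : UTCover →ₗ[ℝ] UTCover) =
    (√(M.g (F.flow z t).1).det)⁻¹ * √(M.g z.1).det := by
  have h : (F.flowDeriv z t : UTCover →ₗ[ℝ] UTCover) ∘ₗ (M.frameMap z : UTCover →ₗ[ℝ] UTCover) =
      (M.frameMap (F.flow z t) : UTCover →ₗ[ℝ] UTCover) ∘ₗ
        (F.jacobiMap z t : UTCover →ₗ[ℝ] UTCover) :=
    LinearMap.ext fun v => F.flowDeriv_frameMap z t v
  have h2 := congrArg LinearMap.det h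
  rw [LinearMap.det_comp, LinearMap.det_comp, M.det_frameMap, M.det_frameMap, det_jacobiMap,
    mul_one] at h2
  have hp := (sqrt_pos.2 (M.det_pos z.1)).ne'
  rw [← h2, inv_mul_cancel_right₀ hp]

theorem hasFDerivAt_flow (ht : 0 ≤ t) :
    HasFDerivAt (fun y => F.flow y t) (F.flowDeriv z t) z := by
  refine _root_.hasFDerivAt_flow (f := M.spray) (contDiff_spray 2) F.flow_zero F.hasDerivAt_flow z
    (F.flowDeriv z) (fun h => ?_) (fun h s => ?_) t ht
  · have : F.jacobiMap z 0 = ContinuousLinearMap.id ℝ UTCover := by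
      refine ContinuousLinearMap.ext fun v => ?_
      ext i <;> [fin_cases i; skip] <;>
        simp [jacobiMap_apply, jacobi_zero, jacobiDeriv_zero, cojacobi_zero, cojacobiDeriv_zero]
    simp only [flowDeriv, this, F.flow_zero, ContinuousLinearMap.id_comp]
    change frameEquiv M z ((frameEquiv M z).symm h) = h
    simp
  · set v := (frameEquiv M z).symm h with hv
    have hL : ∀ s, F.flowDeriv z s h = M.frameMap (F.flow z s) (F.jacobiMap z s v) := fun s => rfl
    simp only [hL, jacobiMap_apply, RMetric.frameMap_apply]
    have hY : HasDerivAt (fun s => M.spray (F.flow z s))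
        (fderiv ℝ M.spray (F.flow z s) (M.spray (F.flow z s))) s :=
      (M.differentiable_spray _).hasFDerivAt.comp_hasDerivAt s (F.hasDerivAt_flow z s)
    have hH : HasDerivAt (fun s => M.horiz (F.flow z s))
        (fderiv ℝ M.horiz (F.flow z s) (M.spray (F.flow z s))) s :=
      ((M.contDiff_horiz.differentiable (by simp)) _).hasFDerivAt.comp_hasDerivAt s
        (F.hasDerivAt_flow z s)
    have hb := ((F.hasDerivAt_cojacobi z s).const_mul (v.1 1)).add
      ((F.hasDerivAt_jacobi z s).const_mul v.2)
    have hc := ((F.hasDerivAt_cojacobiDeriv z s).const_mul (v.1 1)).add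
      ((F.hasDerivAt_jacobiDeriv z s).const_mul v.2)
    refine (((hY.const_smul (v.1 0)).add (hb.smul hH)).add
      (hc.smul_const ((0 : V2), (1 : ℝ)))).congr_deriv ?_
    have hK := M.fderiv_horiz_spray (F.flow z s)
    rw [sub_eq_iff_eq_add] at hK
    have hK2 : ((0 : V2), M.K (F.flow z s).1) = M.K (F.flow z s).1 • ((0 : V2), (1 : ℝ)) := by simp
    rw [hK, hK2]
    simp only [map_add, map_smul, M.fderiv_spray_vertical, Matrix.cons_val_zero,
      Matrix.cons_val_one, Matrix.cons_val_fin_one]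
    simp only [Pi.add_apply]
    module

theorem continuous_jacobi_jacobiDeriv :
    (Continuous fun y : UTCover × ℝ => F.jacobi y.1 y.2) ∧
      Continuous fun y : UTCover × ℝ => F.jacobiDeriv y.1 y.2 := by
  let f : UTCover × (ℝ × ℝ) → UTCover × (ℝ × ℝ) := fun y =>
    (M.spray y.1, (y.2.2, -(M.K y.1.1 * y.2.1)))
  have hf : ContDiff ℝ 1 f := by
    have hK : ContDiff ℝ 1 M.K := ContDiff.of_le M.smooth_K (WithTop.coe_le_coe.2 le_top)
    exact ((contDiff_spray 1).comp contDiff_fst).prodMk (contDiff_snd.snd.prodMk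
      ((hK.comp contDiff_fst.fst).mul contDiff_snd.fst).neg)
  let Ψ : UTCover × (ℝ × ℝ) → ℝ → UTCover × (ℝ × ℝ) := fun y t =>
    (F.flow y.1 t, (y.2.1 * F.cojacobi y.1 t + y.2.2 * F.jacobi y.1 t,
      y.2.1 * F.cojacobiDeriv y.1 t + y.2.2 * F.jacobiDeriv y.1 t))
  have h := continuous_uncurry_flow (Ψ := Ψ) hf (fun y => by
      simp [Ψ, F.flow_zero, jacobi_zero, jacobiDeriv_zero, cojacobi_zero, cojacobiDeriv_zero])
    (fun y t => by
      refine (F.hasDerivAt_flow y.1 t).prodMk (HasDerivAt.prodMk ?_ ?_)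
      · exact ((F.hasDerivAt_cojacobi y.1 t).const_mul _).add
          ((F.hasDerivAt_jacobi y.1 t).const_mul _)
      · refine (((F.hasDerivAt_cojacobiDeriv y.1 t).const_mul _).add
          ((F.hasDerivAt_jacobiDeriv y.1 t).const_mul _)).congr_deriv ?_
        simp only [Ψ]
        ring)
  have hi : Continuous fun y : UTCover × ℝ => ((y.1, ((0 : ℝ), (1 : ℝ))), y.2) := by fun_prop
  have h2 := h.comp hi
  refine ⟨?_, ?_⟩
  · convert h2.snd.fst using 2
    simp [Ψ]
  · convert h2.snd.snd using 2
    simp [Ψ]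

end HopfFlow

/-- Translation of the angle by multiples of `2π`. -/
abbrev AngleShifts : AddSubgroup UTCover := AddSubgroup.zmultiples ((0 : V2), 2 * π)

theorem isAddFundamentalDomain_angle :
    IsAddFundamentalDomain AngleShifts (univ ×ˢ Ico 0 (2 * π) : Set UTCover) := by
  refine IsAddFundamentalDomain.mk' (MeasurableSet.univ.prod measurableSet_Ico).nullMeasurableSet
    fun z => ?_
  obtain ⟨n, hn, hu⟩ := existsUnique_add_zsmul_mem_Ico two_pi_pos z.2 0
  refine ⟨⟨n • ((0 : V2), 2 * π), ⟨n, rfl⟩⟩, ?_, ?_⟩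
  · refine ⟨trivial, ?_⟩
    have : z.2 + n • (2 * π) ∈ Ico 0 (0 + 2 * π) := hn
    rw [zero_add, add_comm] at this
    exact this
  · rintro ⟨_, m, rfl⟩ ⟨-, hm⟩
    have : z.2 + m • (2 * π) ∈ Ico 0 (0 + 2 * π) := by
      rw [zero_add, add_comm]
      exact hm
    have h := hu m this
    subst h
    rfl

namespace RMetric

variable (M : RMetric)

/-- The lift of the Liouville measure to a fundamental domain in `UTCover`. -/
def liouvilleCover : Measure UTCover := M.area.prod (volume.restrict (Ico 0 (2 * π)))

theorem continuous_density : Continuous fun p => √(M.g p).det :=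
  continuous_sqrt.comp M.smooth_det.continuous

theorem lintegral_liouvilleCover (h : UTCover → ℝ≥0∞) (hh : Measurable h) :
    ∫⁻ z, h z ∂M.liouvilleCover =
      ∫⁻ z in univ ×ˢ Ico 0 (2 * π), ENNReal.ofReal (√(M.g z.1).det) * h z := by
  have hρ : Measurable fun p => ENNReal.ofReal (√(M.g p).det) :=
    M.continuous_density.measurable.ennreal_ofReal
  rw [liouvilleCover, area, prod_withDensity_left hρ,
    lintegral_withDensity_eq_lintegral_mul _ (f := fun z : UTCover => ENNReal.ofReal (√(M.g z.1).det))
      (hρ.comp measurable_fst) hh]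
  rw [Measure.volume_eq_prod, ← Measure.prod_restrict, Measure.restrict_univ]
  rfl

end RMetric

namespace HopfFlow

variable {M : RMetric} (F : HopfFlow M)

/-- The flow as a homeomorphism. -/
def flowHomeo (t : ℝ) : UTCover ≃ₜ UTCover where
  toFun z := F.flow z t
  invFun z := F.flow z (-t)
  left_inv z := by
    dsimp only
    rw [← F.flow_add, add_neg_cancel, F.flow_zero]
  right_inv z := by
    dsimp only
    rw [← F.flow_add, neg_add_cancel, F.flow_zero]
  continuous_toFun := F.continuous_flow_right t
  continuous_invFun := F.continuous_flow_right (-t)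

theorem flow_vadd (g : AngleShifts) (z : UTCover) (t : ℝ) :
    F.flow (g +ᵥ z) t = g +ᵥ F.flow z t := by
  obtain ⟨_, n, rfl⟩ := g
  change F.flow (n • ((0 : V2), 2 * π) + z) t = n • ((0 : V2), 2 * π) + F.flow z t
  induction n using Int.induction_on generalizing z with
  | zero => simp
  | succ n ih =>
    rw [add_smul, one_smul, add_assoc, ih, add_assoc, add_comm _ z, F.flow_add_two_pi,
      add_comm (F.flow z t)]
  | pred n ih =>
    have h := ih ((-1 : ℤ) • ((0 : V2), 2 * π) + z)
    have h2 := F.flow_add_two_pi ((-1 : ℤ) • ((0 : V2), 2 * π) + z) t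
    have e : (-1 : ℤ) • ((0 : V2), 2 * π) + z + (0, 2 * π) = z := by
      rw [neg_smul, one_smul]; abel
    rw [e] at h2
    rw [sub_eq_add_neg, add_smul, add_assoc, h, h2]
    simp only [neg_smul, one_smul]
    abel

theorem isAddFundamentalDomain_flow (t : ℝ) :
    IsAddFundamentalDomain AngleShifts
      (F.flowHomeo t '' (univ ×ˢ Ico 0 (2 * π) : Set UTCover)) := by
  refine IsAddFundamentalDomain.mk' ?_ fun z => ?_
  · exact ((F.flowHomeo t).measurableEmbedding.measurableSet_image.2
      (MeasurableSet.univ.prod measurableSet_Ico)).nullMeasurableSet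
  · obtain ⟨n, hn, hu⟩ := existsUnique_add_zsmul_mem_Ico two_pi_pos (F.flow z (-t)).2 0
    have key : ∀ g : AngleShifts,
        (g +ᵥ z ∈ F.flowHomeo t '' (univ ×ˢ Ico 0 (2 * π) : Set UTCover)) ↔
        (g +ᵥ F.flow z (-t)) ∈ (univ ×ˢ Ico 0 (2 * π) : Set UTCover) := by
      intro g
      rw [(F.flowHomeo t).image_eq_preimage_symm, mem_preimage, ← flow_vadd]
      rfl
    refine ⟨⟨n • ((0 : V2), 2 * π), ⟨n, rfl⟩⟩, ?_, ?_⟩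
    · refine (key _).2 ⟨trivial, ?_⟩
      have : (F.flow z (-t)).2 + n • (2 * π) ∈ Ico 0 (0 + 2 * π) := hn
      rw [zero_add, add_comm] at this
      exact this
    · rintro ⟨_, m, rfl⟩ hm
      obtain ⟨-, hm⟩ := (key _).1 hm
      have : (F.flow z (-t)).2 + m • (2 * π) ∈ Ico 0 (0 + 2 * π) := by
        rw [zero_add, add_comm]
        exact hm
      have h := hu m this
      subst h
      rfl

theorem periodic_vadd {α : Type*} {h : UTCover → α} (hp : ∀ z, h (z + (0, 2 * π)) = h z)
    (g : AngleShifts) (z : UTCover) : h (g +ᵥ z) = h z := by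
  obtain ⟨_, n, rfl⟩ := g
  have : Function.Periodic h ((0 : V2), 2 * π) := hp
  change h (n • ((0 : V2), 2 * π) + z) = h z
  rw [add_comm]
  exact this.zsmul n z

/-- The geodesic flow preserves the Liouville measure. -/
theorem lintegral_flow {t : ℝ} (ht : 0 ≤ t) {h : UTCover → ℝ≥0∞} (hh : Measurable h)
    (hp : ∀ z, h (z + (0, 2 * π)) = h z) :
    ∫⁻ z, h (F.flow z t) ∂M.liouvilleCover = ∫⁻ z, h z ∂M.liouvilleCover := by
  rw [M.lintegral_liouvilleCover h hh,
    M.lintegral_liouvilleCover (fun z => h (F.flow z t))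
      (hh.comp (F.continuous_flow_right t).measurable)]
  have hD : MeasurableSet (univ ×ˢ Ico 0 (2 * π) : Set UTCover) :=
    MeasurableSet.univ.prod measurableSet_Ico
  have : (volume : Measure UTCover).IsAddHaarMeasure := by
    rw [Measure.volume_eq_prod]
    infer_instance
  have h1 := isAddFundamentalDomain_angle.setLIntegral_eq (F.isAddFundamentalDomain_flow t)
    (fun z => ENNReal.ofReal (√(M.g z.1).det) * h z)
    (fun g z => periodic_vadd (h := fun z => ENNReal.ofReal (√(M.g z.1).det) * h z)
      (fun z => by simp [hp]) g z)
  rw [h1]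
  change _ = ∫⁻ z in (fun y => F.flow y t) '' _, _
  rw [lintegral_image_eq_lintegral_abs_det_fderiv_mul volume hD
    (fun z _ => (F.hasFDerivAt_flow z t ht).hasFDerivWithinAt) (F.flowHomeo t).injective.injOn]
  refine lintegral_congr fun z => ?_
  rw [← mul_assoc, ← ENNReal.ofReal_mul (abs_nonneg _)]
  congr 2
  have hdet : (F.flowDeriv z t).det = _ := F.det_flowDeriv z t
  have hp1 := sqrt_pos.2 (M.det_pos (F.flow z t).1)
  have hp2 := sqrt_pos.2 (M.det_pos z.1)
  rw [hdet, abs_of_pos (mul_pos (inv_pos.2 hp1) hp2)]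
  change _ = _ * √(M.g (F.flow z t).1).det
  field_simp

theorem integrable_flow {t : ℝ} (ht : 0 ≤ t) {h : UTCover → ℝ} (hh : Measurable h)
    (hp : ∀ z, h (z + (0, 2 * π)) = h z) (hi : Integrable h M.liouvilleCover) :
    Integrable (fun z => h (F.flow z t)) M.liouvilleCover := by
  refine ⟨(hh.comp (F.continuous_flow_right t).measurable).aestronglyMeasurable, ?_⟩
  have h2 := hi.2
  rw [hasFiniteIntegral_iff_enorm] at h2 ⊢
  rwa [F.lintegral_flow ht (h := fun z => ‖h z‖ₑ) hh.enorm (fun z => by simp [hp])]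

theorem integral_flow {t : ℝ} (ht : 0 ≤ t) {h : UTCover → ℝ} (hh : Measurable h)
    (hp : ∀ z, h (z + (0, 2 * π)) = h z) (hi : Integrable h M.liouvilleCover) :
    ∫ z, h (F.flow z t) ∂M.liouvilleCover = ∫ z, h z ∂M.liouvilleCover := by
  rw [integral_eq_lintegral_pos_part_sub_lintegral_neg_part (F.integrable_flow ht hh hp hi),
    integral_eq_lintegral_pos_part_sub_lintegral_neg_part hi,
    F.lintegral_flow ht (h := fun z => ENNReal.ofReal (h z)) hh.ennreal_ofReal
      (fun z => by simp [hp]),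
    F.lintegral_flow ht (h := fun z => ENNReal.ofReal (-h z)) hh.neg.ennreal_ofReal
      (fun z => by simp [hp])]

end HopfFlow

/-- The polar coordinates of a complex number near `v₀`, with the angle continued from `arg v₀`. -/
def polarNear (v₀ v : ℂ) : ℝ × ℝ :=
  (‖v₀‖ * exp (Complex.log (v / v₀)).re, Complex.arg v₀ + (Complex.log (v / v₀)).im)

theorem polarNear_self {v₀ : ℂ} (h : v₀ ≠ 0) : polarNear v₀ v₀ = (‖v₀‖, Complex.arg v₀) := by
  simp [polarNear, h]

theorem norm_polarNear {v₀ v : ℂ} (h₀ : v₀ ≠ 0) (h : v ≠ 0) : (polarNear v₀ v).1 = ‖v‖ := by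
  have h1 : ‖v‖ / ‖v₀‖ ≠ 0 := by positivity
  simp only [polarNear, Complex.log_re, norm_div]
  rw [exp_log (by positivity)]
  field_simp

theorem polarNear_spec {v₀ v : ℂ} (h₀ : v₀ ≠ 0) (h : v ≠ 0) :
    v = (polarNear v₀ v).1 * Complex.exp ((polarNear v₀ v).2 * Complex.I) := by
  rw [norm_polarNear h₀ h]
  have e1 : v = v₀ * Complex.exp (Complex.log (v / v₀)) := by
    rw [Complex.exp_log (div_ne_zero h h₀)]; field_simp
  have e2 := Complex.norm_mul_exp_arg_mul_I v₀
  have e3 := Complex.norm_mul_exp_arg_mul_I (v / v₀)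
  have : ((polarNear v₀ v).2 : ℂ) * Complex.I =
      Complex.arg v₀ * Complex.I + Complex.arg (v / v₀) * Complex.I := by
    simp [polarNear, Complex.log_im]; ring
  rw [this, Complex.exp_add]
  calc v = v₀ * (v / v₀) := by field_simp
    _ = (‖v₀‖ * Complex.exp (Complex.arg v₀ * Complex.I)) *
        (‖v / v₀‖ * Complex.exp (Complex.arg (v / v₀) * Complex.I)) := by rw [e2, e3]
    _ = _ := by
      have : (‖v‖ : ℂ) = ‖v₀‖ * ‖v / v₀‖ := by
        rw [norm_div]; push_cast
        have : (‖v₀‖ : ℂ) ≠ 0 := by simpa using h₀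
        field_simp
      rw [this]; ring

theorem polar_congr {X : Type*} {f : ℝ × ℝ → X} (hp : ∀ s θ, f (s, θ + 2 * π) = f (s, θ))
    {s θ : ℝ} (hs : 0 < s) {v : ℂ} (hv : v = s * Complex.exp (θ * Complex.I)) :
    f (‖v‖, Complex.arg v) = f (s, θ) := by
  have hn : ‖v‖ = s := by
    rw [hv, norm_mul, Complex.norm_exp_ofReal_mul_I, Complex.norm_real, norm_of_nonneg hs.le,
      mul_one]
  have h2 := Complex.norm_mul_exp_arg_mul_I v
  rw [hn] at h2 ⊢
  rw [hv] at h2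
  have h3 := mul_left_cancel₀ (by exact_mod_cast hs.ne') h2
  rw [← hv] at h3
  obtain ⟨n, hn⟩ := Complex.exp_eq_exp_iff_exists_int.1 h3
  have h4 : Complex.arg v = θ + n * (2 * π) := by
    have : ((Complex.arg v : ℝ) : ℂ) = ((θ + n * (2 * π) : ℝ) : ℂ) := by
      have hI := Complex.I_ne_zero
      apply mul_right_cancel₀ hI
      rw [hn]; push_cast; ring
    exact_mod_cast this
  rw [h4]
  have per : Function.Periodic (fun x => f (s, x)) (2 * π) := fun x => hp s x
  exact per.int_mul n θ

theorem re_ofReal_add_mul_I (a b : ℝ) : ((a : ℂ) + b * Complex.I).re = a := by simp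

theorem im_ofReal_add_mul_I (a b : ℝ) : ((a : ℂ) + b * Complex.I).im = b := by simp

theorem hasFDerivAt_polarNear {v₀ : ℂ} (h : v₀ ≠ 0) : HasFDerivAt (polarNear v₀)
    ((cos (Complex.arg v₀) • Complex.reCLM + sin (Complex.arg v₀) • Complex.imCLM).prod
      (‖v₀‖⁻¹ • (cos (Complex.arg v₀) • Complex.imCLM - sin (Complex.arg v₀) • Complex.reCLM)))
    v₀ := by
  have hl : HasDerivAt (fun v => Complex.log (v / v₀)) (1 / v₀) v₀ := by
    have h1 : HasDerivAt (fun v : ℂ => v / v₀) (1 / v₀) v₀ := (hasDerivAt_id v₀).div_const v₀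
    have := h1.clog (by simp [h, Complex.one_mem_slitPlane])
    simpa [h] using this
  have hl' := hl.hasFDerivAt.restrictScalars ℝ
  have hre := Complex.reCLM.hasFDerivAt.comp v₀ hl'
  have him := Complex.imCLM.hasFDerivAt.comp v₀ hl'
  have := (hre.exp.const_mul ‖v₀‖).prodMk (him.const_add (Complex.arg v₀))
  refine this.congr_fderiv ?_
  have hn : ‖v₀‖ ≠ 0 := by simpa using h
  have key : ∀ w : ℂ, w * v₀⁻¹ = ((‖v₀‖⁻¹ * (cos (Complex.arg v₀) * w.re + sin (Complex.arg v₀) * w.im) : ℝ) : ℂ)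
      + ((‖v₀‖⁻¹ * (cos (Complex.arg v₀) * w.im - sin (Complex.arg v₀) * w.re) : ℝ) : ℂ) * Complex.I := by
    intro w
    have hc : (‖v₀‖ : ℂ) ≠ 0 := by exact_mod_cast hn
    have e2 := Complex.norm_mul_exp_arg_mul_I v₀
    have e3 : v₀⁻¹ = (‖v₀‖ : ℂ)⁻¹ * Complex.exp (((-Complex.arg v₀ : ℝ) : ℂ) * Complex.I) := by
      conv_lhs => rw [← e2]
      rw [mul_inv, ← Complex.exp_neg]; push_cast; ring_nf
    rw [e3, Complex.exp_mul_I, ← Complex.ofReal_cos, ← Complex.ofReal_sin]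
    apply Complex.ext
    · simp; ring
    · simp; ring
  refine ContinuousLinearMap.ext fun w => ?_
  have k1 := congrArg Complex.re (key w)
  have k2 := congrArg Complex.im (key w)
  rw [re_ofReal_add_mul_I] at k1
  rw [im_ofReal_add_mul_I] at k2
  have e1 : ‖v₀‖ * (‖v₀‖⁻¹ * (cos v₀.arg * w.re + sin v₀.arg * w.im)) =
      cos v₀.arg * w.re + sin v₀.arg * w.im := by field_simp
  have e2 : rexp (Complex.log (v₀ / v₀)).re = 1 := by simp [h]
  refine Prod.ext ?_ ?_
  · change ‖v₀‖ * (rexp (Complex.log (v₀ / v₀)).re * (w * (1 / v₀)).re) =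
      cos v₀.arg * w.re + sin v₀.arg * w.im
    rw [e2, one_div, k1, one_mul, e1]
  · change (w * (1 / v₀)).im = ‖v₀‖⁻¹ * (cos v₀.arg * w.im - sin v₀.arg * w.re)
    rw [one_div, k2]

theorem continuous_polar_lift {X : Type*} [TopologicalSpace X] {f : ℝ × ℝ → X}
    (hf : Continuous f) (hp : ∀ s θ, f (s, θ + 2 * π) = f (s, θ))
    (h0 : ∀ θ, f (0, θ) = f (0, 0)) : Continuous fun v : ℂ => f (‖v‖, Complex.arg v) := by
  rw [continuous_iff_continuousAt]
  intro v₀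
  rcases eq_or_ne v₀ 0 with rfl | h
  · rw [ContinuousAt]
    simp only [norm_zero, Complex.arg_zero]
    intro U hU
    rw [mem_map]
    have : ∀ θ ∈ Icc (-π) π, ∀ᶠ z : ℝ × ℝ in nhds ((0 : ℝ), θ), f (z.1, z.2) ∈ U := by
      intro θ _
      exact hf.continuousAt (x := (0, θ)) (by rw [h0]; exact hU)
    have h1 := isCompact_Icc.eventually_forall_of_forall_eventually
      (P := fun s θ => f (s, θ) ∈ U) this
    have h2 : Tendsto (fun v : ℂ => ‖v‖) (nhds 0) (nhds 0) := by
      simpa using (continuous_norm (E := ℂ)).tendsto 0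
    filter_upwards [h2.eventually h1] with v hv
    exact hv _ ⟨(Complex.neg_pi_lt_arg v).le, Complex.arg_le_pi v⟩
  · have h1 : ContinuousAt (fun v => f (polarNear v₀ v)) v₀ :=
      hf.continuousAt.comp (hasFDerivAt_polarNear h).continuousAt
    refine h1.congr ?_
    filter_upwards [isOpen_ne.mem_nhds h] with v hv
    have h2 := norm_polarNear h hv
    exact (polar_congr hp (h2 ▸ norm_pos_iff.2 hv) (polarNear_spec h hv)).symm

namespace RMetric

variable (M : RMetric)

theorem met_unitVec_add (p : V2) (θ a b : ℝ) :
    M.met p (a • M.unitVec p θ + b • M.unitVec p (θ + π / 2))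
      (a • M.unitVec p θ + b • M.unitVec p (θ + π / 2)) = a ^ 2 + b ^ 2 := by
  have h1 := M.met_E1_E1 p
  have h2 := M.met_E1_E2 p
  have h3 := M.met_E2_E2 p
  rw [met_eq] at h1 h2 h3 ⊢
  simp only [Pi.add_apply, Pi.smul_apply, smul_eq_mul, unitVec_apply, frame_zero, frame_one,
    cos_add_pi_div_two, sin_add_pi_div_two]
  linear_combination (a * cos θ - b * sin θ) ^ 2 * h1 +
    2 * (a * cos θ - b * sin θ) * (a * sin θ + b * cos θ) * h2 +
    (a * sin θ + b * cos θ) ^ 2 * h3 + (a ^ 2 + b ^ 2) * cos_sq_add_sin_sq θ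

end RMetric

namespace HopfFlow

variable {M : RMetric} (F : HopfFlow M)

/-- The quotient `J t / t` of the Jacobi field by `t`, continued to `t = 0`. -/
def jacobiQuot (z : UTCover) (t : ℝ) : ℝ := ∫ τ in (0 : ℝ)..1, F.jacobiDeriv z (t * τ)

theorem jacobi_eq_mul_jacobiQuot (z : UTCover) (t : ℝ) :
    F.jacobi z t = t * F.jacobiQuot z t := by
  have h1 : Continuous (F.jacobiDeriv z) :=
    F.continuous_jacobi_jacobiDeriv.2.comp (Continuous.prodMk_right z)
  have h2 := intervalIntegral.integral_eq_sub_of_hasDerivAt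
    (fun s _ => F.hasDerivAt_jacobi z s) (h1.intervalIntegrable 0 t)
  rw [jacobiQuot, intervalIntegral.mul_integral_comp_mul_left, mul_zero, mul_one, h2, jacobi_zero,
    sub_zero]

theorem jacobiQuot_zero (z : UTCover) : F.jacobiQuot z 0 = 1 := by
  simp [jacobiQuot, jacobiDeriv_zero]

theorem jacobiQuot_pos (z : UTCover) {t : ℝ} (ht : 0 ≤ t) : 0 < F.jacobiQuot z t := by
  rcases ht.eq_or_lt with rfl | ht
  · simp [jacobiQuot_zero]
  · have := F.jacobi_pos z ht
    rw [jacobi_eq_mul_jacobiQuot] at this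
    exact pos_of_mul_pos_right this ht.le

theorem continuous_jacobiQuot : Continuous fun y : UTCover × ℝ => F.jacobiQuot y.1 y.2 := by
  refine intervalIntegral.continuous_parametric_intervalIntegral_of_continuous'
    (f := fun (y : UTCover × ℝ) τ => F.jacobiDeriv y.1 (y.2 * τ)) ?_ 0 1
  have h := F.continuous_jacobi_jacobiDeriv.2
  have h2 : Continuous fun w : (UTCover × ℝ) × ℝ => (w.1.1, w.1.2 * w.2) := by fun_prop
  exact h.comp h2

theorem posJacobi_add_two_pi (z : UTCover) (t : ℝ) :
    F.posJacobi (z + (0, 2 * π)) t = F.posJacobi z t := by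
  simp [posJacobi, flow_add_two_pi, F.U_add_two_pi]

theorem jacobi_add_two_pi (z : UTCover) (t : ℝ) :
    F.jacobi (z + (0, 2 * π)) t = F.jacobi z t := by
  simp [jacobi, posJacobi_add_two_pi]

theorem jacobiDeriv_add_two_pi (z : UTCover) (t : ℝ) :
    F.jacobiDeriv (z + (0, 2 * π)) t = F.jacobiDeriv z t := by
  simp [jacobiDeriv, posJacobi_add_two_pi, jacobi_add_two_pi, flow_add_two_pi, F.U_add_two_pi]

theorem jacobiQuot_add_two_pi (z : UTCover) (t : ℝ) :
    F.jacobiQuot (z + (0, 2 * π)) t = F.jacobiQuot z t := by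
  simp [jacobiQuot, jacobiDeriv_add_two_pi]

variable (p : V2)

/-- Geodesic polar coordinates about `p`. -/
def polar (y : ℝ × ℝ) : V2 := (F.flow (p, y.2) y.1).1

/-- The unit radial vector field in geodesic polar coordinates. -/
def radial (y : ℝ × ℝ) : V2 := (M.spray (F.flow (p, y.2) y.1)).1

/-- The unit angular vector field in geodesic polar coordinates. -/
def angular (y : ℝ × ℝ) : V2 := (M.horiz (F.flow (p, y.2) y.1)).1

theorem continuous_flow_fiber : Continuous fun y : ℝ × ℝ => F.flow (p, y.2) y.1 := by
  have h : Continuous fun y : ℝ × ℝ => ((p, y.2), y.1) := by fun_prop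
  exact F.continuous_flow.comp h

theorem continuous_polar : Continuous (F.polar p) := (F.continuous_flow_fiber p).fst

theorem continuous_radial : Continuous (F.radial p) :=
  (M.continuous_spray.comp (F.continuous_flow_fiber p)).fst

theorem continuous_angular : Continuous (F.angular p) :=
  (M.contDiff_horiz.continuous.comp (F.continuous_flow_fiber p)).fst

theorem flow_fiber_add_two_pi (θ t : ℝ) :
    F.flow (p, θ + 2 * π) t = F.flow (p, θ) t + (0, 2 * π) := by
  have : (p, θ + 2 * π) = ((p, θ) : UTCover) + (0, 2 * π) := by simp
  rw [this, flow_add_two_pi]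

theorem polar_add_two_pi (s θ : ℝ) : F.polar p (s, θ + 2 * π) = F.polar p (s, θ) := by
  simp [polar, flow_fiber_add_two_pi]

theorem radial_add_two_pi (s θ : ℝ) : F.radial p (s, θ + 2 * π) = F.radial p (s, θ) := by
  simp [radial, flow_fiber_add_two_pi, M.spray_add_two_pi]

theorem angular_add_two_pi (s θ : ℝ) : F.angular p (s, θ + 2 * π) = F.angular p (s, θ) := by
  have (z : UTCover) : M.horiz (z + (0, 2 * π)) = M.horiz z := by
    have : (z + (0, 2 * π)).2 + π / 2 = z.2 + π / 2 + 2 * π := by simp; ring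
    rw [RMetric.horiz, this]
    have h := M.spray_add_two_pi (z.1, z.2 + π / 2)
    simpa [RMetric.horiz] using h
  simp [angular, flow_fiber_add_two_pi, this]

theorem polar_zero (θ : ℝ) : F.polar p (0, θ) = p := by simp [polar, F.flow_zero]

theorem radial_zero (θ : ℝ) : F.radial p (0, θ) = M.unitVec p θ := by
  simp [radial, F.flow_zero, RMetric.spray]

theorem angular_zero (θ : ℝ) : F.angular p (0, θ) = M.unitVec p (θ + π / 2) := by
  simp [angular, F.flow_zero, RMetric.spray, RMetric.horiz]

theorem hasDerivAt_polar_fst (s θ : ℝ) :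
    HasDerivAt (fun s => F.polar p (s, θ)) (F.radial p (s, θ)) s :=
  (F.hasDerivAt_flow (p, θ) s).fst

theorem hasDerivAt_polar_snd {s : ℝ} (hs : 0 ≤ s) (θ : ℝ) :
    HasDerivAt (fun θ => F.polar p (s, θ)) (F.jacobi (p, θ) s • F.angular p (s, θ)) θ := by
  have h1 : HasDerivAt (fun θ : ℝ => ((p, θ) : UTCover)) (0, 1) θ :=
    (hasDerivAt_const θ p).prodMk (hasDerivAt_id θ)
  have h2 := (F.hasFDerivAt_flow (p, θ) s hs).comp_hasDerivAt θ h1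
  rw [flowDeriv_vertical] at h2
  refine ((ContinuousLinearMap.fst ℝ V2 ℝ).hasFDerivAt.comp_hasDerivAt θ h2).congr_deriv ?_
  simp [angular]

/-- The derivative of the exponential map in polar coordinates. -/
def polarDeriv (y : ℝ × ℝ) : ℂ →L[ℝ] V2 :=
  (cos y.2 • Complex.reCLM + sin y.2 • Complex.imCLM).smulRight (F.radial p y) +
    (F.jacobiQuot (p, y.2) y.1 • (cos y.2 • Complex.imCLM - sin y.2 • Complex.reCLM)).smulRight
      (F.angular p y)

theorem polarDeriv_apply (y : ℝ × ℝ) (w : ℂ) : F.polarDeriv p y w =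
    (cos y.2 * w.re + sin y.2 * w.im) • F.radial p y +
      (F.jacobiQuot (p, y.2) y.1 * (cos y.2 * w.im - sin y.2 * w.re)) • F.angular p y := by
  simp [polarDeriv]

theorem met_polarDeriv (y : ℝ × ℝ) (w : ℂ) :
    M.met (F.polar p y) (F.polarDeriv p y w) (F.polarDeriv p y w) =
      (cos y.2 * w.re + sin y.2 * w.im) ^ 2 +
      (F.jacobiQuot (p, y.2) y.1 * (cos y.2 * w.im - sin y.2 * w.re)) ^ 2 := by
  rw [polarDeriv_apply]
  exact M.met_unitVec_add _ _ _ _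

theorem polarDeriv_injective {y : ℝ × ℝ} (hy : 0 ≤ y.1) :
    Function.Injective (F.polarDeriv p y) := by
  rw [injective_iff_map_eq_zero]
  intro w hw
  have h := F.met_polarDeriv p y w
  rw [hw, RMetric.met_eq] at h
  simp only [Pi.zero_apply, mul_zero, add_zero] at h
  have hk := F.jacobiQuot_pos (p, y.2) hy
  have h1 : cos y.2 * w.re + sin y.2 * w.im = 0 := by nlinarith [sq_nonneg (cos y.2 * w.re + sin y.2 * w.im), sq_nonneg (F.jacobiQuot (p, y.2) y.1 * (cos y.2 * w.im - sin y.2 * w.re))]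
  have h2 : F.jacobiQuot (p, y.2) y.1 * (cos y.2 * w.im - sin y.2 * w.re) = 0 := by
    rw [h1] at h
    exact pow_eq_zero_iff (two_ne_zero) |>.1 (by linarith)
  have h3 := (mul_eq_zero.1 h2).resolve_left hk.ne'
  have h4 := cos_sq_add_sin_sq y.2
  apply Complex.ext
  · simp only [Complex.zero_re]
    linear_combination cos y.2 * h1 - sin y.2 * h3 - w.re * h4
  · simp only [Complex.zero_im]
    linear_combination sin y.2 * h1 + cos y.2 * h3 - w.im * h4

theorem continuous_polarDeriv : Continuous (F.polarDeriv p) := by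
  rw [continuous_clm_apply]
  intro w
  simp only [polarDeriv_apply]
  have h : Continuous fun y : ℝ × ℝ => F.jacobiQuot (p, y.2) y.1 := by
    have h : Continuous fun y : ℝ × ℝ => (((p, y.2) : UTCover), y.1) := by fun_prop
    exact F.continuous_jacobiQuot.comp h
  have h1 := F.continuous_radial p
  have h2 := F.continuous_angular p
  fun_prop

theorem polarDeriv_add_two_pi (s θ : ℝ) :
    F.polarDeriv p (s, θ + 2 * π) = F.polarDeriv p (s, θ) := by
  have : (p, θ + 2 * π) = ((p, θ) : UTCover) + (0, 2 * π) := by simp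
  ext1
  simp only [polarDeriv_apply, cos_add_two_pi, sin_add_two_pi, radial_add_two_pi,
    angular_add_two_pi, this, jacobiQuot_add_two_pi]

theorem polarDeriv_zero (θ : ℝ) (w : ℂ) : F.polarDeriv p (0, θ) w =
    w.re • M.unitVec p 0 + w.im • M.unitVec p (π / 2) := by
  rw [polarDeriv_apply]
  simp only [radial_zero, angular_zero, jacobiQuot_zero]
  ext k
  simp only [Pi.add_apply, Pi.smul_apply, smul_eq_mul, RMetric.unitVec_apply, cos_add_pi_div_two,
    sin_add_pi_div_two, cos_zero, sin_zero, cos_pi_div_two, sin_pi_div_two]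
  linear_combination (w.re * M.frame 0 p k + w.im * M.frame 1 p k) * cos_sq_add_sin_sq θ

theorem polarDeriv_radial (s θ : ℝ) :
    F.polarDeriv p (s, θ) (Complex.exp (θ * Complex.I)) = F.radial p (s, θ) := by
  have h := cos_sq_add_sin_sq θ
  rw [polarDeriv_apply, Complex.exp_ofReal_mul_I_re, Complex.exp_ofReal_mul_I_im]
  have e1 : cos θ * cos θ + sin θ * sin θ = 1 := by linarith
  have e2 : cos θ * sin θ - sin θ * cos θ = 0 := by ring
  simp [e1, e2]

/-- The exponential map at `p`. -/
def expMap (v : ℂ) : V2 := F.polar p (‖v‖, Complex.arg v)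

/-- The derivative of the exponential map at `p`. -/
def expDeriv (v : ℂ) : ℂ →L[ℝ] V2 := F.polarDeriv p (‖v‖, Complex.arg v)

theorem continuous_expDeriv : Continuous (F.expDeriv p) :=
  continuous_polar_lift (F.continuous_polarDeriv p) (F.polarDeriv_add_two_pi p) fun θ => by
    ext1 w
    rw [polarDeriv_zero, polarDeriv_zero]

theorem continuous_expMap : Continuous (F.expMap p) :=
  continuous_polar_lift (F.continuous_polar p) (F.polar_add_two_pi p) fun θ => by
    rw [polar_zero, polar_zero]

theorem hasFDerivAt_polar {y : ℝ × ℝ} (hy : 0 < y.1) : HasFDerivAt (F.polar p)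
    ((ContinuousLinearMap.toSpanSingleton ℝ (F.radial p y)).coprod
      (ContinuousLinearMap.toSpanSingleton ℝ (F.jacobi (p, y.2) y.1 • F.angular p y))) y := by
  have hj : Continuous fun y : ℝ × ℝ => F.jacobi (p, y.2) y.1 := by
    have h : Continuous fun y : ℝ × ℝ => (((p, y.2) : UTCover), y.1) := by fun_prop
    exact F.continuous_jacobi_jacobiDeriv.1.comp h
  have hr := F.continuous_radial p
  have ha := F.continuous_angular p
  refine (hasStrictFDerivAt_uncurry_coprod (u := y) (f := fun s θ => F.polar p (s, θ))
    (f₁ := fun s θ => ContinuousLinearMap.toSpanSingleton ℝ (F.radial p (s, θ)))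
    (f₂ := fun s θ => ContinuousLinearMap.toSpanSingleton ℝ
      (F.jacobi (p, θ) s • F.angular p (s, θ))) ?_ ?_ ?_ ?_).hasFDerivAt
  · exact .of_forall fun v => F.hasDerivAt_polar_fst p v.1 v.2
  · have : ∀ᶠ v : ℝ × ℝ in nhds y, 0 < v.1 := continuous_fst.continuousAt.eventually (lt_mem_nhds hy)
    filter_upwards [this] with v hv
    exact F.hasDerivAt_polar_snd p hv.le v.2
  · refine Continuous.continuousAt ?_
    refine continuous_clm_apply.2 fun w => ?_
    simp only [Function.HasUncurry.uncurry, id, ContinuousLinearMap.toSpanSingleton_apply]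
    fun_prop
  · refine Continuous.continuousAt ?_
    refine continuous_clm_apply.2 fun w => ?_
    simp only [Function.HasUncurry.uncurry, id, ContinuousLinearMap.toSpanSingleton_apply]
    fun_prop

theorem hasFDerivAt_expMap_of_ne {v₀ : ℂ} (h : v₀ ≠ 0) :
    HasFDerivAt (F.expMap p) (F.expDeriv p v₀) v₀ := by
  have hn : 0 < ‖v₀‖ := norm_pos_iff.2 h
  have h1 := F.hasFDerivAt_polar p (y := (‖v₀‖, Complex.arg v₀)) hn
  rw [← polarNear_self h] at h1
  have h2 := h1.comp v₀ (hasFDerivAt_polarNear h)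
  have h3 : F.expMap p =ᶠ[nhds v₀] F.polar p ∘ polarNear v₀ := by
    filter_upwards [isOpen_ne.mem_nhds h] with v hv
    have h2 := norm_polarNear h hv
    exact polar_congr (F.polar_add_two_pi p) (h2.symm ▸ norm_pos_iff.2 hv : 0 < (polarNear v₀ v).1)
      (polarNear_spec h hv)
  refine (h2.congr_of_eventuallyEq h3).congr_fderiv ?_
  ext1 w
  rw [polarNear_self h, expDeriv, polarDeriv_apply]
  simp only [ContinuousLinearMap.comp_apply, ContinuousLinearMap.coprod_apply,
    ContinuousLinearMap.prod_apply, ContinuousLinearMap.toSpanSingleton_apply,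
    jacobi_eq_mul_jacobiQuot]
  simp only [_root_.add_apply, _root_.smul_apply,
    _root_.sub_apply, Complex.reCLM_apply, Complex.imCLM_apply, smul_eq_mul, smul_smul]
  congr 2
  field_simp

theorem hasFDerivAt_expMap_zero : HasFDerivAt (F.expMap p) (F.expDeriv p 0) 0 := by
  rw [hasFDerivAt_iff_isLittleO_nhds_zero, Asymptotics.isLittleO_iff]
  intro ε hε
  have hc := (F.continuous_expDeriv p).continuousAt (x := 0)
  rw [Metric.continuousAt_iff] at hc
  obtain ⟨δ, hδ, hc⟩ := hc ε hε
  filter_upwards [Metric.ball_mem_nhds (0 : ℂ) hδ] with v hv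
  rw [Metric.mem_ball, dist_zero_right] at hv
  rcases eq_or_ne v 0 with rfl | h0
  · simp
  have hpos : 0 < ‖v‖ := norm_pos_iff.2 h0
  set θ := Complex.arg v with hθ
  set L := F.expDeriv p 0
  have hL : ∀ w, L w = F.polarDeriv p (0, θ) w := fun w => by
    rw [polarDeriv_zero]; simp only [L, expDeriv, norm_zero, polarDeriv_zero]
  have hd : ∀ s ∈ Icc 0 ‖v‖, HasDerivWithinAt
      (fun s : ℝ => F.polar p (s, θ) - s • L (Complex.exp (θ * Complex.I)))
      (F.radial p (s, θ) - L (Complex.exp (θ * Complex.I))) (Icc 0 ‖v‖) s := by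
    intro s _
    have := (hasDerivAt_id s).smul_const (L (Complex.exp (θ * Complex.I)))
    rw [one_smul] at this
    exact ((F.hasDerivAt_polar_fst p s θ).sub this).hasDerivWithinAt
  have hb : ∀ s ∈ Ico 0 ‖v‖, ‖F.radial p (s, θ) - L (Complex.exp (θ * Complex.I))‖ ≤ ε := by
    intro s hs
    rcases hs.1.eq_or_lt with rfl | hs0
    · rw [hL, polarDeriv_radial, sub_self, norm_zero]; exact hε.le
    · let x : ℂ := s * Complex.exp (θ * Complex.I)
      have hx : ‖x‖ = s := by
        simp only [x]
        rw [norm_mul, Complex.norm_exp_ofReal_mul_I, Complex.norm_real, norm_of_nonneg hs0.le,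
          mul_one]
      have h1 : F.expDeriv p x = F.polarDeriv p (s, θ) :=
        polar_congr (F.polarDeriv_add_two_pi p) hs0 rfl
      have h2 := (hc (x := x) (by rw [dist_zero_right, hx]; exact hs.2.trans hv)).le
      rw [dist_eq_norm, h1] at h2
      have h3 := (F.polarDeriv p (s, θ) - L).le_of_opNorm_le h2 (Complex.exp (θ * Complex.I))
      rw [_root_.sub_apply, polarDeriv_radial, Complex.norm_exp_ofReal_mul_I,
        mul_one] at h3
      exact h3
  have := norm_image_sub_le_of_norm_deriv_le_segment' hd hb ‖v‖ (right_mem_Icc.2 hpos.le)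
  have e : ‖v‖ • L (Complex.exp (θ * Complex.I)) = L v := by
    rw [← map_smul, Complex.real_smul, hθ, Complex.norm_mul_exp_arg_mul_I]
  rw [e] at this
  have e2 : F.expMap p 0 = p := by simp [expMap, polar_zero]
  rw [zero_add, e2]
  simp only [polar_zero, zero_smul, sub_zero] at this
  rw [sub_right_comm]
  exact this

theorem hasFDerivAt_expMap (v : ℂ) : HasFDerivAt (F.expMap p) (F.expDeriv p v) v := by
  rcases eq_or_ne v 0 with rfl | h
  · exact F.hasFDerivAt_expMap_zero p
  · exact F.hasFDerivAt_expMap_of_ne p h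

theorem hasStrictFDerivAt_expMap (v : ℂ) : HasStrictFDerivAt (F.expMap p) (F.expDeriv p v) v :=
  hasStrictFDerivAt_of_hasFDerivAt_of_continuousAt (.of_forall (F.hasFDerivAt_expMap p))
    (F.continuous_expDeriv p).continuousAt

/-- The derivative of the exponential map as a linear isomorphism. -/
def expDerivEquiv (v : ℂ) : ℂ ≃L[ℝ] V2 :=
  (LinearEquiv.ofInjectiveOfFinrankEq (F.expDeriv p v : ℂ →ₗ[ℝ] V2)
    (F.polarDeriv_injective p (norm_nonneg v)) (by simp)).toContinuousLinearEquiv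

theorem hasStrictFDerivAt_expMap' (v : ℂ) :
    HasStrictFDerivAt (F.expMap p) (F.expDerivEquiv p v : ℂ →L[ℝ] V2) v :=
  F.hasStrictFDerivAt_expMap p v

theorem isLocalHomeomorph_expMap : IsLocalHomeomorph (F.expMap p) := by
  refine IsLocalHomeomorph.mk _ fun v => ?_
  exact ⟨(F.hasStrictFDerivAt_expMap' p v).toOpenPartialHomeomorph _,
    (F.hasStrictFDerivAt_expMap' p v).mem_toOpenPartialHomeomorph_source, fun _ _ => rfl⟩

end HopfFlow

namespace RMetric

variable (M : RMetric)

/-- The Riemannian norm of the tangent vector `v` at `q`. -/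
def speed (q v : V2) : ℝ := √(M.met q v v)

theorem continuous_speed : Continuous fun x : V2 × V2 => M.speed x.1 x.2 := by
  have h (i j : Fin 2) : Continuous fun p => M.g p i j := (M.smooth i j).continuous
  simp only [speed, met_eq]
  have h1 := fun i j => (h i j).comp (continuous_fst (X := V2) (Y := V2))
  simp only [Function.comp_def] at h1
  have h00 := h1 0 0
  have h01 := h1 0 1
  have h11 := h1 1 1
  fun_prop

theorem speed_smul (q v : V2) (a : ℝ) : M.speed q (a • v) = |a| * M.speed q v := by
  have : M.met q (a • v) (a • v) = a ^ 2 * M.met q v v := by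
    simp only [met_eq, Pi.smul_apply, smul_eq_mul]; ring
  rw [speed, this, sqrt_mul (sq_nonneg a), sqrt_sq_eq_abs, speed]

end RMetric

namespace HopfFlow

variable {M : RMetric} (F : HopfFlow M) (p : V2)

theorem expMap_zero : F.expMap p 0 = p := by simp [expMap, polar_zero]

theorem inner_le_speed (v w : ℂ) :
    |v.re * w.re + v.im * w.im| ≤ ‖v‖ * M.speed (F.expMap p v) (F.expDeriv p v w) := by
  have h := F.met_polarDeriv p (‖v‖, Complex.arg v) w
  have h1 : |cos (Complex.arg v) * w.re + sin (Complex.arg v) * w.im| ≤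
      M.speed (F.expMap p v) (F.expDeriv p v w) := by
    apply abs_le_sqrt
    change _ ≤ M.met (F.polar p (‖v‖, Complex.arg v)) (F.polarDeriv p (‖v‖, Complex.arg v) w)
      (F.polarDeriv p (‖v‖, Complex.arg v) w)
    rw [h]
    nlinarith [sq_nonneg (F.jacobiQuot (p, Complex.arg v) ‖v‖ *
      (cos (Complex.arg v) * w.im - sin (Complex.arg v) * w.re))]
  have e : v.re * w.re + v.im * w.im =
      ‖v‖ * (cos (Complex.arg v) * w.re + sin (Complex.arg v) * w.im) := by
    conv_lhs => rw [← Complex.norm_mul_cos_arg v, ← Complex.norm_mul_sin_arg v]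
    ring
  rw [e, abs_mul, abs_norm]
  gcongr

theorem hasDerivAt_lift {c : ℝ → V2} {c' : V2} {γ : ℝ → ℂ} {t : ℝ} (hc : HasDerivAt c c' t)
    (hγ : ContinuousAt γ t) (h : ∀ᶠ s in nhds t, F.expMap p (γ s) = c s) :
    ∃ w, HasDerivAt γ w t ∧ F.expDeriv p (γ t) w = c' := by
  have hs := F.hasStrictFDerivAt_expMap' p (γ t)
  set e := hs.toOpenPartialHomeomorph (F.expMap p) with he
  have hmem : γ t ∈ e.source := hs.mem_toOpenPartialHomeomorph_source
  have ht : F.expMap p (γ t) = c t := h.self_of_nhds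
  have hmem' : c t ∈ e.target := by rw [← ht]; exact e.map_source hmem
  have hinv : e.symm (c t) = γ t := by rw [← ht]; exact e.left_inv hmem
  have h1 : HasFDerivAt e.symm ((F.expDerivEquiv p (γ t)).symm : V2 →L[ℝ] ℂ) (c t) := by
    refine e.hasFDerivAt_symm hmem' ?_
    rw [hinv]
    exact hs.hasFDerivAt
  refine ⟨(F.expDerivEquiv p (γ t)).symm c', ?_, ?_⟩
  · refine (h1.comp_hasDerivAt t hc).congr_of_eventuallyEq ?_
    filter_upwards [h, hγ.eventually (e.open_source.mem_nhds hmem)] with s hs1 hs2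
    rw [Function.comp, ← hs1]
    exact (e.left_inv hs2).symm
  · exact (F.expDerivEquiv p (γ t)).apply_symm_apply c'

theorem abs_norm_lift_sub_le {c c' : ℝ → V2} (hc : ∀ t, HasDerivAt c (c' t) t)
    (hc' : Continuous c') {γ : ℝ → ℂ} {a b : ℝ} (hab : a ≤ b) (hγ : ContinuousOn γ (Icc a b))
    (h : ∀ t ∈ Icc a b, F.expMap p (γ t) = c t) :
    |‖γ b‖ - ‖γ a‖| ≤ ∫ t in a..b, M.speed (c t) (c' t) := by
  have hcc : Continuous c := continuous_iff_continuousAt.2 fun t => (hc t).continuousAt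
  have hσ : Continuous fun t => M.speed (c t) (c' t) := M.continuous_speed.comp (hcc.prodMk hc')
  refine le_of_forall_pos_le_add fun δ hδ => ?_
  let N : ℝ → ℝ := fun t => √(‖γ t‖ ^ 2 + δ ^ 2)
  have hN1 (t : ℝ) : ‖γ t‖ ≤ N t := le_sqrt_of_sq_le (by nlinarith)
  have hN2 (t : ℝ) : N t ≤ ‖γ t‖ + δ := by
    apply sqrt_le_iff.2 ⟨by positivity, by nlinarith [norm_nonneg (γ t)]⟩
  have hNc : ContinuousOn N (Icc a b) := by
    apply ContinuousOn.sqrt; fun_prop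
  have hd : ∀ t ∈ Ioo a b, ∃ D, HasDerivAt N D t ∧ |D| ≤ M.speed (c t) (c' t) := by
    intro t ht
    have hn := Icc_mem_nhds ht.1 ht.2
    obtain ⟨w, hw, hw'⟩ := F.hasDerivAt_lift p (hc t) (hγ.continuousAt hn)
      (by filter_upwards [hn] with s hs using h s hs)
    have hre := Complex.reCLM.hasFDerivAt.comp_hasDerivAt t hw
    have him := Complex.imCLM.hasFDerivAt.comp_hasDerivAt t hw
    have hsq : HasDerivAt (fun s => ‖γ s‖ ^ 2 + δ ^ 2)
        (2 * ((γ t).re * w.re + (γ t).im * w.im)) t := by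
      have h2 := ((hre.mul hre).add (him.mul him)).add_const (δ ^ 2)
      have e : (fun s => ‖γ s‖ ^ 2 + δ ^ 2) = fun x =>
          (⇑Complex.reCLM ∘ γ * ⇑Complex.reCLM ∘ γ + ⇑Complex.imCLM ∘ γ * ⇑Complex.imCLM ∘ γ) x +
            δ ^ 2 := by
        funext s
        simp [Complex.sq_norm, Complex.normSq_apply]
      rw [e]
      refine h2.congr_deriv ?_
      simp
      ring
    have hpos : 0 < ‖γ t‖ ^ 2 + δ ^ 2 := by positivity
    refine ⟨_, hsq.sqrt hpos.ne', ?_⟩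
    have h3 := F.inner_le_speed p (γ t) w
    rw [hw', h t ⟨ht.1.le, ht.2.le⟩] at h3
    have hNpos : 0 < √(‖γ t‖ ^ 2 + δ ^ 2) := sqrt_pos.2 hpos
    rw [mul_div_mul_left _ _ two_ne_zero, abs_div, abs_of_pos hNpos, div_le_iff₀ hNpos]
    refine h3.trans ?_
    rw [mul_comm]
    gcongr
    · exact sqrt_nonneg _
    · exact hN1 t
  choose! D hD hD' using hd
  have i1 := intervalIntegral.sub_le_integral_of_hasDeriv_right_of_le hab hNc
    (fun t ht => (hD t ht).hasDerivWithinAt) (hσ.integrableOn_Icc)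
    (fun t ht => (le_abs_self _).trans (hD' t ht))
  have i2 := intervalIntegral.sub_le_integral_of_hasDeriv_right_of_le hab hNc.neg
    (fun t ht => (hD t ht).neg.hasDerivWithinAt) (hσ.integrableOn_Icc)
    (fun t ht => (neg_le_abs _).trans (hD' t ht))
  simp only [Pi.neg_apply] at i2
  have := hN1 a
  have := hN1 b
  have := hN2 a
  have := hN2 b
  rw [abs_le]
  constructor <;> linarith

/-- The property that the curve `c` lifts through the exponential map on `[0, T]`. -/
def LiftsTo (c : ℝ → V2) (T : ℝ) : Prop :=
  0 ≤ T ∧ ∃ γ : ℝ → ℂ, ContinuousOn γ (Icc 0 T) ∧ γ 0 = 0 ∧ ∀ t ∈ Icc 0 T, F.expMap p (γ t) = c t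

theorem liftsTo_near {c c' : ℝ → V2} (hc : ∀ t, HasDerivAt c (c' t) t) (hc' : Continuous c')
    {T : ℝ} (hT : T ∈ closure {T | F.LiftsTo p c T}) :
    ∃ δ > 0, ∀ T' ≥ 0, |T' - T| < δ → F.LiftsTo p c T' := by
  have hcc : Continuous c := continuous_iff_continuousAt.2 fun t => (hc t).continuousAt
  have hσ : Continuous fun t => M.speed (c t) (c' t) := M.continuous_speed.comp (hcc.prodMk hc')
  obtain ⟨τ, hτ, hlim⟩ := mem_closure_iff_seq_limit.1 hT
  choose hτ0 γ hγc hγ0 hγ using hτ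
  have hbd : ∀ n, ‖γ n (τ n)‖ ≤ ∫ t in (0 : ℝ)..τ n, M.speed (c t) (c' t) := fun n => by
    have := F.abs_norm_lift_sub_le p hc hc' (hτ0 n) (hγc n) (hγ n)
    rw [hγ0, norm_zero, sub_zero, abs_norm] at this
    exact this
  have hI : Continuous fun T => ∫ t in (0 : ℝ)..T, M.speed (c t) (c' t) :=
    intervalIntegral.continuous_primitive (fun a b => hσ.intervalIntegrable a b) 0
  have hI2 := (hI.tendsto T).comp hlim
  set R := (∫ t in (0 : ℝ)..T, M.speed (c t) (c' t)) + 1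
  have hev : ∀ᶠ n in atTop, γ n (τ n) ∈ Metric.closedBall (0 : ℂ) R := by
    filter_upwards [hI2.eventually (gt_mem_nhds (lt_add_one _))] with n hn
    rw [mem_closedBall_zero_iff]
    exact (hbd n).trans hn.le
  obtain ⟨w, -, φ, hφ, hw⟩ :=
    tendsto_subseq_of_frequently_bounded Metric.isBounded_closedBall hev.frequently
  have hlimφ := hlim.comp hφ.tendsto_atTop
  have hEw : F.expMap p w = c T := by
    refine tendsto_nhds_unique (((F.continuous_expMap p).tendsto w).comp hw) ?_
    refine ((hcc.tendsto T).comp hlimφ).congr fun n => ?_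
    exact (hγ (φ n) (τ (φ n)) ⟨hτ0 _, le_rfl⟩).symm
  have hs := F.hasStrictFDerivAt_expMap' p w
  set e := hs.toOpenPartialHomeomorph (F.expMap p) with he
  have hmem : w ∈ e.source := hs.mem_toOpenPartialHomeomorph_source
  have hmem' : c T ∈ e.target := by rw [← hEw]; exact e.map_source hmem
  obtain ⟨δ, hδ, hball⟩ := Metric.mem_nhds_iff.1
    (hcc.continuousAt.preimage_mem_nhds (e.open_target.mem_nhds hmem'))
  refine ⟨δ, hδ, fun T' hT' hd => ?_⟩
  obtain ⟨n, hn1, hn2⟩ := ((hw.eventually (e.open_source.mem_nhds hmem)).and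
    (hlimφ.eventually (Metric.ball_mem_nhds T hδ))).exists
  simp only [Function.comp] at hn1 hn2
  generalize φ n = m at hn1 hn2
  rcases le_total T' (τ m) with hle | hle
  · exact ⟨hT', γ m, (hγc m).mono (Icc_subset_Icc_right hle), hγ0 m, fun t ht =>
      hγ m t ⟨ht.1, ht.2.trans hle⟩⟩
  have hin : ∀ t ∈ Icc (τ m) T', c t ∈ e.target := by
    intro t ht
    refine hball ?_
    rw [Metric.mem_ball]
    rw [dist_eq] at hn2 ⊢
    rw [abs_lt] at *
    exact ⟨by linarith [ht.1], by linarith [ht.2]⟩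
  have hjoin : γ m (τ m) = e.symm (c (τ m)) := by
    rw [← hγ m (τ m) ⟨hτ0 m, le_rfl⟩]
    exact (e.left_inv hn1).symm
  let Γ : ℝ → ℂ := fun t => if t ≤ τ m then γ m t else e.symm (c t)
  have g1 : ∀ t ∈ Icc 0 (τ m), Γ t = γ m t := fun t ht => if_pos ht.2
  have g2 : ∀ t ∈ Icc (τ m) T', Γ t = e.symm (c t) := fun t ht => by
    rcases ht.1.eq_or_lt with rfl | hlt
    · simp only [Γ, le_refl, if_true]; exact hjoin
    · exact if_neg hlt.not_ge
  refine ⟨hT', Γ, ?_, ?_, ?_⟩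
  · rw [← Icc_union_Icc_eq_Icc (hτ0 m) hle]
    refine ContinuousOn.union_of_isClosed ((hγc m).congr g1) ?_ isClosed_Icc isClosed_Icc
    refine ContinuousOn.congr ?_ g2
    exact e.continuousOn_symm.comp hcc.continuousOn hin
  · rw [g1 0 ⟨le_rfl, hτ0 m⟩, hγ0]
  · intro t ht
    rcases le_total t (τ m) with h | h
    · rw [g1 t ⟨ht.1, h⟩, hγ m t ⟨ht.1, h⟩]
    · rw [g2 t ⟨h, ht.2⟩]
      exact e.right_inv (hin t ⟨h, ht.2⟩)

theorem liftsTo_one {c c' : ℝ → V2} (hc : ∀ t, HasDerivAt c (c' t) t) (hc' : Continuous c')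
    (h0 : c 0 = p) : F.LiftsTo p c 1 := by
  have h := IsClosed.Icc_subset_of_forall_mem_nhdsWithin (a := 0) (b := 1)
    (s := {T | F.LiftsTo p c T}) ?_ ?_ ?_
  · exact h (right_mem_Icc.2 zero_le_one)
  · refine isClosed_of_closure_subset fun T hT => ?_
    have hT1 := closure_mono inter_subset_left hT
    have hT2 : T ∈ Icc (0 : ℝ) 1 := isClosed_Icc.closure_subset_iff.2 inter_subset_right hT
    obtain ⟨δ, hδ, h⟩ := F.liftsTo_near p hc hc' hT1
    exact ⟨h T hT2.1 (by simpa using hδ), hT2⟩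
  · refine ⟨le_rfl, fun _ => 0, continuousOn_const, rfl, fun t ht => ?_⟩
    have : t = 0 := le_antisymm ht.2 ht.1
    rw [this, h0, expMap_zero]
  · intro T hT
    obtain ⟨δ, hδ, h⟩ := F.liftsTo_near p hc hc' (subset_closure hT.1)
    have h1 : Metric.ball T δ ∈ nhdsWithin T (Ioi T) :=
      mem_nhdsWithin_of_mem_nhds (Metric.ball_mem_nhds T hδ)
    filter_upwards [h1, self_mem_nhdsWithin] with T' hT' hT''
    exact h T' (hT.2.1.trans (le_of_lt hT'')) hT'

theorem exists_logMap : ∃ L : V2 → ℂ, Continuous L ∧ (∀ q, F.expMap p (L q) = q) ∧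
    ∀ v, L (F.expMap p v) = v := by
  have hd : ∀ q : V2, ∀ t, HasDerivAt (fun t : ℝ => p + t • (q - p)) (q - p) t := fun q t => by
    simpa using ((hasDerivAt_id t).smul_const (q - p)).const_add p
  have hl : ∀ q : V2, F.LiftsTo p (fun t : ℝ => p + t • (q - p)) 1 := fun q =>
    F.liftsTo_one p (hd q) continuous_const (by simp)
  choose _ γ hγc hγ0 hγ using hl
  have sep : IsSeparatedMap (F.expMap p) := T2Space.isSeparatedMap _
  let g : unitInterval × V2 → ℂ := fun y => γ y.2 y.1
  have hg : Continuous g := by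
    refine (F.isLocalHomeomorph_expMap p).continuous_lift sep
      ⟨fun y : unitInterval × V2 => p + (y.1 : ℝ) • (y.2 - p), by fun_prop⟩ ?_ ?_ ?_
    · ext1 y
      exact hγ y.2 y.1 y.1.2
    · have : (fun q => g (0, q)) = fun _ => 0 := funext fun q => hγ0 q
      rw [this]
      exact continuous_const
    · intro q
      exact continuousOn_iff_continuous_domRestrict.1 (hγc q)
  have hL : Continuous fun q => g (1, q) := hg.comp (by fun_prop)
  have hE : ∀ q, F.expMap p (g (1, q)) = q := fun q => by
    have := hγ q 1 (right_mem_Icc.2 zero_le_one)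
    simpa [g] using this
  have hLp : g (1, p) = 0 := by
    have := F.abs_norm_lift_sub_le p (hd p) continuous_const zero_le_one (hγc p) (hγ p)
    have e (x : V2) : M.speed x 0 = 0 := by simp [RMetric.speed, RMetric.met_eq]
    simp only [sub_self, e, hγ0, norm_zero, sub_zero, abs_norm, intervalIntegral.integral_zero] at this
    simpa [g] using this
  refine ⟨fun q => g (1, q), hL, hE, fun v => ?_⟩
  have := sep.eq_of_comp_eq (F.isLocalHomeomorph_expMap p).isLocallyInjective
    (g₁ := fun v => g (1, F.expMap p v)) (g₂ := id) (hL.comp (F.continuous_expMap p)) continuous_id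
    (by ext1 v; exact hE _) 0 (by rw [expMap_zero]; exact hLp)
  exact congrFun this v

/-- The exponential map at `p` as a homeomorphism. -/
def expHomeo : ℂ ≃ₜ V2 where
  toFun := F.expMap p
  invFun := (F.exists_logMap p).choose
  left_inv := (F.exists_logMap p).choose_spec.2.2
  right_inv := (F.exists_logMap p).choose_spec.2.1
  continuous_toFun := F.continuous_expMap p
  continuous_invFun := (F.exists_logMap p).choose_spec.1

/-- The distance to `p`, as the norm in normal coordinates. -/
def radius (q : V2) : ℝ := ‖(F.expHomeo p).symm q‖

theorem radius_expMap (v : ℂ) : F.radius p (F.expMap p v) = ‖v‖ :=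
  congrArg norm ((F.expHomeo p).symm_apply_apply v)

theorem radius_self : F.radius p p = 0 := by
  conv_lhs => rw [← F.expMap_zero p]
  rw [expMap_zero]
  have := F.radius_expMap p 0
  rwa [expMap_zero, norm_zero] at this

theorem continuous_radius : Continuous (F.radius p) := (F.expHomeo p).symm.continuous.norm

theorem abs_radius_sub_le {c c' : ℝ → V2} (hc : ∀ t, HasDerivAt c (c' t) t)
    (hc' : Continuous c') {a b : ℝ} (hab : a ≤ b) :
    |F.radius p (c b) - F.radius p (c a)| ≤ ∫ t in a..b, M.speed (c t) (c' t) := by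
  have hcc : Continuous c := continuous_iff_continuousAt.2 fun t => (hc t).continuousAt
  exact F.abs_norm_lift_sub_le p hc hc' (γ := fun t => (F.expHomeo p).symm (c t)) hab
    ((F.expHomeo p).symm.continuous.comp hcc).continuousOn
    fun t _ => (F.expHomeo p).apply_symm_apply (c t)

theorem abs_radius_flow_sub_le (z : UTCover) {t : ℝ} (ht : 0 ≤ t) :
    |F.radius p (F.flow z t).1 - F.radius p z.1| ≤ t := by
  have h := F.abs_radius_sub_le p (c := fun t => (F.flow z t).1)
    (fun t => (F.hasDerivAt_flow z t).fst) (M.continuous_spray.comp (F.continuous_flow_left z)).fst ht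
  have e (t : ℝ) : M.speed (F.flow z t).1 (M.spray (F.flow z t)).1 = 1 := by
    rw [RMetric.speed, RMetric.spray, RMetric.met_unitVec, sqrt_one]
  simpa [e, F.flow_zero] using h

theorem dist_eq_radius (q : V2) : M.dist p q = F.radius p q := by
  have key : ∀ L ∈ {L | ∃ γ : ℝ → V2, ContDiff ℝ 1 γ ∧ γ 0 = p ∧ γ 1 = q ∧ L = M.curveLen γ 0 1},
      F.radius p q ≤ L := by
    rintro L ⟨γ, hγ, h0, h1, rfl⟩
    have hd : ∀ t, HasDerivAt γ (vel γ t) t := fun t => hasDerivAt_pi.2 fun k =>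
      (differentiableAt_pi.1 (hγ.differentiable one_ne_zero t) k).hasDerivAt
    have hv : Continuous (vel γ) := by
      have : vel γ = deriv γ := funext fun t => (hd t).deriv.symm
      rw [this]
      exact hγ.continuous_deriv le_rfl
    have := F.abs_radius_sub_le p hd hv zero_le_one
    rw [h0, h1, radius_self, sub_zero] at this
    exact (le_abs_self _).trans this
  have hmem : F.radius p q ∈
      {L | ∃ γ : ℝ → V2, ContDiff ℝ 1 γ ∧ γ 0 = p ∧ γ 1 = q ∧ L = M.curveLen γ 0 1} := by
    set v := (F.expHomeo p).symm q with hv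
    have hq : F.expMap p v = q := (F.expHomeo p).apply_symm_apply q
    let θ := Complex.arg v
    let γ : ℝ → V2 := fun t => F.polar p (t * ‖v‖, θ)
    have hd : ∀ t, HasDerivAt γ (‖v‖ • F.radial p (t * ‖v‖, θ)) t := fun t => by
      have h1 : HasDerivAt (fun t : ℝ => t * ‖v‖) ‖v‖ t := by
        simpa using (hasDerivAt_id t).mul_const ‖v‖
      exact (F.hasDerivAt_polar_fst p (t * ‖v‖) θ).scomp t h1
    have hvel : ∀ t, vel γ t = ‖v‖ • F.radial p (t * ‖v‖, θ) := fun t => funext fun k =>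
      (hasDerivAt_pi.1 (hd t) k).deriv
    refine ⟨γ, ?_, ?_, ?_, ?_⟩
    · refine contDiff_one_iff_deriv.2 ⟨fun t => (hd t).differentiableAt, ?_⟩
      rw [funext fun t => (hd t).deriv]
      have := F.continuous_radial p
      fun_prop
    · simp [γ, polar_zero]
    · simp only [γ, one_mul]; exact hq
    · have e (t : ℝ) : √(M.met (γ t) (vel γ t) (vel γ t)) = ‖v‖ := by
        have e1 := M.speed_smul (γ t) (F.radial p (t * ‖v‖, θ)) ‖v‖
        have e2 : M.speed (γ t) (F.radial p (t * ‖v‖, θ)) = 1 := by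
          simp only [RMetric.speed]
          rw [← sqrt_one]
          congr 1
          exact M.met_unitVec _ _
        rw [hvel]
        rw [e2, abs_norm, mul_one] at e1
        exact e1
      simp only [RMetric.curveLen, e]
      simp [radius, v]
  exact le_antisymm (csInf_le ⟨_, key⟩ hmem) (le_csInf ⟨_, hmem⟩ key)

end HopfFlow

theorem hasDerivAt_intervalIntegral_of_continuous {h g : ℝ → ℝ → ℝ} {a b : ℝ}
    (hd : ∀ s θ, HasDerivAt (fun s => h s θ) (g s θ) s) (hh : ∀ s, Continuous (h s))
    (hg : Continuous fun y : ℝ × ℝ => g y.1 y.2) (s : ℝ) :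
    HasDerivAt (fun s => ∫ θ in a..b, h s θ) (∫ θ in a..b, g s θ) s := by
  have hG : Continuous fun s => ∫ θ in a..b, g s θ :=
    intervalIntegral.continuous_parametric_intervalIntegral_of_continuous' hg a b
  have e : (fun s => ∫ θ in a..b, h s θ) = fun s =>
      (∫ θ in a..b, h 0 θ) + ∫ τ in (0 : ℝ)..s, ∫ θ in a..b, g τ θ := by
    funext s
    rw [intervalIntegral_intervalIntegral_swap]
    · rw [← intervalIntegral.integral_add ((hh 0).intervalIntegrable _ _)]
      · congr 1
        funext θ
        rw [intervalIntegral.integral_eq_sub_of_hasDerivAt (fun τ _ => hd τ θ)]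
        · ring
        · exact (hg.comp (by fun_prop : Continuous fun τ : ℝ => (τ, θ))).intervalIntegrable _ _
      · refine (intervalIntegral.continuous_parametric_intervalIntegral_of_continuous'
          (f := fun θ τ => g τ θ) ?_ 0 s).intervalIntegrable _ _
        exact hg.comp (by fun_prop : Continuous fun y : ℝ × ℝ => (y.2, y.1))
    · exact (hg.continuousOn.integrableOn_compact (isCompact_uIcc.prod isCompact_uIcc)).mono_set
        (prod_mono uIoc_subset_uIcc uIoc_subset_uIcc)
  rw [e]
  exact (intervalIntegral.integral_hasDerivAt_right (hG.intervalIntegrable _ _)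
    hG.stronglyMeasurable.stronglyMeasurableAtFilter hG.continuousAt).const_add _

namespace RMetric

variable (M : RMetric)

instance : IsLocallyFiniteMeasure M.area :=
  IsLocallyFiniteMeasure.withDensity_ofReal M.continuous_density

theorem area_absolutelyContinuous : M.area ≪ volume := withDensity_absolutelyContinuous _ _

theorem setIntegral_area {s : Set V2} (hs : MeasurableSet s) (f : V2 → ℝ) :
    ∫ q in s, f q ∂M.area = ∫ q in s, √(M.g q).det * f q := by
  have h : M.area = volume.withDensity fun q => ((√(M.g q).det).toNNReal : ℝ≥0∞) := rfl
  rw [h, setIntegral_withDensity_eq_setIntegral_smul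
    (M.continuous_density.measurable.real_toNNReal) _ hs]
  refine setIntegral_congr_fun hs fun q _ => ?_
  simp [NNReal.smul_def]

end RMetric

namespace HopfFlow

variable {M : RMetric} (F : HopfFlow M) (p : V2)

theorem expMap_polar {s θ : ℝ} (hs : 0 < s) (hθ : θ ∈ Ioc (-π) π) :
    F.expMap p (s * (Complex.cos θ + Complex.sin θ * Complex.I)) = F.polar p (s, θ) := by
  rw [expMap, Complex.arg_mul_cos_add_sin_mul_I hs hθ]
  congr 2
  rw [norm_mul, Complex.norm_cos_add_sin_mul_I, mul_one, Complex.norm_real, norm_of_nonneg hs.le]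

theorem radius_polar {s θ : ℝ} (hs : 0 < s) (hθ : θ ∈ Ioc (-π) π) :
    F.radius p (F.polar p (s, θ)) = s := by
  rw [← expMap_polar F p hs hθ, radius_expMap, norm_mul, Complex.norm_cos_add_sin_mul_I, mul_one,
    Complex.norm_real, norm_of_nonneg hs.le]

theorem polar_injOn {s θ s' θ' : ℝ} (hs : 0 < s) (hθ : θ ∈ Ioc (-π) π) (hs' : 0 < s')
    (hθ' : θ' ∈ Ioc (-π) π) (h : F.polar p (s, θ) = F.polar p (s', θ')) : s = s' ∧ θ = θ' := by
  refine ⟨by rw [← F.radius_polar p hs hθ, h, F.radius_polar p hs' hθ'], ?_⟩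
  rw [← expMap_polar F p hs hθ, ← expMap_polar F p hs' hθ'] at h
  have := congrArg Complex.arg ((F.expHomeo p).injective h)
  rwa [Complex.arg_mul_cos_add_sin_mul_I hs hθ, Complex.arg_mul_cos_add_sin_mul_I hs' hθ'] at this

/-- Integration in geodesic polar coordinates. -/
theorem setIntegral_polar {I : Set ℝ} (hI : MeasurableSet I) (hpos : ∀ s ∈ I, 0 < s) (f : V2 → ℝ) :
    ∫ q in {q | F.radius p q ∈ I}, f q ∂M.area =
      ∫ y in I ×ˢ Ioc (-π) π, F.jacobi (p, y.2) y.1 * f (F.polar p y) := by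
  set S : Set V2 := {w | w 0 ∈ I ∧ w 1 ∈ Ioc (-π) π} with hS
  have hSm : MeasurableSet S :=
    (hI.preimage (measurable_pi_apply 0)).inter
      (measurableSet_Ioc.preimage (measurable_pi_apply 1))
  let T : V2 → V2 := fun w => F.polar p (w 0, w 1)
  let T' : V2 → V2 →L[ℝ] V2 := fun w =>
    ((ContinuousLinearMap.toSpanSingleton ℝ (F.radial p (w 0, w 1))).coprod
      (ContinuousLinearMap.toSpanSingleton ℝ
        (F.jacobi (p, w 1) (w 0) • F.angular p (w 0, w 1)))).comp
      ((ContinuousLinearMap.proj 0).prod (ContinuousLinearMap.proj 1))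
  have hT : ∀ w ∈ S, HasFDerivWithinAt T (T' w) S w := fun w hw => by
    refine HasFDerivAt.hasFDerivWithinAt ?_
    have h1 : HasFDerivAt (fun w : V2 => (w 0, w 1))
      ((ContinuousLinearMap.proj (R := ℝ) (φ := fun _ : Fin 2 => ℝ) 0).prod
        (ContinuousLinearMap.proj 1)) w :=
      ((ContinuousLinearMap.proj (R := ℝ) (φ := fun _ : Fin 2 => ℝ) 0).prod
        (ContinuousLinearMap.proj 1)).hasFDerivAt
    exact (F.hasFDerivAt_polar p (y := (w 0, w 1)) (hpos _ hw.1)).comp w h1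
  have hinj : InjOn T S := fun w hw w' hw' h => by
    obtain ⟨h0, h1⟩ := F.polar_injOn p (hpos _ hw.1) hw.2 (hpos _ hw'.1) hw'.2 h
    ext k
    fin_cases k
    exacts [h0, h1]
  have himg : T '' S = {q | F.radius p q ∈ I} := by
    ext q
    constructor
    · rintro ⟨w, hw, rfl⟩
      change F.radius p (F.polar p (w 0, w 1)) ∈ I
      rw [F.radius_polar p (hpos _ hw.1) hw.2]
      exact hw.1
    · intro hq
      refine ⟨![F.radius p q, Complex.arg ((F.expHomeo p).symm q)], ⟨hq, ?_⟩, ?_⟩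
      · exact Complex.arg_mem_Ioc _
      · exact (F.expHomeo p).apply_symm_apply q
  have hdet : ∀ w, (T' w).det =
      F.jacobi (p, w 1) (w 0) * (√(M.g (T w)).det)⁻¹ := fun w => by
    have h := M.det_unitVec (T w) (F.flow (p, w 1) (w 0)).2
    rw [← h, ContinuousLinearMap.det, ← LinearMap.det_toMatrix', Matrix.det_fin_two]
    simp [T', LinearMap.toMatrix'_apply, radial, angular, RMetric.spray, RMetric.horiz, T, polar]
    ring
  have hqm : MeasurableSet {q | F.radius p q ∈ I} := (F.continuous_radius p).measurable hI
  rw [RMetric.setIntegral_area _ hqm, ← himg,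
    integral_image_eq_integral_abs_det_fderiv_smul volume hSm hT hinj]
  have hmp := (volume_preserving_finTwoArrow ℝ).setIntegral_preimage_emb
    (MeasurableEquiv.finTwoArrow (α := ℝ)).measurableEmbedding
    (fun y : ℝ × ℝ => F.jacobi (p, y.2) y.1 * f (F.polar p y)) (I ×ˢ Ioc (-π) π)
  rw [← hmp]
  refine setIntegral_congr_fun hSm fun w hw => ?_
  have hJ := F.jacobi_pos (p, w 1) (hpos _ hw.1)
  have hD : 0 < √(M.g (T w)).det := sqrt_pos.2 (M.det_pos _)
  simp only [hdet, smul_eq_mul]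
  rw [abs_of_pos (by positivity)]
  change _ = F.jacobi (p, w 1) (w 0) * f (T w)
  field_simp

theorem isCompact_radius_le (r : ℝ) : IsCompact {q | F.radius p q ≤ r} := by
  have : {q | F.radius p q ≤ r} = (F.expHomeo p) '' Metric.closedBall 0 r := by
    rw [Homeomorph.image_eq_preimage_symm]
    ext q
    simp [radius]
  rw [this]
  exact (isCompact_closedBall _ _).image (F.expHomeo p).continuous

theorem area_radius_eq (r : ℝ) : M.area {q | F.radius p q = r} = 0 := by
  rcases le_or_gt r 0 with hr | hr
  · refine measure_mono_null (t := {p}) (fun q hq => ?_) ?_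
    · have h : ‖(F.expHomeo p).symm q‖ = r := hq
      have h0 : (F.expHomeo p).symm q = 0 := norm_le_zero_iff.1 (h.trans_le hr)
      have := (F.expHomeo p).apply_symm_apply q
      rw [h0] at this
      exact this.symm.trans (F.expMap_zero p)
    · exact M.area_absolutelyContinuous (measure_singleton p)
  · have h := F.setIntegral_polar p (measurableSet_singleton r) (by rintro s rfl; exact hr)
      fun _ => 1
    have hnull : (volume : Measure (ℝ × ℝ)) ({r} ×ˢ Ioc (-π) π) = 0 := by
      rw [Measure.volume_eq_prod, Measure.prod_prod]
      simp
    rw [Measure.restrict_eq_zero.2 hnull, integral_zero_measure] at h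
    simp only [mem_singleton_iff, integral_const, smul_eq_mul, mul_one, measureReal_restrict_apply,
      MeasurableSet.univ, univ_inter] at h
    refine (measureReal_eq_zero_iff ?_).1 h
    exact ((measure_mono fun q hq => le_of_eq hq).trans_lt
      (F.isCompact_radius_le p r).measure_lt_top).ne

end HopfFlow

namespace HopfFlow

variable {M : RMetric} (F : HopfFlow M) (p : V2)

theorem continuous_jacobi_fiber : Continuous fun y : ℝ × ℝ => F.jacobi (p, y.2) y.1 := by
  have h : Continuous fun y : ℝ × ℝ => (((p, y.2) : UTCover), y.1) := by fun_prop
  exact F.continuous_jacobi_jacobiDeriv.1.comp h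

theorem continuous_jacobiDeriv_fiber : Continuous fun y : ℝ × ℝ => F.jacobiDeriv (p, y.2) y.1 := by
  have h : Continuous fun y : ℝ × ℝ => (((p, y.2) : UTCover), y.1) := by fun_prop
  exact F.continuous_jacobi_jacobiDeriv.2.comp h

/-- The length of the metric circle of radius `s` about `p`. -/
def circumference (s : ℝ) : ℝ := ∫ θ in (-π)..π, F.jacobi (p, θ) s

/-- The total geodesic curvature of the metric circle of radius `s` about `p`. -/
def totalCurvature (s : ℝ) : ℝ := ∫ θ in (-π)..π, F.jacobiDeriv (p, θ) s

theorem continuous_circumference : Continuous (F.circumference p) :=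
  intervalIntegral.continuous_parametric_intervalIntegral_of_continuous'
    (F.continuous_jacobi_fiber p) _ _

theorem hasDerivAt_circumference (s : ℝ) :
    HasDerivAt (F.circumference p) (F.totalCurvature p s) s :=
  hasDerivAt_intervalIntegral_of_continuous (fun s θ => F.hasDerivAt_jacobi (p, θ) s)
    (fun s => (F.continuous_jacobi_fiber p).comp (Continuous.prodMk_right s))
    (F.continuous_jacobiDeriv_fiber p) s

theorem hasDerivAt_totalCurvature (s : ℝ) : HasDerivAt (F.totalCurvature p)
    (∫ θ in (-π)..π, -(M.K (F.polar p (s, θ)) * F.jacobi (p, θ) s)) s :=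
  hasDerivAt_intervalIntegral_of_continuous (fun s θ => F.hasDerivAt_jacobiDeriv (p, θ) s)
    (fun s => (F.continuous_jacobiDeriv_fiber p).comp (Continuous.prodMk_right s))
    (((M.smooth_K.continuous.comp (F.continuous_polar p)).mul (F.continuous_jacobi_fiber p)).neg) s

theorem measurableSet_radius_le (r : ℝ) : MeasurableSet {q | F.radius p q ≤ r} :=
  (F.isCompact_radius_le p r).measurableSet

theorem integral_radius_le {f : V2 → ℝ} (hf : Continuous f) {r : ℝ} (hr : 0 ≤ r) :
    ∫ q in {q | F.radius p q ≤ r}, f q ∂M.area =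
      ∫ s in (0 : ℝ)..r, ∫ θ in (-π)..π, F.jacobi (p, θ) s * f (F.polar p (s, θ)) := by
  have e : ({q | F.radius p q ≤ r} : Set V2) =ᵐ[M.area] {q | F.radius p q ∈ Ioc 0 r} := by
    refine eventuallyLE_antisymm_iff.2 ⟨?_, ?_⟩
    · refine ae_le_set.2 (measure_mono_null (fun q hq => ?_) (F.area_radius_eq p 0))
      have h0 : 0 ≤ F.radius p q := norm_nonneg _
      by_contra h
      exact hq.2 ⟨lt_of_le_of_ne h0 (Ne.symm h), hq.1⟩
    · exact LE.le.eventuallyLE (fun q hq => hq.2)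
  rw [setIntegral_congr_set e, F.setIntegral_polar p measurableSet_Ioc fun s hs => hs.1,
    Measure.volume_eq_prod, setIntegral_prod, intervalIntegral.integral_of_le hr]
  · refine setIntegral_congr_fun measurableSet_Ioc fun s _ => ?_
    rw [intervalIntegral.integral_of_le (by linarith [pi_pos])]
  · rw [← Measure.volume_eq_prod]
    exact (((F.continuous_jacobi_fiber p).mul (hf.comp (F.continuous_polar p))).continuousOn.integrableOn_compact
      (isCompact_Icc.prod isCompact_Icc)).mono_set (prod_mono Ioc_subset_Icc_self Ioc_subset_Icc_self)

theorem area_real_radius_le {r : ℝ} (hr : 0 ≤ r) :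
    M.area.real {q | F.radius p q ≤ r} = ∫ s in (0 : ℝ)..r, F.circumference p s := by
  have h := F.integral_radius_le p (continuous_const (y := (1 : ℝ))) hr
  simpa [circumference] using h

/-- The Gauss--Bonnet formula for metric discs. -/
theorem integral_K_radius_le {r : ℝ} (hr : 0 ≤ r) :
    ∫ q in {q | F.radius p q ≤ r}, M.K q ∂M.area = 2 * π - F.totalCurvature p r := by
  have hc : Continuous fun y : ℝ × ℝ => -(M.K (F.polar p (y.1, y.2)) * F.jacobi (p, y.2) y.1) :=
    ((M.smooth_K.continuous.comp (F.continuous_polar p)).mul (F.continuous_jacobi_fiber p)).neg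
  have h := intervalIntegral.integral_eq_sub_of_hasDerivAt
    (fun s _ => F.hasDerivAt_totalCurvature p s) (a := 0) (b := r)
    ((intervalIntegral.continuous_parametric_intervalIntegral_of_continuous'
      hc _ _).intervalIntegrable _ _)
  have h0 : F.totalCurvature p 0 = 2 * π := by
    simp [totalCurvature, jacobiDeriv_zero]
    ring
  rw [F.integral_radius_le p M.smooth_K.continuous hr]
  rw [h0] at h
  simp only [intervalIntegral.integral_neg] at h
  rw [← neg_sub, ← h, neg_neg]
  simp only [mul_comm]

theorem ball_eq (r : ℝ) : M.ball p r = {q | F.radius p q < r} := by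
  simp [RMetric.ball, F.dist_eq_radius]

theorem closure_ball {r : ℝ} (hr : 0 < r) : closure (M.ball p r) = {q | F.radius p q ≤ r} := by
  have h : M.ball p r = (F.expHomeo p).symm ⁻¹' Metric.ball 0 r := by
    rw [F.ball_eq p]
    ext q
    simp [radius]
  rw [h, ← Homeomorph.preimage_closure, _root_.closure_ball _ hr.ne']
  ext q
  simp [radius]

theorem area_ball (r : ℝ) : M.area (M.ball p r) = M.area {q | F.radius p q ≤ r} := by
  rw [F.ball_eq p]
  refine measure_congr (eventuallyLE_antisymm_iff.2 ⟨?_, ?_⟩)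
  · exact LE.le.eventuallyLE (fun q (hq : _ < r) => show _ ≤ r from le_of_lt hq)
  · refine ae_le_set.2 (measure_mono_null (fun q hq => ?_) (F.area_radius_eq p r))
    exact le_antisymm hq.1 (not_lt.1 hq.2)

theorem hasDerivAt_area_ball {r : ℝ} (hr : 0 < r) :
    HasDerivAt (fun r => (M.area (M.ball p r)).toReal) (F.circumference p r) r := by
  have h := intervalIntegral.integral_hasDerivAt_right
    ((F.continuous_circumference p).intervalIntegrable 0 r)
    (F.continuous_circumference p).stronglyMeasurable.stronglyMeasurableAtFilter
    (F.continuous_circumference p).continuousAt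
  refine h.congr_of_eventuallyEq ?_
  filter_upwards [lt_mem_nhds hr] with s hs
  rw [F.area_ball p, ← F.area_real_radius_le p hs.le]
  rfl

theorem deriv_deriv_area_ball {r : ℝ} (hr : 0 < r) :
    deriv (deriv fun r => (M.area (M.ball p r)).toReal) r = F.totalCurvature p r := by
  have : deriv (fun r => (M.area (M.ball p r)).toReal) =ᶠ[nhds r] F.circumference p := by
    filter_upwards [lt_mem_nhds hr] with s hs
    exact (F.hasDerivAt_area_ball p hs).deriv
  rw [this.deriv_eq, (F.hasDerivAt_circumference p r).deriv]

end HopfFlow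

/-- The Cauchy--Schwarz inequality against the constant function. -/
theorem sq_integral_abs_le {α : Type*} [MeasurableSpace α] {μ : Measure α} [IsFiniteMeasure μ]
    {f : α → ℝ} (hf : Integrable f μ) (hf2 : Integrable (fun x => f x ^ 2) μ) :
    (∫ x, |f x| ∂μ) ^ 2 ≤ (∫ x, f x ^ 2 ∂μ) * μ.real univ := by
  have h : ∀ c : ℝ, 0 ≤ μ.real univ * (c * c) + (-(2 * ∫ x, |f x| ∂μ)) * c + ∫ x, f x ^ 2 ∂μ := by
    intro c
    have h1 : 0 ≤ ∫ x, (f x ^ 2 - 2 * c * |f x| + c ^ 2) ∂μ := by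
      refine integral_nonneg fun x => ?_
      have : f x ^ 2 - 2 * c * |f x| + c ^ 2 = (|f x| - c) ^ 2 := by rw [← sq_abs (f x)]; ring
      simp only [Pi.zero_apply, this]
      positivity
    have h2 : Integrable (fun x => f x ^ 2 - 2 * c * |f x|) μ := hf2.sub (hf.abs.const_mul _)
    rw [integral_add h2 (integrable_const _),
      integral_sub hf2 (hf.abs.const_mul _), integral_const_mul, integral_const, smul_eq_mul] at h1
    linarith
  have := discrim_le_zero h
  simp only [discrim] at this
  linarith

namespace HopfFlow

variable {M : RMetric} (F : HopfFlow M) (p : V2)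

/-- The part of the angular cover of the unit tangent bundle over a closed metric disc. -/
def discBundle (r : ℝ) : Set UTCover := {z | F.radius p z.1 ≤ r}

theorem measurableSet_discBundle (r : ℝ) : MeasurableSet (F.discBundle p r) :=
  (F.measurableSet_radius_le p r).preimage measurable_fst

theorem discBundle_mono {r s : ℝ} (h : r ≤ s) : F.discBundle p r ⊆ F.discBundle p s :=
  fun _ hz => le_trans hz h

theorem restrict_discBundle (r : ℝ) : M.liouvilleCover.restrict (F.discBundle p r) =
    (M.area.restrict {q | F.radius p q ≤ r}).prod (volume.restrict (Ico 0 (2 * π))) := by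
  have h : F.discBundle p r = {q | F.radius p q ≤ r} ×ˢ univ := by
    ext z; simp [discBundle]
  rw [h, RMetric.liouvilleCover, ← Measure.prod_restrict, Measure.restrict_univ]

theorem setIntegral_discBundle_comp_fst (r : ℝ) (f : V2 → ℝ) :
    ∫ z in F.discBundle p r, f z.1 ∂M.liouvilleCover =
      2 * π * ∫ q in {q | F.radius p q ≤ r}, f q ∂M.area := by
  rw [restrict_discBundle, integral_fun_fst]
  simp [two_pi_pos.le]

theorem measure_discBundle_lt_top (r : ℝ) : M.liouvilleCover (F.discBundle p r) < ∞ := by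
  have h : IsFiniteMeasure (M.area.restrict {q | F.radius p q ≤ r}) :=
    ⟨by simpa using (F.isCompact_radius_le p r).measure_lt_top⟩
  rw [← Measure.restrict_apply_univ, restrict_discBundle]
  exact measure_lt_top _ _

theorem measure_real_discBundle {r : ℝ} (hr : 0 ≤ r) :
    M.liouvilleCover.real (F.discBundle p r) = 2 * π * ∫ s in (0 : ℝ)..r, F.circumference p s := by
  rw [← F.area_real_radius_le p hr]
  have h := F.setIntegral_discBundle_comp_fst p r fun _ => 1
  simpa using h

theorem exists_abs_K_le (r : ℝ) : ∃ C, 0 ≤ C ∧ ∀ q, F.radius p q ≤ r → |M.K q| ≤ C := by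
  obtain ⟨C, hC⟩ := (F.isCompact_radius_le p r).exists_bound_of_continuousOn
    M.smooth_K.continuous.continuousOn
  exact ⟨max C 0, le_max_right _ _, fun q hq => (hC q hq).trans (le_max_left _ _)⟩

theorem exists_abs_U_le (r : ℝ) : ∃ C, 0 ≤ C ∧ ∀ z ∈ F.discBundle p r, |F.U z| ≤ C := by
  obtain ⟨R, hR⟩ := (F.isCompact_radius_le p r).exists_bound_of_continuousOn
    (f := id) continuousOn_id
  obtain ⟨C, hC⟩ := F.locBdd R
  exact ⟨max C 0, le_max_right _ _, fun z hz => (hC z (hR z.1 hz)).trans (le_max_left _ _)⟩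

theorem integrableOn_discBundle {r C : ℝ} {f : UTCover → ℝ} (hf : Measurable f)
    (h : ∀ z ∈ F.discBundle p r, |f z| ≤ C) :
    IntegrableOn f (F.discBundle p r) M.liouvilleCover :=
  Measure.integrableOn_of_bounded (F.measure_discBundle_lt_top p r).ne hf.aestronglyMeasurable
    (M := C) ((ae_restrict_iff' (F.measurableSet_discBundle p r)).2 (Eventually.of_forall h))

theorem integrableOn_U (r : ℝ) : IntegrableOn F.U (F.discBundle p r) M.liouvilleCover := by
  obtain ⟨C, -, hC⟩ := F.exists_abs_U_le p r
  exact F.integrableOn_discBundle p F.measurable_U hC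

theorem integrableOn_U_sq (r : ℝ) :
    IntegrableOn (fun z => F.U z ^ 2) (F.discBundle p r) M.liouvilleCover := by
  obtain ⟨C, -, hC⟩ := F.exists_abs_U_le p r
  refine F.integrableOn_discBundle p (F.measurable_U.pow_const 2) (C := C ^ 2) fun z hz => ?_
  rw [abs_pow]
  exact pow_le_pow_left₀ (abs_nonneg _) (hC z hz) 2

theorem integrableOn_K (r : ℝ) :
    IntegrableOn (fun z => M.K z.1) (F.discBundle p r) M.liouvilleCover := by
  obtain ⟨C, -, hC⟩ := F.exists_abs_K_le p r
  exact F.integrableOn_discBundle p (M.smooth_K.continuous.comp continuous_fst).measurable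
    fun z hz => hC z.1 hz

/-- The integral of `U ^ 2` over the unit tangent vectors with footpoint in a closed disc. -/
def energy (r : ℝ) : ℝ := ∫ z in F.discBundle p r, F.U z ^ 2 ∂M.liouvilleCover

theorem energy_nonneg (r : ℝ) : 0 ≤ F.energy p r := integral_nonneg fun _ => sq_nonneg _

theorem energy_mono : Monotone (F.energy p) := fun _ s h =>
  setIntegral_mono_set (F.integrableOn_U_sq p s) (Eventually.of_forall fun _ => sq_nonneg _)
    (LE.le.eventuallyLE (F.discBundle_mono p h))

theorem setIntegral_U_sq_sdiff {r s : ℝ} (h : r ≤ s) :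
    ∫ z in F.discBundle p s \ F.discBundle p r, F.U z ^ 2 ∂M.liouvilleCover =
      F.energy p s - F.energy p r :=
  setIntegral_sdiff (F.measurableSet_discBundle p r) (F.integrableOn_U_sq p s)
    (F.discBundle_mono p h)

theorem measure_real_sdiff {r s : ℝ} (hr : 0 ≤ r) (h : r ≤ s) :
    M.liouvilleCover.real (F.discBundle p s \ F.discBundle p r) =
      2 * π * ∫ x in r..s, F.circumference p x := by
  have hi := fun a b => (F.continuous_circumference p).intervalIntegrable (μ := volume) a b
  rw [measureReal_sdiff (F.discBundle_mono p h) (F.measurableSet_discBundle p r)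
    (F.measure_discBundle_lt_top p s).ne, F.measure_real_discBundle p (hr.trans h),
    F.measure_real_discBundle p hr, ← intervalIntegral.integral_interval_sub_left (hi 0 s) (hi 0 r)]
  ring

theorem setIntegral_abs_U_sdiff_le {r s : ℝ} (hr : 0 ≤ r) (h : r ≤ s) :
    ∫ z in F.discBundle p s \ F.discBundle p r, |F.U z| ∂M.liouvilleCover ≤
      √((F.energy p s - F.energy p r) * (2 * π * ∫ x in r..s, F.circumference p x)) := by
  have hsub : F.discBundle p s \ F.discBundle p r ⊆ F.discBundle p s := sdiff_subset
  have hfin : IsFiniteMeasure (M.liouvilleCover.restrict (F.discBundle p s \ F.discBundle p r)) :=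
    ⟨by simpa using (measure_mono hsub).trans_lt (F.measure_discBundle_lt_top p s)⟩
  refine le_sqrt_of_sq_le ?_
  have := sq_integral_abs_le ((F.integrableOn_U p s).mono_set hsub)
    ((F.integrableOn_U_sq p s).mono_set hsub)
  rwa [F.setIntegral_U_sq_sdiff p h, measureReal_restrict_apply_univ,
    F.measure_real_sdiff p hr h] at this

theorem exists_energy_sub_le {b : ℝ} (hb : 0 ≤ b) : ∃ L, 0 ≤ L ∧ ∀ r s, 0 ≤ r → r ≤ s → s ≤ b →
    F.energy p s - F.energy p r ≤ L * (s - r) := by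
  obtain ⟨C, hC0, hC⟩ := F.exists_abs_U_le p b
  obtain ⟨D, hD⟩ := isCompact_Icc.exists_bound_of_continuousOn (s := Icc 0 b)
    (F.continuous_circumference p).continuousOn
  have hD0 : 0 ≤ D := (norm_nonneg _).trans (hD 0 ⟨le_rfl, hb⟩)
  refine ⟨C ^ 2 * (2 * π * D), by positivity, fun r s hr hrs hs => ?_⟩
  rw [← F.setIntegral_U_sq_sdiff p hrs]
  have hsub : F.discBundle p s \ F.discBundle p r ⊆ F.discBundle p s := sdiff_subset
  have h1 := norm_setIntegral_le_of_norm_le_const (μ := M.liouvilleCover) (C := C ^ 2)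
    (f := fun z => F.U z ^ 2) ((measure_mono hsub).trans_lt (F.measure_discBundle_lt_top p s))
    (fun z hz => by
      rw [norm_pow]
      exact pow_le_pow_left₀ (norm_nonneg _) (hC z (F.discBundle_mono p hs (hsub hz))) 2)
  rw [F.measure_real_sdiff p hr hrs] at h1
  have h2 := intervalIntegral.norm_integral_le_of_norm_le_const (a := r) (b := s) (C := D)
    (f := F.circumference p) fun x hx => by
      rw [uIoc_of_le hrs] at hx
      exact hD x ⟨hr.trans hx.1.le, hx.2.trans hs⟩
  rw [abs_of_nonneg (sub_nonneg.2 hrs)] at h2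
  calc _ ≤ _ := (le_abs_self _).trans h1
    _ ≤ C ^ 2 * (2 * π * (D * (s - r))) := by
        gcongr
        exact (le_abs_self _).trans h2
    _ = _ := by ring

end HopfFlow

namespace HopfFlow

variable {M : RMetric} (F : HopfFlow M) (p : V2)

/-- A Lipschitz cutoff: `1` on the disc of radius `r`, `0` off the disc of radius `r + ε`. -/
def cutoff (r ε : ℝ) (q : V2) : ℝ := max 0 (min 1 (1 - (F.radius p q - r) / ε))

theorem cutoff_nonneg (r ε : ℝ) (q : V2) : 0 ≤ F.cutoff p r ε q := le_max_left _ _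

theorem cutoff_le_one (r ε : ℝ) (q : V2) : F.cutoff p r ε q ≤ 1 :=
  max_le zero_le_one (min_le_left _ _)

theorem abs_cutoff_le_one (r ε : ℝ) (q : V2) : |F.cutoff p r ε q| ≤ 1 := by
  rw [abs_of_nonneg (F.cutoff_nonneg p r ε q)]
  exact F.cutoff_le_one p r ε q

theorem cutoff_eq_one {r ε : ℝ} (hε : 0 < ε) {q : V2} (h : F.radius p q ≤ r) :
    F.cutoff p r ε q = 1 := by
  have : (F.radius p q - r) / ε ≤ 0 := div_nonpos_of_nonpos_of_nonneg (by linarith) hε.le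
  rw [cutoff, min_eq_left (by linarith), max_eq_right zero_le_one]

theorem cutoff_eq_zero {r ε : ℝ} (hε : 0 < ε) {q : V2} (h : r + ε ≤ F.radius p q) :
    F.cutoff p r ε q = 0 := by
  have : 1 ≤ (F.radius p q - r) / ε := by rw [le_div_iff₀ hε]; linarith
  exact max_eq_left ((min_le_right _ _).trans (by linarith))

theorem continuous_cutoff (r ε : ℝ) : Continuous (F.cutoff p r ε) := by
  have := F.continuous_radius p
  unfold cutoff
  fun_prop

theorem abs_cutoff_sub_le {r ε : ℝ} (hε : 0 < ε) (q q' : V2) :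
    |F.cutoff p r ε q - F.cutoff p r ε q'| ≤ |F.radius p q - F.radius p q'| / ε := by
  have h0 := abs_max_sub_max_le_max 0 (min 1 (1 - (F.radius p q - r) / ε)) 0
    (min 1 (1 - (F.radius p q' - r) / ε))
  rw [sub_self, abs_zero] at h0
  refine h0.trans (max_le (by positivity) ?_)
  have h1 := abs_min_sub_min_le_max 1 (1 - (F.radius p q - r) / ε) 1 (1 - (F.radius p q' - r) / ε)
  rw [sub_self, abs_zero, max_eq_right (abs_nonneg _)] at h1
  refine h1.trans (le_of_eq ?_)
  rw [abs_sub_comm, ← abs_of_pos hε, ← abs_div, abs_of_pos hε]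
  congr 1
  ring

theorem radius_flow_le (z : UTCover) {t : ℝ} (ht : 0 ≤ t) :
    F.radius p (F.flow z t).1 ≤ F.radius p z.1 + t := by
  have := (abs_le.1 (F.abs_radius_flow_sub_le p z ht)).2
  linarith

theorem integrable_mul_cutoff {r ε C : ℝ} (hε : 0 < ε) {f : UTCover → ℝ} (hf : Measurable f)
    (h : ∀ z ∈ F.discBundle p (r + ε), |f z| ≤ C) :
    Integrable (fun z => f z * F.cutoff p r ε z.1) M.liouvilleCover := by
  have hm : Measurable fun z : UTCover => F.cutoff p r ε z.1 :=
    ((F.continuous_cutoff p r ε).comp continuous_fst).measurable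
  refine (integrableOn_iff_integrable_of_support_subset ?_).1
    (F.integrableOn_discBundle p (hf.mul hm) (C := C) (r := r + ε) fun z hz => ?_)
  · intro z hz
    by_contra hz'
    exact hz (mul_eq_zero_of_right _ (F.cutoff_eq_zero p hε (le_of_lt (not_le.1 hz'))))
  · rw [abs_mul]
    exact (mul_le_of_le_one_right (abs_nonneg _) (F.abs_cutoff_le_one p r ε _)).trans (h z hz)

theorem abs_integral_difference_le {r ε τ t : ℝ} (hε : 0 < ε) (ht : 0 < t) (htτ : t < τ) :
    |∫ z, (F.U (F.flow z t) - F.U z) * F.cutoff p r ε z.1 ∂M.liouvilleCover| ≤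
      t / ε * ∫ z in F.discBundle p (r + ε + τ) \ F.discBundle p (r - τ),
        |F.U z| ∂M.liouvilleCover := by
  obtain ⟨C, -, hC⟩ := F.exists_abs_U_le p (r + ε + τ)
  have hCε : ∀ z ∈ F.discBundle p (r + ε), |F.U z| ≤ C := fun z hz =>
    hC z (F.discBundle_mono p (by linarith) hz)
  have hm : Measurable fun z : UTCover => F.cutoff p r ε z.1 :=
    ((F.continuous_cutoff p r ε).comp continuous_fst).measurable
  have hUt : Measurable fun z => F.U (F.flow z t) :=
    F.measurable_U.comp (F.continuous_flow_right t).measurable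
  set S := F.discBundle p (r + ε + τ) \ F.discBundle p (r - τ) with hS
  have hSm : MeasurableSet S :=
    (F.measurableSet_discBundle p _).diff (F.measurableSet_discBundle p _)
  have hi := F.integrable_mul_cutoff p hε F.measurable_U hCε
  have hper : ∀ z : UTCover, F.U (z + (0, 2 * π)) * F.cutoff p r ε (z + (0, 2 * π)).1 =
      F.U z * F.cutoff p r ε z.1 := fun z => by
    rw [F.U_add_two_pi]; simp
  have hinv := F.integral_flow ht.le (F.measurable_U.mul hm) hper hi
  have hinv' := F.integrable_flow ht.le (F.measurable_U.mul hm) hper hi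
  simp only [Pi.mul_apply] at hinv hinv'
  have hg : Integrable (fun z => (F.U (F.flow z t) - F.U z) * F.cutoff p r ε z.1)
      M.liouvilleCover := by
    refine F.integrable_mul_cutoff p hε (hUt.sub F.measurable_U) (C := C + C) fun z hz => ?_
    refine (abs_sub _ _).trans (add_le_add (hC _ ?_) (hCε z hz))
    have h1 := F.radius_flow_le p z ht.le
    have h2 : F.radius p z.1 ≤ r + ε := hz
    change F.radius p _ ≤ _
    linarith
  have hkS : IntegrableOn (fun z => |F.U z|) S M.liouvilleCover :=
    ((F.integrableOn_U p _).mono_set sdiff_subset).abs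
  have hk := hkS.integrable_indicator hSm
  have hkm : Measurable (S.indicator fun z => |F.U z|) := F.measurable_U.abs.indicator hSm
  have hkper : ∀ z : UTCover, S.indicator (fun z => |F.U z|) (z + (0, 2 * π)) =
      S.indicator (fun z => |F.U z|) z := fun z => by
    have : z + (0, 2 * π) ∈ S ↔ z ∈ S := by simp [hS, discBundle]
    by_cases hz : z ∈ S
    · rw [indicator_of_mem hz, indicator_of_mem (this.2 hz), F.U_add_two_pi]
    · rw [indicator_of_notMem hz, indicator_of_notMem (this.not.2 hz)]
  have e : ∫ z, (F.U (F.flow z t) - F.U z) * F.cutoff p r ε z.1 ∂M.liouvilleCover =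
      ∫ z, F.U (F.flow z t) * (F.cutoff p r ε z.1 - F.cutoff p r ε (F.flow z t).1)
        ∂M.liouvilleCover := by
    have h1 : ∀ z, F.U (F.flow z t) * (F.cutoff p r ε z.1 - F.cutoff p r ε (F.flow z t).1) =
        ((F.U (F.flow z t) - F.U z) * F.cutoff p r ε z.1 -
          F.U (F.flow z t) * F.cutoff p r ε (F.flow z t).1) + F.U z * F.cutoff p r ε z.1 :=
      fun z => by ring
    have h2 : Integrable (fun z => (F.U (F.flow z t) - F.U z) * F.cutoff p r ε z.1 -
        F.U (F.flow z t) * F.cutoff p r ε (F.flow z t).1) M.liouvilleCover := hg.sub hinv'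
    simp only [h1]
    rw [integral_add h2 hi, integral_sub hg hinv', hinv]
    ring
  rw [e]
  have hkt := F.integrable_flow ht.le hkm hkper hk
  rw [← integral_indicator hSm, ← F.integral_flow ht.le hkm hkper hk, ← integral_const_mul,
    ← Real.norm_eq_abs]
  refine norm_integral_le_of_norm_le (hkt.const_mul _) (Eventually.of_forall fun z => ?_)
  have hρ := F.abs_radius_flow_sub_le p z ht.le
  have hρ' := abs_le.1 hρ
  by_cases hz : F.flow z t ∈ S
  · rw [indicator_of_mem hz, norm_mul, mul_comm]
    refine mul_le_mul_of_nonneg_right ?_ (abs_nonneg _)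
    refine (F.abs_cutoff_sub_le p hε _ _).trans ?_
    rw [abs_sub_comm]
    gcongr
  · rw [indicator_of_notMem hz, mul_zero]
    refine le_of_eq ?_
    rw [norm_eq_zero]
    refine mul_eq_zero_of_right _ (sub_eq_zero.2 ?_)
    by_cases h1 : F.flow z t ∈ F.discBundle p (r + ε + τ)
    · have h2 : F.radius p (F.flow z t).1 ≤ r - τ := by
        by_contra h
        exact hz ⟨h1, h⟩
      rw [F.cutoff_eq_one p hε (by linarith), F.cutoff_eq_one p hε (by linarith)]
    · have h2 : r + ε + τ < F.radius p (F.flow z t).1 := not_le.1 h1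
      rw [F.cutoff_eq_zero p hε (by linarith), F.cutoff_eq_zero p hε (by linarith)]

theorem tendsto_integral_difference (r : ℝ) {ε : ℝ} (hε : 0 < ε) :
    Tendsto (fun t => ∫ z, t⁻¹ * (F.U (F.flow z t) - F.U z) * F.cutoff p r ε z.1 ∂M.liouvilleCover)
      (nhdsWithin 0 (Ioi 0))
      (nhds (∫ z, (-F.U z ^ 2 - M.K z.1) * F.cutoff p r ε z.1 ∂M.liouvilleCover)) := by
  obtain ⟨C, hC0, hC⟩ := F.exists_abs_U_le p (r + ε + 1)
  obtain ⟨D, hD0, hD⟩ := F.exists_abs_K_le p (r + ε + 1)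
  have hm : Measurable fun z : UTCover => F.cutoff p r ε z.1 :=
    ((F.continuous_cutoff p r ε).comp continuous_fst).measurable
  refine tendsto_integral_filter_of_dominated_convergence
    (fun z => (C ^ 2 + D) * F.cutoff p r ε z.1) ?_ ?_ ?_ ?_
  · refine Eventually.of_forall fun t => Measurable.aestronglyMeasurable ?_
    have hUt : Measurable fun z => F.U (F.flow z t) :=
      F.measurable_U.comp (F.continuous_flow_right t).measurable
    exact ((hUt.sub F.measurable_U).const_mul _).mul hm
  · filter_upwards [Ioc_mem_nhdsGT (zero_lt_one (α := ℝ))] with t ht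
    refine Eventually.of_forall fun z => ?_
    rw [norm_mul, norm_of_nonneg (F.cutoff_nonneg p r ε z.1)]
    by_cases hz : F.radius p z.1 ≤ r + ε
    · refine mul_le_mul_of_nonneg_right ?_ (F.cutoff_nonneg p r ε z.1)
      have h := Convex.norm_image_sub_le_of_norm_hasDerivWithin_le (C := C ^ 2 + D)
        (fun s (_ : s ∈ Icc 0 t) => (F.riccati z s).hasDerivWithinAt) (fun s hs => ?_)
        (convex_Icc 0 t) (left_mem_Icc.2 ht.1.le) (right_mem_Icc.2 ht.1.le)
      · rw [F.flow_zero, sub_zero, norm_of_nonneg ht.1.le] at h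
        rw [norm_mul, norm_inv, norm_of_nonneg ht.1.le, inv_mul_le_iff₀ ht.1, mul_comm t]
        exact h
      · have hs1 := F.radius_flow_le p z hs.1
        have hs2 : F.radius p (F.flow z s).1 ≤ r + ε + 1 := by linarith [hs.2, ht.2]
        have hu := hC (F.flow z s) hs2
        have hk := hD (F.flow z s).1 hs2
        refine (norm_sub_le _ _).trans (add_le_add ?_ hk)
        rw [norm_neg, norm_pow]
        exact pow_le_pow_left₀ (norm_nonneg _) hu 2
    · rw [F.cutoff_eq_zero p hε (not_le.1 hz).le, mul_zero, mul_zero]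
  · exact F.integrable_mul_cutoff p hε measurable_const fun z _ => le_rfl
  · refine Eventually.of_forall fun z => ?_
    have h := (F.riccati z 0).tendsto_slope_zero_right
    simp only [zero_add, F.flow_zero, smul_eq_mul] at h
    exact h.mul_const _

theorem integral_mul_cutoff_le (r : ℝ) {ε τ : ℝ} (hε : 0 < ε) (hτ : 0 < τ) :
    ∫ z, (F.U z ^ 2 + M.K z.1) * F.cutoff p r ε z.1 ∂M.liouvilleCover ≤
      ε⁻¹ * ∫ z in F.discBundle p (r + ε + τ) \ F.discBundle p (r - τ),
        |F.U z| ∂M.liouvilleCover := by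
  have h := (F.tendsto_integral_difference p r hε).neg
  have e : -∫ z, (-F.U z ^ 2 - M.K z.1) * F.cutoff p r ε z.1 ∂M.liouvilleCover =
      ∫ z, (F.U z ^ 2 + M.K z.1) * F.cutoff p r ε z.1 ∂M.liouvilleCover := by
    rw [← integral_neg]
    congr 1
    funext z
    ring
  rw [e] at h
  refine le_of_tendsto h ?_
  filter_upwards [Ioo_mem_nhdsGT hτ] with t ht
  have h1 := (neg_le_abs _).trans (F.abs_integral_difference_le p (r := r) hε ht.1 ht.2)
  simp only [mul_assoc]
  rw [integral_const_mul, ← mul_neg, inv_mul_le_iff₀ ht.1]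
  refine h1.trans (le_of_eq ?_)
  ring

end HopfFlow

theorem absContOn_of_abs_sub_le {f : ℝ → ℝ} {a b L : ℝ} (hL : 0 ≤ L)
    (h : ∀ x y, a ≤ x → x ≤ y → y ≤ b → |f y - f x| ≤ L * (y - x)) : AbsContOn f a b := by
  intro ε hε
  refine ⟨ε / (L + 1), by positivity, fun n I hI _ hs => ?_⟩
  calc ∑ i, |f (I i).2 - f (I i).1| ≤ ∑ i, L * ((I i).2 - (I i).1) :=
        Finset.sum_le_sum fun i _ => h _ _ (hI i).1 (hI i).2.1 (hI i).2.2
    _ = L * ∑ i, ((I i).2 - (I i).1) := by rw [Finset.mul_sum]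
    _ ≤ (L + 1) * ∑ i, ((I i).2 - (I i).1) := by
        refine mul_le_mul_of_nonneg_right (by linarith) (Finset.sum_nonneg fun i _ => ?_)
        linarith [(hI i).2.1]
    _ < ε := by rwa [lt_div_iff₀' (by positivity)] at hs

namespace HopfFlow

variable {M : RMetric} (F : HopfFlow M) (p : V2)

theorem continuousAt_energy {r : ℝ} (hr : 0 < r) : ContinuousAt (F.energy p) r := by
  obtain ⟨L, hL, h⟩ := F.exists_energy_sub_le p (b := r + 1) (by linarith)
  refine continuousAt_of_locally_lipschitz (r := min r 1) (by positivity) L fun s hs => ?_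
  rw [dist_eq, dist_eq] at *
  have h1 := abs_lt.1 (hs.trans_le (min_le_left _ _))
  have h2 := abs_lt.1 (hs.trans_le (min_le_right _ _))
  rcases le_total r s with hrs | hrs
  · rw [abs_of_nonneg (sub_nonneg.2 (F.energy_mono p hrs)), abs_of_nonneg (sub_nonneg.2 hrs)]
    exact h r s hr.le hrs (by linarith)
  · rw [abs_sub_comm, abs_sub_comm s,
      abs_of_nonneg (sub_nonneg.2 (F.energy_mono p hrs)), abs_of_nonneg (sub_nonneg.2 hrs)]
    exact h s r (by linarith) hrs (by linarith)

theorem le_integral_mul_cutoff {r ε C : ℝ} (hr : 0 ≤ r) (hε : 0 < ε)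
    (hC0 : 0 ≤ C) (hC : ∀ q, F.radius p q ≤ r + ε → |M.K q| ≤ C) :
    F.energy p r + 2 * π * (2 * π - F.totalCurvature p r) -
        C * (2 * π * ∫ x in r..(r + ε), F.circumference p x) ≤
      ∫ z, (F.U z ^ 2 + M.K z.1) * F.cutoff p r ε z.1 ∂M.liouvilleCover := by
  have hrε : r ≤ r + ε := by linarith
  set S := F.discBundle p (r + ε) \ F.discBundle p r with hS
  have hSm : MeasurableSet S :=
    (F.measurableSet_discBundle p _).diff (F.measurableSet_discBundle p _)
  have hSfin : M.liouvilleCover S < ∞ :=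
    (measure_mono sdiff_subset).trans_lt (F.measure_discBundle_lt_top p (r + ε))
  have hUK : IntegrableOn (fun z => F.U z ^ 2 + M.K z.1) (F.discBundle p r) M.liouvilleCover :=
    (F.integrableOn_U_sq p r).add (F.integrableOn_K p r)
  have i1 := hUK.integrable_indicator (F.measurableSet_discBundle p r)
  have hconst : IntegrableOn (fun _ : UTCover => C) S M.liouvilleCover :=
    integrableOn_const hSfin.ne
  have i2 := hconst.integrable_indicator hSm
  obtain ⟨D, -, hD⟩ := F.exists_abs_U_le p (r + ε)
  have i3 := F.integrable_mul_cutoff p (r := r) (C := D ^ 2 + C) hε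
    ((F.measurable_U.pow_const 2).add (M.smooth_K.continuous.comp continuous_fst).measurable)
    fun z hz => by
      refine (abs_add_le _ _).trans (add_le_add ?_ (hC z.1 hz))
      rw [abs_pow]
      exact pow_le_pow_left₀ (abs_nonneg _) (hD z hz) 2
  have h := integral_mono (i1.sub i2) i3 fun z => ?_
  · rw [integral_sub' i1 i2, integral_indicator (F.measurableSet_discBundle p r),
      integral_indicator hSm, integral_add (F.integrableOn_U_sq p r) (F.integrableOn_K p r),
      F.setIntegral_discBundle_comp_fst p r M.K, F.integral_K_radius_le p hr, setIntegral_const,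
      F.measure_real_sdiff p hr hrε, smul_eq_mul, mul_comm _ C] at h
    exact h
  · simp only [Pi.sub_apply]
    by_cases h1 : z ∈ F.discBundle p r
    · rw [indicator_of_mem h1, indicator_of_notMem (fun h => h.2 h1),
        F.cutoff_eq_one p hε (show F.radius p z.1 ≤ r from h1)]
      simp
    rw [indicator_of_notMem h1]
    by_cases h2 : z ∈ F.discBundle p (r + ε)
    · rw [indicator_of_mem (show z ∈ S from ⟨h2, h1⟩)]
      have h3 := (abs_le.1 (hC z.1 h2)).1
      have h4 := F.cutoff_nonneg p r ε z.1
      have h5 := F.cutoff_le_one p r ε z.1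
      simp only [Pi.add_apply, Function.comp_apply]
      nlinarith [mul_nonneg (sq_nonneg (F.U z)) h4]
    · rw [indicator_of_notMem (fun h => h2 h.1), F.cutoff_eq_zero p hε (not_le.1 h2).le]
      simp

theorem energy_add_curvature_le {r ε C : ℝ} (hr : 0 < r) (hε : 0 < ε)
    (hC0 : 0 ≤ C) (hC : ∀ q, F.radius p q ≤ r + ε → |M.K q| ≤ C) :
    F.energy p r + 2 * π * (2 * π - F.totalCurvature p r) -
        C * (2 * π * ∫ x in r..(r + ε), F.circumference p x) ≤
      √((ε⁻¹ * (F.energy p (r + ε) - F.energy p r)) *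
        (2 * π * (ε⁻¹ * ∫ x in r..(r + ε), F.circumference p x))) := by
  have hprim : Continuous fun x => ∫ y in (0 : ℝ)..x, F.circumference p y :=
    intervalIntegral.continuous_primitive
      (fun a b => (F.continuous_circumference p).intervalIntegrable a b) 0
  have hint (a b : ℝ) : ∫ x in a..b, F.circumference p x =
      (∫ x in (0 : ℝ)..b, F.circumference p x) - ∫ x in (0 : ℝ)..a, F.circumference p x :=
    (intervalIntegral.integral_interval_sub_left
      ((F.continuous_circumference p).intervalIntegrable _ _)
      ((F.continuous_circumference p).intervalIntegrable _ _)).symm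
  let G : ℝ → ℝ := fun τ => ε⁻¹ * √((F.energy p (r + ε + τ) - F.energy p (r - τ)) *
    (2 * π * ∫ x in (r - τ)..(r + ε + τ), F.circumference p x))
  have hG : ContinuousAt G 0 := by
    have h1 : ContinuousAt (fun τ : ℝ => F.energy p (r + ε + τ)) 0 := by
      have h : ContinuousAt (F.energy p) (r + ε + 0) := F.continuousAt_energy p (by linarith)
      exact h.comp (f := fun τ : ℝ => r + ε + τ)
        (by fun_prop : ContinuousAt (fun τ : ℝ => r + ε + τ) 0)
    have h2 : ContinuousAt (fun τ : ℝ => F.energy p (r - τ)) 0 := by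
      have h : ContinuousAt (F.energy p) (r - 0) := F.continuousAt_energy p (by linarith)
      exact h.comp (f := fun τ : ℝ => r - τ)
        (by fun_prop : ContinuousAt (fun τ : ℝ => r - τ) 0)
    have hGe : G = fun τ => ε⁻¹ * √((F.energy p (r + ε + τ) - F.energy p (r - τ)) *
        (2 * π * ((∫ x in (0 : ℝ)..(r + ε + τ), F.circumference p x) -
          ∫ x in (0 : ℝ)..(r - τ), F.circumference p x))) :=
      funext fun τ => by simp only [G]; rw [hint (r - τ) (r + ε + τ)]
    rw [hGe]
    have h3 : Continuous fun τ => ∫ y in (0 : ℝ)..(r + ε + τ), F.circumference p y :=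
      hprim.comp (by fun_prop)
    have h4 : Continuous fun τ => ∫ y in (0 : ℝ)..(r - τ), F.circumference p y :=
      hprim.comp (by fun_prop)
    exact continuousAt_const.mul (((h1.sub h2).mul
      (continuousAt_const.mul (h3.continuousAt.sub h4.continuousAt))).sqrt)
  have hle : ∫ z, (F.U z ^ 2 + M.K z.1) * F.cutoff p r ε z.1 ∂M.liouvilleCover ≤ G 0 := by
    refine ge_of_tendsto (hG.tendsto.mono_left (nhdsWithin_le_nhds (s := Ioi 0))) ?_
    filter_upwards [Ioo_mem_nhdsGT hr] with τ hτ
    refine (F.integral_mul_cutoff_le p r hε hτ.1).trans ?_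
    exact mul_le_mul_of_nonneg_left (F.setIntegral_abs_U_sdiff_le p (by linarith [hτ.2])
      (by linarith [hτ.1])) (inv_nonneg.2 hε.le)
  refine ((F.le_integral_mul_cutoff p hr.le hε hC0 hC).trans hle).trans (le_of_eq ?_)
  simp only [G, add_zero, sub_zero]
  rw [← sqrt_sq (inv_nonneg.2 hε.le), ← sqrt_mul (sq_nonneg _)]
  congr 1
  rw [sqrt_sq (inv_nonneg.2 hε.le)]
  ring

theorem energy_le {r e : ℝ} (hr : 0 < r) (he : HasDerivAt (F.energy p) e r) :
    F.energy p r ≤ 2 * π * F.totalCurvature p r + √(2 * π) * √(e * F.circumference p r) -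
      4 * π ^ 2 := by
  obtain ⟨C, hC0, hC⟩ := F.exists_abs_K_le p (r + 1)
  have hprim : HasDerivAt (fun x => ∫ y in r..x, F.circumference p y) (F.circumference p r) r :=
    intervalIntegral.integral_hasDerivAt_right
      ((F.continuous_circumference p).intervalIntegrable _ _)
      (F.continuous_circumference p).stronglyMeasurable.stronglyMeasurableAtFilter
      (F.continuous_circumference p).continuousAt
  have t1 := he.tendsto_slope_zero_right
  have t2 := hprim.tendsto_slope_zero_right
  simp only [intervalIntegral.integral_same, sub_zero, smul_eq_mul] at t1 t2
  have t3 : Tendsto (fun ε => ∫ y in r..(r + ε), F.circumference p y) (nhdsWithin 0 (Ioi 0))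
      (nhds 0) := by
    have h : Tendsto (fun ε : ℝ => ε) (nhdsWithin 0 (Ioi 0)) (nhds 0) :=
      tendsto_id.mono_left nhdsWithin_le_nhds
    have h2 := h.mul t2
    rw [zero_mul] at h2
    refine h2.congr' ?_
    filter_upwards [self_mem_nhdsWithin] with ε hε
    exact mul_inv_cancel_left₀ (ne_of_gt hε) _
  have h := le_of_tendsto_of_tendsto
    ((tendsto_const_nhds (x := F.energy p r + 2 * π * (2 * π - F.totalCurvature p r))).sub
      ((t3.const_mul (2 * π)).const_mul C)) (t1.mul (t2.const_mul (2 * π))).sqrt ?_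
  · have e1 : e * (2 * π * F.circumference p r) = 2 * π * (e * F.circumference p r) := by ring
    rw [e1, sqrt_mul two_pi_pos.le, mul_zero, mul_zero, sub_zero] at h
    linarith
  · filter_upwards [Ioc_mem_nhdsGT (zero_lt_one (α := ℝ))] with ε hε
    exact F.energy_add_curvature_le p hr hε.1 hC0 fun q hq => hC q (by linarith [hε.2])

theorem locAbsContOn_energy : LocAbsContOn (F.energy p) (Ioi 0) := by
  intro a ha b hb _
  obtain ⟨L, hL, h⟩ := F.exists_energy_sub_le p (b := b) (le_of_lt hb)
  refine absContOn_of_abs_sub_le hL fun x y hx hxy hy => ?_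
  rw [abs_of_nonneg (sub_nonneg.2 (F.energy_mono p hxy))]
  exact h x y ((le_of_lt ha).trans hx) hxy hy

theorem setIntegral_liouville {u : (V2 × V2) × ℝ → ℝ} (hu : Measurable u)
    (hF : ∀ z : UTCover, F.U z = u ((z.1, M.unitVec z.1 z.2), 0)) {r : ℝ} (hr : 0 < r) :
    ∫ x in {x : V2 × V2 | x.1 ∈ closure (M.ball p r)}, u (x, 0) ^ 2 ∂M.liouville =
      F.energy p r := by
  have hm : Measurable fun x : V2 × ℝ => (x.1, M.unitVec x.1 x.2) :=
    (continuous_fst.prodMk M.continuous_unitVec).measurable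
  have hs : MeasurableSet {x : V2 × V2 | x.1 ∈ closure (M.ball p r)} :=
    isClosed_closure.measurableSet.preimage measurable_fst
  have hu0 : Measurable fun x : V2 × V2 => u (x, 0) ^ 2 :=
    (hu.comp (by fun_prop)).pow_const 2
  rw [RMetric.liouville, setIntegral_map hs hu0.aestronglyMeasurable hm.aemeasurable]
  have e : (fun x : V2 × ℝ => (x.1, M.unitVec x.1 x.2)) ⁻¹'
      {x : V2 × V2 | x.1 ∈ closure (M.ball p r)} = F.discBundle p r := by
    rw [F.closure_ball p hr]
    rfl
  rw [e, energy, RMetric.liouvilleCover]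
  simp only [hF]

end HopfFlow

end

/-- **The differential inequality from Hopf's method on the plane.** With `U`
from Hopf's construction and `F_p(r) = ∫_{σ⁻¹(cl B(p,r))} U² dμ`, the function
`F_p` is non-negative, non-decreasing and locally absolutely continuous on
`(0,∞)`, and a.e. `F_p ≤ 2π A_p'' + √(2π) (F_p' A_p')^{1/2} - 4π²`. -/
theorem hopf_differential_inequality (M : RMetric)
    (hcomp : M.Complete) (hconj : M.NoConjugatePoints)
    (Φ : V2 × V2 → ℝ → V2 × V2) (hΦ : M.IsGeodesicFlow Φ)
    (u : (V2 × V2) × ℝ → ℝ) (hu : M.IsHopfSolution Φ u) (p : V2) :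
    let Ap : ℝ → ℝ := fun r => (M.area (M.ball p r)).toReal
    let Fp : ℝ → ℝ := fun r =>
      ∫ x in {x : V2 × V2 | x.1 ∈ closure (M.ball p r)}, (u (x, 0)) ^ 2 ∂M.liouville
    (∀ r > (0:ℝ), 0 ≤ Fp r) ∧ MonotoneOn Fp (Set.Ioi 0) ∧
      LocAbsContOn Fp (Set.Ioi 0) ∧
      ∀ᵐ r ∂(volume.restrict (Set.Ioi (0:ℝ))),
        Fp r ≤ 2 * π * deriv (deriv Ap) r +
          Real.sqrt (2 * π) * Real.sqrt (deriv Fp r * deriv Ap r) - 4 * π ^ 2 := by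
  intro Ap Fp
  obtain ⟨F, hF⟩ := M.exists_hopfFlow hΦ hu
  have hE (r : ℝ) (hr : 0 < r) : Fp r = F.energy p r := F.setIntegral_liouville p hu.1 hF hr
  refine ⟨fun r hr => (hE r hr).symm ▸ F.energy_nonneg p r, fun r hr s hs hrs => ?_,
    fun a ha b hb hab ε hε => ?_, ?_⟩
  · rw [hE r hr, hE s hs]
    exact F.energy_mono p hrs
  · obtain ⟨δ, hδ, h⟩ := F.locAbsContOn_energy p a ha b hb hab ε hε
    refine ⟨δ, hδ, fun n I hI hd hs => ?_⟩
    have hpos (i : Fin n) : 0 < (I i).1 := lt_of_lt_of_le ha (hI i).1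
    simpa only [hE _ (hpos _), hE _ ((hpos _).trans_le (hI _).2.1)] using h n I hI hd hs
  · filter_upwards [ae_restrict_of_ae (F.energy_mono p).ae_differentiableAt,
      ae_restrict_mem measurableSet_Ioi] with r hd hr
    have h1 : deriv Fp r = deriv (F.energy p) r :=
      Filter.EventuallyEq.deriv_eq ((lt_mem_nhds hr).mono hE)
    have h2 : deriv Ap r = F.circumference p r := (F.hasDerivAt_area_ball p hr).deriv
    have h3 : deriv (deriv Ap) r = F.totalCurvature p r := F.deriv_deriv_area_ball p hr
    rw [hE r hr, h1, h2, h3]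
    exact F.energy_le p hr hd.hasDerivAt
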